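/- Let φ be a conformal mapping from the unit disk Δ onto a simply connected domain Ω ⊊ ℂ. Then log φ′ belongs to BMOA(Δ) — equivalently, by the standard Carleson-measure characterization of BMOA, the measure |φ″(z)/φ′(z)|²(1 − |z|²) dx dy is a Carleson measure on Δ — if and only if the pull-back operator φ* is bounded from CM(Ω) to CM(Δ): for every Carleson measure μ on Ω, the measure (φ*μ)(A) = ∫_{φ(A)} |(φ⁻¹)′(w)| dμ(w) is a Carleson measure on Δ, with ‖φ*μ‖_* ≤ C‖μ‖_* for a constant C independent of μ. -/

import Mathlib

open MeasureTheory Metric Set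
open scoped ENNReal NNReal

/-- The open unit disk `Δ` in the complex plane. -/
def unitDisk : Set ℂ := Metric.ball (0 : ℂ) 1

/-- The Carleson "norm" `‖μ‖_* = sup { μ(Ω ∩ D(z,r))/r : z ∈ ∂Ω, 0 < r < diam ∂Ω }`
of a positive Borel measure relative to a domain `Ω`. -/
noncomputable def carlesonNorm (Ω : Set ℂ) (μ : Measure ℂ) : ℝ≥0∞ :=
  ⨆ z ∈ frontier Ω, ⨆ r : ℝ,
    ⨆ (_ : 0 < r ∧ ENNReal.ofReal r < EMetric.diam (frontier Ω)),
      μ (Ω ∩ Metric.ball z r) / ENNReal.ofReal r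

/-- `μ` is a Carleson measure on `Ω`. -/
def IsCarleson (Ω : Set ℂ) (μ : Measure ℂ) : Prop :=
  carlesonNorm Ω μ < ⊤

/-- The push-forward `(φ⁻¹)* ν` of a measure `ν` on `D` under a conformal map `φ` of `D`:
the measure `A ↦ ∫_{φ⁻¹(A)} |φ′| dν`. -/
noncomputable def pushForward (D : Set ℂ) (φ : ℂ → ℂ) (ν : Measure ℂ) : Measure ℂ :=
  Measure.map φ ((ν.restrict D).withDensity fun z => (‖deriv φ z‖₊ : ℝ≥0∞))

/-- The measure `|φ″(z)/φ′(z)|² (1 - |z|²) dxdy` on the unit disk, whose Carleson property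
characterizes `log φ′ ∈ BMOA(Δ)`. -/
noncomputable def bmoaMeasure (φ : ℂ → ℂ) : Measure ℂ :=
  (MeasureTheory.volume.restrict unitDisk).withDensity fun z =>
    ENNReal.ofReal (‖deriv (deriv φ) z / deriv φ z‖ ^ 2 * (1 - ‖z‖ ^ 2))

section

open Filter Topology ComplexConjugate

/-! ## Univalent functions -/

lemma isOpen_image_of_injOn {f : ℂ → ℂ} (hf : DifferentiableOn ℂ f (ball 0 1))
    (hinj : InjOn f (ball 0 1)) {s : Set ℂ} (hs : s ⊆ ball 0 1) (hso : IsOpen s) :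
    IsOpen (f '' s) := by
  rcases (hf.analyticOnNhd isOpen_ball).is_constant_or_isOpen
    (convex_ball (0 : ℂ) 1).isPreconnected with ⟨w, hw⟩ | h
  · have h0 : (0 : ℂ) ∈ ball (0 : ℂ) 1 := by simp
    have h1 : (1 / 2 : ℂ) ∈ ball (0 : ℂ) 1 := by simp; norm_num
    have := hinj h0 h1 ((hw _ h0).trans (hw _ h1).symm)
    norm_num at this
  · exact h s hs hso

lemma continuousAt_inverse_of_injOn {f g : ℂ → ℂ} (hf : DifferentiableOn ℂ f (ball 0 1))
    (hinj : InjOn f (ball 0 1)) (hg : ∀ z ∈ ball (0 : ℂ) 1, g (f z) = z) {z : ℂ}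
    (hz : z ∈ ball (0 : ℂ) 1) : ContinuousAt g (f z) := by
  rw [ContinuousAt, hg z hz]
  refine tendsto_def.2 fun V hV => ?_
  obtain ⟨W, hWV, hWo, hzW⟩ := _root_.mem_nhds_iff.1 hV
  have ho := isOpen_image_of_injOn hf hinj (s := W ∩ ball 0 1) inter_subset_right
    (hWo.inter isOpen_ball)
  have : f z ∈ f '' (W ∩ ball 0 1) := ⟨z, ⟨hzW, hz⟩, rfl⟩
  filter_upwards [ho.mem_nhds this]
  rintro _ ⟨y, hy, rfl⟩
  rw [mem_preimage, hg y hy.2]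
  exact hWV hy.1

lemma deriv_ne_zero_of_injOn {f : ℂ → ℂ} (hf : DifferentiableOn ℂ f (ball 0 1))
    (hinj : InjOn f (ball 0 1)) {z : ℂ} (hz : z ∈ ball (0 : ℂ) 1) : deriv f z ≠ 0 := by
  intro h0
  obtain ⟨g, hg⟩ : ∃ g : ℂ → ℂ, ∀ z ∈ ball (0 : ℂ) 1, g (f z) = z :=
    ⟨Function.invFunOn f (ball 0 1), fun z hz => hinj.leftInvOn_invFunOn hz⟩
  have hzn : ball (0 : ℂ) 1 ∈ 𝓝 z := isOpen_ball.mem_nhds hz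
  have hda : AnalyticAt ℂ (deriv f) z := (hf.analyticAt hzn).deriv
  rcases hda.eventually_eq_zero_or_eventually_ne_zero with h | h
  · obtain ⟨ε, hε, hb⟩ := Metric.eventually_nhds_iff_ball.1 (h.and hzn)
    have hc : ∀ x ∈ ball z ε, f x = f z := by
      intro x hx
      refine (convex_ball z ε).is_const_of_fderivWithin_eq_zero (𝕜 := ℂ)
        (fun y hy => (hf.differentiableAt (isOpen_ball.mem_nhds
          (hb y hy).2)).differentiableWithinAt) ?_ hx (mem_ball_self hε)
      intro y hy
      rw [fderivWithin_of_isOpen isOpen_ball hy]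
      ext
      simp [(hb y hy).1]
    have hx : z + (ε / 2 : ℝ) ∈ ball z ε := by
      simp only [mem_ball, dist_self_add_left, Complex.norm_real, Real.norm_eq_abs]
      rw [abs_of_pos (by positivity)]; linarith
    have := hinj (hb _ hx).2 hz (hc _ hx)
    simp at this
    exact hε.ne' this
  · rw [eventually_nhdsWithin_iff] at h
    obtain ⟨ε, hε, hb⟩ := Metric.eventually_nhds_iff_ball.1 (h.and hzn)
    have hbs : ball z ε ⊆ ball 0 1 := fun y hy => (hb y hy).2
    have ho := isOpen_image_of_injOn hf hinj hbs isOpen_ball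
    have hmem : f z ∈ f '' ball z ε := ⟨z, mem_ball_self hε, rfl⟩
    have hd : DifferentiableOn ℂ g (f '' ball z ε) := by
      rw [← Complex.differentiableOn_compl_singleton_and_continuousAt_iff (ho.mem_nhds hmem)]
      refine ⟨?_, continuousAt_inverse_of_injOn hf hinj hg hz⟩
      rintro _ ⟨⟨y, hy, rfl⟩, hne⟩
      have hyz : y ≠ z := fun h => hne (by simp [h])
      have hy1 := hbs hy
      refine (HasDerivAt.of_local_left_inverse (f := f) (f' := deriv f y)
        (continuousAt_inverse_of_injOn hf hinj hg hy1) ?_ ((hb y hy).1 hyz)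
        ?_).differentiableAt.differentiableWithinAt
      · rw [hg y hy1]
        exact (hf.differentiableAt (isOpen_ball.mem_nhds hy1)).hasDerivAt
      · filter_upwards [ho.mem_nhds ⟨y, hy, rfl⟩]
        rintro _ ⟨x, hx, rfl⟩
        rw [hg x (hbs hx)]
    have h1 : HasDerivAt (g ∘ f) (deriv g (f z) * deriv f z) z :=
      (hd.differentiableAt (ho.mem_nhds hmem)).hasDerivAt.comp z
        (hf.differentiableAt hzn).hasDerivAt
    have h2 : HasDerivAt (g ∘ f) 1 z := by
      refine (hasDerivAt_id z).congr_of_eventuallyEq ?_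
      filter_upwards [hzn] with x hx using hg x hx
    have := h1.unique h2
    simp [h0] at this

lemma hasDerivAt_inverse_of_injOn {f g : ℂ → ℂ} (hf : DifferentiableOn ℂ f (ball 0 1))
    (hinj : InjOn f (ball 0 1)) (hg : ∀ z ∈ ball (0 : ℂ) 1, g (f z) = z) {z : ℂ}
    (hz : z ∈ ball (0 : ℂ) 1) : HasDerivAt g (deriv f z)⁻¹ (f z) := by
  refine HasDerivAt.of_local_left_inverse (f := f) (continuousAt_inverse_of_injOn hf hinj hg hz) ?_
    (deriv_ne_zero_of_injOn hf hinj hz) ?_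
  · rw [hg z hz]
    exact (hf.differentiableAt (isOpen_ball.mem_nhds hz)).hasDerivAt
  · have ho := isOpen_image_of_injOn hf hinj subset_rfl isOpen_ball
    filter_upwards [ho.mem_nhds ⟨z, hz, rfl⟩]
    rintro _ ⟨x, hx, rfl⟩
    rw [hg x hx]

/-- A zero-free holomorphic function on the disk has a holomorphic logarithm. -/
lemma exists_log_of_ne_zero {f : ℂ → ℂ} (hf : DifferentiableOn ℂ f (ball 0 1))
    (h0 : ∀ z ∈ ball (0 : ℂ) 1, f z ≠ 0) :
    ∃ l : ℂ → ℂ, (∀ z ∈ ball (0 : ℂ) 1, HasDerivAt l (deriv f z / f z) z) ∧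
      ∀ z ∈ ball (0 : ℂ) 1, Complex.exp (l z) = f z := by
  have hd : DifferentiableOn ℂ (fun z => deriv f z / f z) (ball 0 1) :=
    (hf.deriv isOpen_ball).div hf h0
  obtain ⟨l, hl0, hl⟩ := hd.isExactOn_ball.with_val_at 0 (Complex.log (f 0))
  refine ⟨l, hl, ?_⟩
  have hz0 : (0 : ℂ) ∈ ball (0 : ℂ) 1 := by simp
  have key : ∀ z ∈ ball (0 : ℂ) 1, HasDerivAt (fun z => Complex.exp (l z) / f z) 0 z := by
    intro z hz
    have h1 := ((hl z hz).cexp.div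
      (hf.differentiableAt (isOpen_ball.mem_nhds hz)).hasDerivAt (h0 z hz))
    have := h0 z hz
    refine h1.congr_deriv ?_
    field_simp
    ring
  intro z hz
  have hc := (convex_ball (0 : ℂ) 1).is_const_of_fderivWithin_eq_zero (𝕜 := ℂ)
    (f := fun z => Complex.exp (l z) / f z)
    (fun y hy => (key y hy).differentiableAt.differentiableWithinAt) (fun y hy => by
      rw [fderivWithin_of_isOpen isOpen_ball hy]
      ext
      simp [(key y hy).deriv]) hz hz0
  simp only [hl0, Complex.exp_log (h0 0 hz0), div_self (h0 0 hz0)] at hc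
  rwa [div_eq_one_iff_eq (h0 z hz)] at hc

/-- `K` is admissible in the Koebe inequality for univalent functions bounded by `B`
whose derivative at the origin is at least `m`. -/
def KoebeBound (B m K : ℝ) : Prop :=
  ∀ f : ℂ → ℂ, DifferentiableOn ℂ f (ball 0 1) → InjOn f (ball 0 1) →
    (∀ z ∈ ball (0 : ℂ) 1, ‖f z - f 0‖ ≤ B) → m ≤ ‖deriv f 0‖ →
    ∀ w, w ∉ f '' ball 0 1 → ‖deriv f 0‖ ≤ K * ‖f 0 - w‖

lemma norm_deriv_le_of_bound {f : ℂ → ℂ} {B : ℝ} (hf : DifferentiableOn ℂ f (ball 0 1))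
    (hB : ∀ z ∈ ball (0 : ℂ) 1, ‖f z - f 0‖ ≤ B) : ‖deriv f 0‖ ≤ B := by
  have := Complex.norm_deriv_le_div_of_mapsTo_ball (R₂ := B) hf
    (fun z hz => by rw [mem_closedBall, dist_eq_norm]; exact hB z hz) one_pos
  simpa using this

lemma exists_koebeBound {B m : ℝ} (hB : 0 < B) (hm : 0 < m) :
    ∃ K, 1 ≤ K ∧ KoebeBound B m K := by
  set ρ := min (m / (2 * (2 * B))) (1 / 2) with hρ
  have hρ0 : 0 < ρ := by positivity
  have hρ1 : ρ ≤ 1 / 2 := min_le_right _ _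
  have hρ2 : 2 * B * ρ ≤ m / 2 := by
    have : ρ ≤ m / (2 * (2 * B)) := min_le_left _ _
    rw [le_div_iff₀ (by positivity)] at this
    linarith
  set ε := ρ * (m / 2) with hε
  have hε0 : 0 < ε := by positivity
  refine ⟨max 1 (2 * B / ε), le_max_left _ _, ?_⟩
  intro f hf hinj hbd hfm w hw
  have h0 : (0 : ℂ) ∈ ball (0 : ℂ) 1 := by simp
  have hsub : closedBall (0 : ℂ) ρ ⊆ ball 0 1 := closedBall_subset_ball (by linarith)
  have hmaps : MapsTo f (ball 0 1) (closedBall (f 0) B) := fun z hz => by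
    rw [mem_closedBall, dist_eq_norm]; exact hbd z hz
  have hlow : ∀ z ∈ sphere (0 : ℂ) ρ, ε ≤ ‖f z - f 0‖ := by
    intro z hz
    have hz1 : z ∈ ball (0 : ℂ) 1 := hsub (sphere_subset_closedBall hz)
    have hzn : ‖z‖ = ρ := by simpa using hz
    have hz0 : z ≠ 0 := by
      rintro rfl; simp at hzn; linarith
    have hgd : DifferentiableOn ℂ (dslope f 0) (ball 0 1) :=
      (Complex.differentiableOn_dslope (isOpen_ball.mem_nhds h0)).2 hf
    have hgb : ∀ y ∈ ball (0 : ℂ) 1, ‖dslope f 0 y‖ ≤ B := fun y hy => by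
      simpa using Complex.norm_dslope_le_div_of_mapsTo_ball hf hmaps hy
    have h1 := Complex.dist_le_div_mul_dist_of_mapsTo_ball (R₂ := 2 * B) hgd
      (fun y hy => by
        rw [mem_closedBall, dist_eq_norm]
        calc _ ≤ ‖dslope f 0 y‖ + ‖dslope f 0 0‖ := norm_sub_le _ _
          _ ≤ 2 * B := by linarith [hgb y hy, hgb 0 h0]) hz1
    rw [dslope_same, dist_eq_norm, dist_zero_right, hzn, div_one] at h1
    have h2 : f z - f 0 = z * dslope f 0 z := by
      have := sub_smul_dslope f 0 z
      simpa using this.symm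
    rw [h2, norm_mul, hzn]
    have h3 : ‖deriv f 0‖ ≤ ‖dslope f 0 z‖ + ‖dslope f 0 z - deriv f 0‖ := by
      rw [← norm_neg (dslope f 0 z - deriv f 0)]
      calc _ = ‖dslope f 0 z + -(dslope f 0 z - deriv f 0)‖ := by congr 1; ring
        _ ≤ _ := norm_add_le _ _
    exact mul_le_mul_of_nonneg_left (by linarith) hρ0.le
  have hfreq : ∃ᶠ z in 𝓝 (0 : ℂ), f z ≠ f 0 := by
    have h2 : ∀ᶠ z in 𝓝[≠] (0 : ℂ), f z ≠ f 0 := by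
      rw [eventually_nhdsWithin_iff]
      filter_upwards [isOpen_ball.mem_nhds h0] with z hz hne heq
      exact hne (hinj hz h0 heq)
    exact h2.frequently.filter_mono nhdsWithin_le_nhds
  have himg := (hf.diffContOnCl_ball hsub).ball_subset_image_closedBall hρ0 hlow hfreq
  have hw2 : ε / 2 ≤ ‖f 0 - w‖ := by
    by_contra! hlt
    obtain ⟨y, hy, hyw⟩ := himg (show w ∈ ball (f 0) (ε / 2) by
      rwa [mem_ball, dist_comm, dist_eq_norm])
    exact hw ⟨y, hsub hy, hyw⟩
  calc ‖deriv f 0‖ ≤ B := norm_deriv_le_of_bound hf hbd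
    _ = (2 * B / ε) * (ε / 2) := by field_simp
    _ ≤ max 1 (2 * B / ε) * ‖f 0 - w‖ := by gcongr; exact le_max_right _ _

lemma KoebeBound.sqrt {B m K : ℝ} (hB : 8 ≤ B) (hm : 0 < m) (hm4 : m ≤ 1 / 4) (hK1 : 1 ≤ K)
    (hK : KoebeBound B m K) : KoebeBound B m (√(32 * K)) := by
  intro f hf hinj hbd hfm w hw
  have h0 : (0 : ℂ) ∈ ball (0 : ℂ) 1 := by simp
  have hfB := norm_deriv_le_of_bound hf hbd
  have hne : ∀ z ∈ ball (0 : ℂ) 1, f z - w ≠ 0 := fun z hz h =>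
    hw ⟨z, hz, sub_eq_zero.1 h⟩
  set d := ‖f 0 - w‖ with hd
  have hd0 : 0 < d := norm_pos_iff.2 (hne 0 h0)
  have hK1' : 1 ≤ √(32 * K) := Real.one_le_sqrt.2 (by linarith)
  rcases le_or_gt ‖deriv f 0‖ d with hle | hgt
  · nlinarith
  obtain ⟨l, hl, hle⟩ := exists_log_of_ne_zero (f := fun z => f z - w) (hf.sub_const w) hne
  set h : ℂ → ℂ := fun z => Complex.exp (l z / 2) with hh
  have hsq : ∀ z ∈ ball (0 : ℂ) 1, h z ^ 2 = f z - w := by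
    intro z hz
    rw [hh, ← hle z hz, ← Complex.exp_nat_mul]; congr 1; push_cast; ring
  have hh0 : ∀ z, h z ≠ 0 := fun z => Complex.exp_ne_zero _
  have hhd : ∀ z ∈ ball (0 : ℂ) 1, HasDerivAt h (deriv f z / (2 * h z)) z := by
    intro z hz
    have h1 := ((hl z hz).div_const 2).cexp
    refine h1.congr_deriv ?_
    rw [deriv_sub_const, ← hsq z hz]
    have := hh0 z
    change h z * _ = _
    field_simp
  have hhD : DifferentiableOn ℂ h (ball 0 1) := fun z hz =>
    (hhd z hz).differentiableAt.differentiableWithinAt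
  have hhinj : InjOn h (ball 0 1) := by
    intro x hx y hy hxy
    refine hinj hx hy ?_
    have : h x ^ 2 = h y ^ 2 := by rw [hxy]
    rw [hsq x hx, hsq y hy] at this
    exact sub_left_inj.1 this
  have hn0 : ‖h 0‖ ^ 2 = d := by rw [← norm_pow, hsq 0 h0]
  have hnz : ∀ z ∈ ball (0 : ℂ) 1, ‖h z‖ ^ 2 ≤ 2 * B := by
    intro z hz
    rw [← norm_pow, hsq z hz]
    calc ‖f z - w‖ = ‖(f z - f 0) + (f 0 - w)‖ := by congr 1; ring
      _ ≤ ‖f z - f 0‖ + ‖f 0 - w‖ := norm_add_le _ _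
      _ ≤ 2 * B := by linarith [hbd z hz]
  have hhB : ∀ z ∈ ball (0 : ℂ) 1, ‖h z - h 0‖ ≤ B := by
    intro z hz
    have h1 : ∀ y ∈ ball (0 : ℂ) 1, ‖h y‖ ≤ B / 2 := fun y hy =>
      abs_le_of_sq_le_sq' (by nlinarith [hnz y hy]) (by linarith) |>.2
    linarith [norm_sub_le (h z) (h 0), h1 z hz, h1 0 h0]
  have hpos : 0 < ‖h 0‖ := norm_pos_iff.2 (hh0 0)
  have hder : ‖deriv h 0‖ = ‖deriv f 0‖ / (2 * ‖h 0‖) := by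
    rw [(hhd 0 h0).deriv]; simp
  have hf0 : 0 < ‖deriv f 0‖ := by linarith
  have hhm : m ≤ ‖deriv h 0‖ := by
    rw [hder, le_div_iff₀ (by positivity)]
    have : (m * (2 * ‖h 0‖)) ^ 2 ≤ ‖deriv f 0‖ ^ 2 := by
      have : (m * (2 * ‖h 0‖)) ^ 2 = 4 * m ^ 2 * d := by rw [← hn0]; ring
      rw [this]
      nlinarith [mul_le_mul hfm hgt.le hd0.le hf0.le, mul_pos hm hd0]
    exact abs_le_of_sq_le_sq' this (by positivity) |>.2
  have hlow : ∀ z ∈ ball (0 : ℂ) 1, ‖deriv h 0‖ ≤ K * ‖h z + h 0‖ := by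
    intro z hz
    have := hK h hhD hhinj hhB hhm (-h z) (by
      rintro ⟨y, hy, hyz⟩
      have h1 : h y ^ 2 = h z ^ 2 := by rw [hyz]; ring
      rw [hsq y hy, hsq z hz] at h1
      have := hinj hy hz (sub_left_inj.1 h1)
      subst this
      have h2 : 2 * h y = 0 := by linear_combination hyz
      simp [hh0] at h2)
    rw [sub_neg_eq_add, add_comm] at this
    exact this
  have hder0 : 0 < ‖deriv h 0‖ := by linarith
  have hp : DifferentiableOn ℂ (fun z => (h z + h 0)⁻¹) (ball 0 1) :=
    (hhD.add_const _).inv fun z hz hz0 => by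
      have := hlow z hz
      rw [hz0] at this; simp at this
      exact hder0.ne' (by simpa using this)
  have hpb : ∀ z ∈ ball (0 : ℂ) 1, ‖(h z + h 0)⁻¹‖ ≤ K / ‖deriv h 0‖ := by
    intro z hz
    have h1 := hlow z hz
    have h2 : 0 < ‖h z + h 0‖ := by
      by_contra! h3
      nlinarith
    rw [norm_inv, le_div_iff₀ hder0, inv_mul_le_iff₀ h2, mul_comm]
    exact h1
  have hpd := norm_deriv_le_of_bound (B := 2 * (K / ‖deriv h 0‖)) hp fun z hz => by
    linarith [norm_sub_le ((h z + h 0)⁻¹) ((h 0 + h 0)⁻¹), hpb z hz, hpb 0 h0]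
  have hpe : deriv (fun z => (h z + h 0)⁻¹) 0 = - deriv h 0 / (h 0 + h 0) ^ 2 :=
    (((hhd 0 h0).differentiableAt.hasDerivAt.add_const (h 0)).inv (by
      rw [← two_mul]; simp [hh0])).deriv
  have hnn : ‖(h 0 + h 0) ^ 2‖ = 4 * d := by
    rw [← hn0, ← two_mul, norm_pow, norm_mul]; norm_num; ring
  rw [hpe, norm_div, norm_neg, hnn, div_le_iff₀ (by positivity)] at hpd
  have h5 : ‖deriv h 0‖ ^ 2 ≤ 8 * K * d := by
    have : 2 * (K / ‖deriv h 0‖) * (4 * d) * ‖deriv h 0‖ = 8 * K * d := by field_simp; ring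
    rw [sq, ← this]; gcongr
  have h6 : ‖deriv h 0‖ ^ 2 * (4 * d) = ‖deriv f 0‖ ^ 2 := by
    rw [hder, ← hn0]; field_simp; ring
  have h7 : ‖deriv f 0‖ ^ 2 ≤ (√(32 * K) * d) ^ 2 := by
    rw [mul_pow, Real.sq_sqrt (by positivity), ← h6]
    nlinarith
  exact abs_le_of_sq_le_sq' h7 (by positivity) |>.2

lemma koebeBound_thirty_two {B m : ℝ} (hB : 8 ≤ B) (hm : 0 < m) (hm4 : m ≤ 1 / 4) :
    KoebeBound B m 32 := by
  set V := {K : ℝ | 1 ≤ K ∧ KoebeBound B m K} with hV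
  have hne : V.Nonempty := exists_koebeBound (by linarith) hm
  have hbdd : BddBelow V := ⟨1, fun K hK => hK.1⟩
  have hI1 : 1 ≤ sInf V := le_csInf hne fun K hK => hK.1
  have hI : sInf V ≤ 32 := by
    by_contra! hlt
    obtain ⟨K, hK, hKl⟩ := exists_lt_of_csInf_lt hne
      (show sInf V < sInf V ^ 2 / 32 by nlinarith)
    have hmem : √(32 * K) ∈ V :=
      ⟨Real.one_le_sqrt.2 (by linarith [hK.1]), hK.2.sqrt hB hm hm4 hK.1⟩
    have h1 := csInf_le hbdd hmem
    have h2 : √(32 * K) < sInf V := by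
      rw [Real.sqrt_lt' (by linarith)]; linarith
    linarith
  intro f hf hinj hbd hfm w hw
  have hd0 : 0 < ‖f 0 - w‖ := norm_pos_iff.2 fun h => hw ⟨0, by simp, sub_eq_zero.1 h⟩
  have : ‖deriv f 0‖ / ‖f 0 - w‖ ≤ sInf V := le_csInf hne fun K hK => by
    rw [div_le_iff₀ hd0]; exact hK.2 f hf hinj hbd hfm w hw
  rw [div_le_iff₀ hd0] at this
  nlinarith

/-- Koebe distortion at the origin, with a non-sharp constant. -/
theorem koebe_zero {f : ℂ → ℂ} (hf : DifferentiableOn ℂ f (ball 0 1))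
    (hinj : InjOn f (ball 0 1)) {w : ℂ} (hw : w ∉ f '' ball 0 1) :
    ‖deriv f 0‖ ≤ 32 * ‖f 0 - w‖ := by
  have h0 : (0 : ℂ) ∈ ball (0 : ℂ) 1 := by simp
  have hd0 : 0 < ‖deriv f 0‖ := norm_pos_iff.2 (deriv_ne_zero_of_injOn hf hinj h0)
  have key : ∀ s ∈ Ioo (0 : ℝ) 1, s * ‖deriv f 0‖ ≤ 32 * ‖f 0 - w‖ := by
    rintro s ⟨hs0, hs1⟩
    have hmaps : ∀ z ∈ ball (0 : ℂ) 1, (s : ℂ) * z ∈ closedBall (0 : ℂ) s := by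
      intro z hz
      rw [mem_ball_zero_iff] at hz
      rw [mem_closedBall_zero_iff, norm_mul, Complex.norm_real, Real.norm_eq_abs, abs_of_pos hs0]
      nlinarith
    have hcs : closedBall (0 : ℂ) s ⊆ ball 0 1 := closedBall_subset_ball hs1
    obtain ⟨C, hC⟩ := (isCompact_closedBall (0 : ℂ) s).exists_bound_of_continuousOn
      (f := fun z => f z - f 0) ((hf.continuousOn.mono hcs).sub continuousOn_const)
    have hder : ∀ z ∈ ball (0 : ℂ) 1,
        HasDerivAt (fun z => f (s * z)) (deriv f (s * z) * s) z := by
      intro z hz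
      have h1 := (hf.differentiableAt (isOpen_ball.mem_nhds (hcs (hmaps z hz)))).hasDerivAt
      have h2 : HasDerivAt (fun z : ℂ => (s : ℂ) * z) s z := by
        simpa using (hasDerivAt_id z).const_mul (s : ℂ)
      exact h1.comp z h2
    have hn : ‖deriv (fun z => f (s * z)) 0‖ = s * ‖deriv f 0‖ := by
      rw [(hder 0 h0).deriv, norm_mul, Complex.norm_real, Real.norm_eq_abs, abs_of_pos hs0,
        mul_zero, mul_comm]
    have := koebeBound_thirty_two (B := max 8 C) (m := min (1 / 4) (s * ‖deriv f 0‖))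
      (le_max_left _ _) (by positivity) (min_le_left _ _) (fun z => f (s * z))
      (fun z hz => (hder z hz).differentiableAt.differentiableWithinAt)
      (fun x hx y hy hxy => by
        have := hinj (hcs (hmaps x hx)) (hcs (hmaps y hy)) hxy
        exact mul_left_cancel₀ (by exact_mod_cast hs0.ne') this)
      (fun z hz => by
        simpa using (hC _ (hmaps z hz)).trans (le_max_right 8 C))
          (by rw [hn]; exact min_le_right _ _) w
      (by
        rintro ⟨y, hy, hyw⟩
        exact hw ⟨_, hcs (hmaps y hy), hyw⟩)
    rw [hn] at this
    simpa using this
  have hlim : Tendsto (fun s : ℝ => s * ‖deriv f 0‖) (𝓝[<] 1) (𝓝 (1 * ‖deriv f 0‖)) :=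
    ((continuous_id.mul continuous_const).tendsto 1).mono_left nhdsWithin_le_nhds
  rw [one_mul] at hlim
  refine le_of_tendsto hlim ?_
  filter_upwards [Ioo_mem_nhdsLT (show (0 : ℝ) < 1 by norm_num)] with s hs using key s hs

/-! ## Disk automorphisms -/

/-- The disk automorphism `z ↦ (z + b) / (1 + b̄ z)`. -/
noncomputable def mob (b z : ℂ) : ℂ := (z + b) / (1 + conj b * z)

lemma one_sub_le_norm_den {b z : ℂ} (hz : ‖z‖ ≤ 1) : 1 - ‖b‖ ≤ ‖1 + conj b * z‖ := by
  have h1 : ‖conj b * z‖ ≤ ‖b‖ := by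
    rw [norm_mul, Complex.norm_conj]; nlinarith [norm_nonneg b]
  have h2 := norm_sub_norm_le (1 : ℂ) (-(conj b * z))
  rw [norm_neg, norm_one, sub_neg_eq_add] at h2
  linarith

lemma den_pos {b z : ℂ} (hb : ‖b‖ < 1) (hz : ‖z‖ ≤ 1) : 0 < ‖1 + conj b * z‖ := by
  linarith [one_sub_le_norm_den (b := b) hz]

lemma den_ne_zero {b z : ℂ} (hb : ‖b‖ < 1) (hz : ‖z‖ ≤ 1) : 1 + conj b * z ≠ 0 :=
  norm_pos_iff.1 (den_pos hb hz)

lemma normSq_den_sub (b z : ℂ) :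
    ‖1 + conj b * z‖ ^ 2 - ‖z + b‖ ^ 2 = (1 - ‖b‖ ^ 2) * (1 - ‖z‖ ^ 2) := by
  simp only [← Complex.normSq_eq_norm_sq, Complex.normSq_apply]
  simp
  ring

lemma one_sub_normSq_mob {b z : ℂ} (hb : ‖b‖ < 1) (hz : ‖z‖ ≤ 1) :
    1 - ‖mob b z‖ ^ 2 = (1 - ‖b‖ ^ 2) * (1 - ‖z‖ ^ 2) / ‖1 + conj b * z‖ ^ 2 := by
  have := den_pos hb hz
  rw [← normSq_den_sub, mob, norm_div, sub_div, div_self (by positivity), div_pow]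

lemma mob_mem_ball {b z : ℂ} (hb : ‖b‖ < 1) (hz : ‖z‖ < 1) : ‖mob b z‖ < 1 := by
  have h1 := one_sub_normSq_mob hb hz.le
  have h2 : 0 < (1 - ‖b‖ ^ 2) * (1 - ‖z‖ ^ 2) / ‖1 + conj b * z‖ ^ 2 := by
    have := den_pos hb hz.le
    have h3 : 0 < 1 - ‖b‖ ^ 2 := by nlinarith [norm_nonneg b]
    have h4 : 0 < 1 - ‖z‖ ^ 2 := by nlinarith [norm_nonneg z]
    positivity
  nlinarith [norm_nonneg (mob b z)]

lemma norm_mob_eq_one {b z : ℂ} (hb : ‖b‖ < 1) (hz : ‖z‖ = 1) : ‖mob b z‖ = 1 := by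
  have h1 := one_sub_normSq_mob hb hz.le
  rw [hz] at h1
  have h2 : ‖mob b z‖ ^ 2 = 1 := by
    have : 1 - ‖mob b z‖ ^ 2 = 0 := by rw [h1]; simp
    linarith
  nlinarith [norm_nonneg (mob b z)]

lemma norm_mob_le_one {b z : ℂ} (hb : ‖b‖ < 1) (hz : ‖z‖ ≤ 1) : ‖mob b z‖ ≤ 1 := by
  rcases hz.lt_or_eq with h | h
  · exact (mob_mem_ball hb h).le
  · exact (norm_mob_eq_one hb h).le

@[simp] lemma mob_zero (b : ℂ) : mob b 0 = b := by simp [mob]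

lemma mob_neg_mob {b z : ℂ} (hb : ‖b‖ < 1) (hz : ‖z‖ ≤ 1) : mob (-b) (mob b z) = z := by
  have h1 := den_ne_zero hb hz
  have h2 := den_ne_zero (b := -b) (by simpa using hb) (norm_mob_le_one hb hz)
  rw [mob, div_eq_iff h2, mob]
  simp only [map_neg]
  rw [mul_comm (conj b) z] at *
  field_simp
  ring

lemma mob_mob_neg {b z : ℂ} (hb : ‖b‖ < 1) (hz : ‖z‖ ≤ 1) : mob b (mob (-b) z) = z := by
  simpa using mob_neg_mob (b := -b) (by simpa using hb) hz

@[simp] lemma mob_neg_self (b : ℂ) : mob (-b) b = 0 := by simp [mob]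

lemma hasDerivAt_mob {b z : ℂ} (hb : ‖b‖ < 1) (hz : ‖z‖ ≤ 1) :
    HasDerivAt (mob b) ((1 - ‖b‖ ^ 2 : ℝ) / (1 + conj b * z) ^ 2) z := by
  have h1 := den_ne_zero hb hz
  have h2 : HasDerivAt (fun z : ℂ => 1 + conj b * z) (conj b) z := by
    simpa using ((hasDerivAt_id z).const_mul (conj b)).const_add 1
  refine (((hasDerivAt_id z).add_const b).div h2 h1).congr_deriv ?_
  congr 1
  have : ((‖b‖ ^ 2 : ℝ) : ℂ) = b * conj b := by
    rw [Complex.mul_conj, Complex.normSq_eq_norm_sq]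
  push_cast at this ⊢
  rw [this]
  simp
  ring

lemma norm_deriv_mob {b z : ℂ} (hb : ‖b‖ < 1) (hz : ‖z‖ ≤ 1) :
    ‖deriv (mob b) z‖ = (1 - ‖b‖ ^ 2) / ‖1 + conj b * z‖ ^ 2 := by
  rw [(hasDerivAt_mob hb hz).deriv, norm_div, norm_pow, Complex.norm_real, Real.norm_eq_abs,
    abs_of_pos (by nlinarith [norm_nonneg b])]

lemma differentiableOn_mob {b : ℂ} (hb : ‖b‖ < 1) : DifferentiableOn ℂ (mob b) (ball 0 1) :=
  fun _ hz =>
    (hasDerivAt_mob hb (mem_ball_zero_iff.1 hz).le).differentiableAt.differentiableWithinAt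

lemma injOn_mob {b : ℂ} (hb : ‖b‖ < 1) : InjOn (mob b) (closedBall 0 1) :=
  LeftInvOn.injOn (f₁' := mob (-b)) fun _ hz => mob_neg_mob hb (mem_closedBall_zero_iff.1 hz)

lemma mapsTo_mob {b : ℂ} (hb : ‖b‖ < 1) : MapsTo (mob b) (ball 0 1) (ball 0 1) :=
  fun _ hz => mem_ball_zero_iff.2 (mob_mem_ball hb (mem_ball_zero_iff.1 hz))

lemma image_mob {b : ℂ} (hb : ‖b‖ < 1) : mob b '' ball 0 1 = ball 0 1 := by
  refine Subset.antisymm (mapsTo_mob hb).image_subset fun z hz => ?_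
  exact ⟨mob (-b) z, mapsTo_mob (by simpa using hb) hz, mob_mob_neg hb (mem_ball_zero_iff.1 hz).le⟩

section Comp
variable {f : ℂ → ℂ} {b : ℂ}

lemma DifferentiableOn.comp_mob (hf : DifferentiableOn ℂ f (ball 0 1)) (hb : ‖b‖ < 1) :
    DifferentiableOn ℂ (f ∘ mob b) (ball 0 1) :=
  hf.comp (differentiableOn_mob hb) (mapsTo_mob hb)

lemma Set.InjOn.comp_mob (hf : InjOn f (ball 0 1)) (hb : ‖b‖ < 1) :
    InjOn (f ∘ mob b) (ball 0 1) :=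
  hf.comp ((injOn_mob hb).mono ball_subset_closedBall) (mapsTo_mob hb)

lemma image_comp_mob (hb : ‖b‖ < 1) : (f ∘ mob b) '' ball 0 1 = f '' ball 0 1 := by
  rw [image_comp, image_mob hb]

lemma deriv_comp_mob (hf : DifferentiableOn ℂ f (ball 0 1)) (hb : ‖b‖ < 1) {z : ℂ}
    (hz : ‖z‖ < 1) : deriv (f ∘ mob b) z = deriv f (mob b z) * deriv (mob b) z :=
  deriv_comp z (hf.differentiableAt (isOpen_ball.mem_nhds
    (mapsTo_mob hb (mem_ball_zero_iff.2 hz)))) (hasDerivAt_mob hb hz.le).differentiableAt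

lemma norm_deriv_comp_mob_zero (hf : DifferentiableOn ℂ f (ball 0 1)) (hb : ‖b‖ < 1) :
    ‖deriv (f ∘ mob b) 0‖ = ‖deriv f b‖ * (1 - ‖b‖ ^ 2) := by
  rw [deriv_comp_mob hf hb (by simp), norm_mul, mob_zero, norm_deriv_mob hb (by simp)]
  simp

end Comp

/-! ## Distortion of univalent functions -/

theorem koebe {f : ℂ → ℂ} (hf : DifferentiableOn ℂ f (ball 0 1))
    (hinj : InjOn f (ball 0 1)) {w z : ℂ} (hw : w ∉ f '' ball 0 1) (hz : ‖z‖ < 1) :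
    ‖deriv f z‖ * (1 - ‖z‖ ^ 2) ≤ 32 * ‖f z - w‖ := by
  have := koebe_zero (hf.comp_mob hz) (hinj.comp_mob hz) (w := w) (by rwa [image_comp_mob hz])
  rwa [norm_deriv_comp_mob_zero hf hz, Function.comp_apply, mob_zero] at this

lemma exists_near_omitted_zero {f : ℂ → ℂ} (hf : DifferentiableOn ℂ f (ball 0 1))
    (hinj : InjOn f (ball 0 1)) (hne : f '' ball 0 1 ≠ univ) :
    ∃ w ∈ frontier (f '' ball 0 1), ‖f 0 - w‖ ≤ ‖deriv f 0‖ := by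
  have h0 : (0 : ℂ) ∈ ball (0 : ℂ) 1 := by simp
  have ho := isOpen_image_of_injOn hf hinj subset_rfl isOpen_ball
  have hcn : ((f '' ball 0 1)ᶜ).Nonempty := nonempty_compl.2 hne
  obtain ⟨w, hw, hwd⟩ := ho.isClosed_compl.exists_infDist_eq_dist hcn (f 0)
  have hd0 : 0 < dist (f 0) w := dist_pos.2 fun h => hw ⟨0, h0, h⟩
  have hsub : ball (f 0) (dist (f 0) w) ⊆ f '' ball 0 1 := by
    intro y hy
    by_contra hyn
    have h1 := infDist_le_dist_of_mem (x := f 0) (show y ∈ (f '' ball 0 1)ᶜ from hyn)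
    rw [hwd, dist_comm (f 0) y] at h1
    exact absurd (mem_ball.1 hy) (not_lt.2 h1)
  refine ⟨w, ?_, ?_⟩
  · rw [ho.frontier_eq]
    refine ⟨closure_mono hsub ?_, hw⟩
    rw [closure_ball _ hd0.ne', mem_closedBall, dist_comm]
  · obtain ⟨g, hg⟩ : ∃ g : ℂ → ℂ, ∀ z ∈ ball (0 : ℂ) 1, g (f z) = z :=
      ⟨Function.invFunOn f (ball 0 1), fun z hz => hinj.leftInvOn_invFunOn hz⟩
    have hgd : DifferentiableOn ℂ g (ball (f 0) (dist (f 0) w)) := fun y hy => by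
      obtain ⟨x, hx, rfl⟩ := hsub hy
      exact (hasDerivAt_inverse_of_injOn hf hinj hg hx).differentiableAt.differentiableWithinAt
    have := Complex.norm_deriv_le_div_of_mapsTo_ball (R₂ := 1) hgd (fun y hy => by
      obtain ⟨x, hx, rfl⟩ := hsub hy
      rw [hg x hx, hg 0 h0]
      exact ball_subset_closedBall hx) hd0
    rw [(hasDerivAt_inverse_of_injOn hf hinj hg h0).deriv, norm_inv, one_div] at this
    rw [← dist_eq_norm]
    exact (inv_le_inv₀ (norm_pos_iff.2 (deriv_ne_zero_of_injOn hf hinj h0)) hd0).1 this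

lemma norm_log_sub_le {f l : ℂ → ℂ} (hf : DifferentiableOn ℂ f (ball 0 1))
    (hinj : InjOn f (ball 0 1)) {w : ℂ} (hw : w ∉ f '' ball 0 1)
    (hl : ∀ z ∈ ball (0 : ℂ) 1, HasDerivAt l (deriv f z / (f z - w)) z) {z : ℂ} (hz : ‖z‖ < 1) :
    ‖l z - l 0‖ ≤ 16 * (Real.log (1 + ‖z‖) - Real.log (1 - ‖z‖)) := by
  set r := ‖z‖ with hr
  have hr0 : 0 ≤ r := norm_nonneg z
  have hmem : ∀ t ∈ Icc (0 : ℝ) 1, ‖(t : ℂ) * z‖ = t * r := by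
    intro t ht
    rw [norm_mul, Complex.norm_real, Real.norm_eq_abs, abs_of_nonneg ht.1]
  have hlt : ∀ t ∈ Icc (0 : ℝ) 1, t * r < 1 := fun t ht => by nlinarith [ht.1, ht.2]
  have hder : ∀ t ∈ Icc (0 : ℝ) 1, HasDerivAt (fun t : ℝ => l (t * z) - l 0)
      (deriv f (t * z) / (f (t * z) - w) * z) t := by
    intro t ht
    have h1 := hl (t * z) (by rw [mem_ball_zero_iff, hmem t ht]; exact hlt t ht)
    have h2 : HasDerivAt (fun t : ℝ => (t : ℂ) * z) z t := by
      simpa using (Complex.ofRealCLM.hasDerivAt (x := t)).mul_const z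
    exact (h1.comp t h2).sub_const _
  have hB : ∀ t ∈ Icc (0 : ℝ) 1, HasDerivAt
      (fun t : ℝ => 16 * (Real.log (1 + t * r) - Real.log (1 - t * r)))
      (16 * (r / (1 + t * r) + r / (1 - t * r))) t := by
    intro t ht
    have h3 := hlt t ht
    have h4 : 0 ≤ t * r := mul_nonneg ht.1 hr0
    have h1 : HasDerivAt (fun t : ℝ => 1 + t * r) r t := by
      simpa using ((hasDerivAt_id t).mul_const r).const_add 1
    have h2 : HasDerivAt (fun t : ℝ => 1 - t * r) (-r) t := by
      simpa using ((hasDerivAt_id t).mul_const r).const_sub 1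
    refine (((h1.log (by linarith)).sub (h2.log (by linarith))).const_mul 16).congr_deriv ?_
    ring
  have := image_norm_le_of_norm_deriv_right_le_deriv_boundary'
    (f := fun t : ℝ => l (t * z) - l 0) (a := 0) (b := 1)
    (fun t ht => (hder t ht).continuousAt.continuousWithinAt)
    (fun t ht => (hder t (Ico_subset_Icc_self ht)).hasDerivWithinAt)
    (B := fun t : ℝ => 16 * (Real.log (1 + t * r) - Real.log (1 - t * r)))
    (by simp) (fun t ht => (hB t ht).continuousAt.continuousWithinAt)
    (fun t ht => (hB t (Ico_subset_Icc_self ht)).hasDerivWithinAt) (by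
      intro t ht
      have ht' := Ico_subset_Icc_self ht
      have h3 := hlt t ht'
      have h4 : 0 ≤ t * r := mul_nonneg ht.1 hr0
      have hk := koebe hf hinj hw (z := t * z) (by rw [hmem t ht']; exact h3)
      rw [hmem t ht'] at hk
      have hpos : 0 < ‖f (t * z) - w‖ := norm_pos_iff.2 fun h =>
        hw ⟨_, by rw [mem_ball_zero_iff, hmem t ht']; exact h3, sub_eq_zero.1 h⟩
      rw [norm_mul, norm_div, ← hr]
      have h5 : 16 * (r / (1 + t * r) + r / (1 - t * r)) = 32 / (1 - (t * r) ^ 2) * r := by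
        have h7 : 1 - t * r ≠ 0 := by linarith
        have h6 : 1 + t * r ≠ 0 := by linarith
        rw [show 1 - (t * r) ^ 2 = (1 - t * r) * (1 + t * r) by ring]
        generalize t * r = x at h6 h7
        field_simp
        ring
      rw [h5]
      refine mul_le_mul_of_nonneg_right ?_ hr0
      rw [div_le_div_iff₀ hpos (by nlinarith)]
      exact hk) (right_mem_Icc.2 zero_le_one)
  simpa using this

lemma norm_sub_le_growth {f : ℂ → ℂ} (hf : DifferentiableOn ℂ f (ball 0 1))
    (hinj : InjOn f (ball 0 1)) {w : ℂ} (hw : w ∉ f '' ball 0 1) {z : ℂ} (hz : ‖z‖ < 1) :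
    ‖f z - w‖ ≤ ‖f 0 - w‖ * ((1 + ‖z‖) / (1 - ‖z‖)) ^ 16 := by
  have h0 : (0 : ℂ) ∈ ball (0 : ℂ) 1 := by simp
  obtain ⟨l, hl, hle⟩ := exists_log_of_ne_zero (f := fun z => f z - w) (hf.sub_const w)
    fun z hz h => hw ⟨z, hz, sub_eq_zero.1 h⟩
  simp only [deriv_sub_const] at hl
  have h1 := norm_log_sub_le hf hinj hw hl hz
  have h2 : (l z).re - (l 0).re ≤ ‖l z - l 0‖ := by
    rw [← Complex.sub_re]; exact (le_abs_self _).trans (Complex.abs_re_le_norm _)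
  rw [← hle z (mem_ball_zero_iff.2 hz), ← hle 0 h0, Complex.norm_exp, Complex.norm_exp]
  have hr0 := norm_nonneg z
  have h3 : ((1 + ‖z‖) / (1 - ‖z‖)) ^ 16 =
      Real.exp (16 * (Real.log (1 + ‖z‖) - Real.log (1 - ‖z‖))) := by
    rw [← Real.log_div (by linarith) (by linarith), mul_comm, Real.exp_mul,
      Real.exp_log (div_pos (by linarith) (by linarith))]
    norm_cast
  rw [h3, ← Real.exp_add]
  exact Real.exp_le_exp.2 (by linarith)

lemma norm_deriv_deriv_zero_le {f : ℂ → ℂ} (hf : DifferentiableOn ℂ f (ball 0 1))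
    (hinj : InjOn f (ball 0 1)) (hne : f '' ball 0 1 ≠ univ) :
    ‖deriv (deriv f) 0‖ ≤ 2 ^ 33 * ‖deriv f 0‖ := by
  have h0 : (0 : ℂ) ∈ ball (0 : ℂ) 1 := by simp
  obtain ⟨w, hw, hwd⟩ := exists_near_omitted_zero hf hinj hne
  rw [(isOpen_image_of_injOn hf hinj subset_rfl isOpen_ball).frontier_eq] at hw
  have hsub : ball (0 : ℂ) (1 / 2) ⊆ ball 0 1 := ball_subset_ball (by norm_num)
  have hb : ∀ z ∈ ball (0 : ℂ) (1 / 2), ‖deriv f z‖ ≤ 2 ^ 31 * ‖deriv f 0‖ := by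
    intro z hz
    have hz1 := mem_ball_zero_iff.1 (hsub hz)
    have hz2 := mem_ball_zero_iff.1 hz
    have hz3 := norm_nonneg z
    have h1 := koebe hf hinj hw.2 hz1
    have h2 := norm_sub_le_growth hf hinj hw.2 hz1
    have h3 : ((1 + ‖z‖) / (1 - ‖z‖)) ^ 16 ≤ 3 ^ 16 := by
      have : 0 < 1 - ‖z‖ := by linarith
      gcongr
      rw [div_le_iff₀ this]; linarith
    have h4 : ‖f z - w‖ ≤ ‖deriv f 0‖ * 3 ^ 16 := h2.trans (by gcongr)
    have h5 : ‖deriv f z‖ * (3 / 4) ≤ ‖deriv f z‖ * (1 - ‖z‖ ^ 2) := by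
      gcongr; nlinarith
    nlinarith [norm_nonneg (deriv f 0)]
  have := Complex.norm_deriv_le_div_of_mapsTo_ball (f := deriv f) (c := 0) (R₁ := 1 / 2)
    (R₂ := 2 * (2 ^ 31 * ‖deriv f 0‖)) ((hf.deriv isOpen_ball).mono hsub) (fun z hz => by
      rw [mem_closedBall, dist_eq_norm]
      linarith [norm_sub_le (deriv f z) (deriv f 0), hb z hz, hb 0 (by simp)]) (by norm_num)
  linarith

/-- Univalent functions have Bloch logarithmic derivative. -/
lemma bloch {f : ℂ → ℂ} (hf : DifferentiableOn ℂ f (ball 0 1))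
    (hinj : InjOn f (ball 0 1)) (hne : f '' ball 0 1 ≠ univ) {z : ℂ} (hz : ‖z‖ < 1) :
    ‖deriv (deriv f) z / deriv f z‖ * (1 - ‖z‖ ^ 2) ≤ 2 ^ 34 := by
  have h0 : (0 : ℂ) ∈ ball (0 : ℂ) 1 := by simp
  have hzb := mem_ball_zero_iff.2 hz
  have hq : 0 < 1 - ‖z‖ ^ 2 := by nlinarith [norm_nonneg z]
  have h1 := norm_deriv_deriv_zero_le (hf.comp_mob hz) (hinj.comp_mob hz)
    (by rwa [image_comp_mob hz])
  rw [norm_deriv_comp_mob_zero hf hz] at h1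
  set q : ℂ := ((1 - ‖z‖ ^ 2 : ℝ) : ℂ) with hqd
  have hqn : ‖q‖ = 1 - ‖z‖ ^ 2 := by
    rw [hqd, Complex.norm_real, Real.norm_eq_abs, abs_of_pos hq]
  have h2 : deriv (f ∘ mob z) =ᶠ[𝓝 0] fun y => deriv f (mob z y) * (q / (1 + conj z * y) ^ 2) := by
    filter_upwards [isOpen_ball.mem_nhds h0] with y hy
    have hy := mem_ball_zero_iff.1 hy
    rw [deriv_comp_mob hf hz hy, (hasDerivAt_mob hz hy.le).deriv]
  have h3 : HasDerivAt (deriv (f ∘ mob z)) (deriv (deriv f) z * q * q +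
      deriv f z * (- 2 * q * conj z)) 0 := by
    refine HasDerivAt.congr_of_eventuallyEq ?_ h2
    have h4 : HasDerivAt (fun y => deriv f (mob z y)) (deriv (deriv f) z * q) 0 := by
      have h5 : HasDerivAt (deriv f) (deriv (deriv f) z) (mob z 0) := by
        rw [mob_zero]
        exact ((hf.deriv isOpen_ball).differentiableAt (isOpen_ball.mem_nhds hzb)).hasDerivAt
      refine (h5.comp 0 (hasDerivAt_mob hz (by simp))).congr_deriv ?_
      simp [hqd]
    have h6 : HasDerivAt (fun y : ℂ => 1 + conj z * y) (conj z) 0 := by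
      simpa using ((hasDerivAt_id (0 : ℂ)).const_mul (conj z)).const_add 1
    have h7 : HasDerivAt (fun y : ℂ => q / (1 + conj z * y) ^ 2) (-2 * q * conj z) 0 := by
      refine ((hasDerivAt_const (0 : ℂ) q).div (h6.pow 2) (by simp)).congr_deriv ?_
      simp
      ring
    refine (h4.mul h7).congr_deriv ?_
    simp
  rw [h3.deriv] at h1
  have hd : 0 < ‖deriv f z‖ := norm_pos_iff.2 (deriv_ne_zero_of_injOn hf hinj hzb)
  have h8 : ‖deriv (deriv f) z * q * q‖ ≤ ‖deriv (deriv f) z * q * q +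
      deriv f z * (- 2 * q * conj z)‖ + ‖deriv f z * (- 2 * q * conj z)‖ := by
    simpa using norm_sub_le (deriv (deriv f) z * q * q +
      deriv f z * (- 2 * q * conj z)) (deriv f z * (- 2 * q * conj z))
  simp only [norm_mul, hqn, norm_neg, Complex.norm_conj, Complex.norm_ofNat] at h8 h1
  have h9 : ‖deriv (deriv f) z‖ * (1 - ‖z‖ ^ 2) ≤ (2 ^ 33 + 2) * ‖deriv f z‖ := by
    have : ‖deriv (deriv f) z‖ * (1 - ‖z‖ ^ 2) * (1 - ‖z‖ ^ 2) ≤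
        (2 ^ 33 + 2) * ‖deriv f z‖ * (1 - ‖z‖ ^ 2) := by
      nlinarith [mul_pos hd hq]
    exact le_of_mul_le_mul_right this hq
  rw [norm_div, div_mul_eq_mul_div, div_le_iff₀ hd]
  nlinarith

/-- Constant in the local distortion theorem. -/
noncomputable def distC : ℝ := Real.exp (2 ^ 34)

lemma one_le_distC : 1 ≤ distC := Real.one_le_exp (by positivity)

lemma norm_deriv_le_distC {f : ℂ → ℂ} (hf : DifferentiableOn ℂ f (ball 0 1))
    (hinj : InjOn f (ball 0 1)) (hne : f '' ball 0 1 ≠ univ) {b y z : ℂ} (hb : ‖b‖ < 1)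
    (hy : ‖y - b‖ ≤ (1 - ‖b‖) / 2) (hz : ‖z - b‖ ≤ (1 - ‖b‖) / 2) :
    ‖deriv f y‖ ≤ distC ^ 2 * ‖deriv f z‖ := by
  obtain ⟨l, hl, hle⟩ := exists_log_of_ne_zero (hf.deriv isOpen_ball)
    fun z hz => deriv_ne_zero_of_injOn hf hinj hz
  have hlt : ∀ x ∈ closedBall b ((1 - ‖b‖) / 2), ‖x‖ ≤ 1 - (1 - ‖b‖) / 2 := by
    intro x hx
    have h1 : ‖x‖ ≤ ‖x - b‖ + ‖b‖ := by simpa using norm_add_le (x - b) b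
    rw [mem_closedBall, dist_eq_norm] at hx
    linarith
  have hlt' : ∀ x ∈ closedBall b ((1 - ‖b‖) / 2), ‖x‖ < 1 := fun x hx => by
    linarith [hlt x hx]
  have key := (convex_closedBall b ((1 - ‖b‖) / 2)).norm_image_sub_le_of_norm_hasDerivWithin_le
    (f := l) (f' := fun x => deriv (deriv f) x / deriv f x) (C := 2 ^ 35 / (1 - ‖b‖))
    (fun x hx => (hl x (mem_ball_zero_iff.2 (hlt' x hx))).hasDerivWithinAt)
    (fun x hx => by
      have h1 := bloch hf hinj hne (hlt' x hx)
      have h2 : (1 - ‖b‖) / 2 ≤ 1 - ‖x‖ ^ 2 := by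
        nlinarith [hlt x hx, norm_nonneg x]
      rw [le_div_iff₀ (by linarith)]
      nlinarith [norm_nonneg (deriv (deriv f) x / deriv f x)])
    (x := z) (y := y) (by rwa [mem_closedBall, dist_eq_norm])
    (by rwa [mem_closedBall, dist_eq_norm])
  have h3 : ‖y - z‖ ≤ 1 - ‖b‖ := by
    have : ‖y - z‖ ≤ ‖y - b‖ + ‖z - b‖ := by
      simpa using norm_sub_le (y - b) (z - b)
    linarith
  have h4 : ‖l y - l z‖ ≤ 2 ^ 35 := key.trans (by
    rw [div_mul_eq_mul_div, div_le_iff₀ (by linarith)]; gcongr)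
  have h2 : (l y).re - (l z).re ≤ ‖l y - l z‖ := by
    rw [← Complex.sub_re]; exact (le_abs_self _).trans (Complex.abs_re_le_norm _)
  rw [← hle y (mem_ball_zero_iff.2 (hlt' y (by rwa [mem_closedBall, dist_eq_norm]))),
    ← hle z (mem_ball_zero_iff.2 (hlt' z (by rwa [mem_closedBall, dist_eq_norm]))),
    Complex.norm_exp, Complex.norm_exp, distC, ← Real.exp_nat_mul, ← Real.exp_add]
  refine Real.exp_le_exp.2 ?_
  push_cast
  linarith

/-! ## Carleson norms -/

lemma measure_inter_ball_le_of_lt {Ω : Set ℂ} {μ : Measure ℂ} {z : ℂ} (hz : z ∈ frontier Ω) {r : ℝ}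
    (hr : 0 < r) (hrd : ENNReal.ofReal r < ediam (frontier Ω)) :
    μ (Ω ∩ ball z r) ≤ carlesonNorm Ω μ * ENNReal.ofReal r := by
  have h1 : μ (Ω ∩ ball z r) / ENNReal.ofReal r ≤ carlesonNorm Ω μ := by
    unfold carlesonNorm
    exact le_iSup₂_of_le z hz (le_iSup₂_of_le r ⟨hr, hrd⟩ le_rfl)
  rwa [ENNReal.div_le_iff (by simpa using hr) ENNReal.ofReal_ne_top] at h1

lemma measure_inter_ball_le {Ω : Set ℂ} {μ : Measure ℂ} {z : ℂ} (hz : z ∈ frontier Ω)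
    (hd : ∀ x ∈ Ω, edist x z < ediam (frontier Ω)) (hpos : 0 < ediam (frontier Ω))
    {r : ℝ} (hr : 0 < r) : μ (Ω ∩ ball z r) ≤ carlesonNorm Ω μ * ENNReal.ofReal r := by
  rcases lt_or_ge (ENNReal.ofReal r) (ediam (frontier Ω)) with h | h
  · exact measure_inter_ball_le_of_lt hz hr h
  have htop : ediam (frontier Ω) ≠ ⊤ := ne_top_of_le_ne_top ENNReal.ofReal_ne_top h
  set D := (ediam (frontier Ω)).toReal with hD
  have hDe : ENNReal.ofReal D = ediam (frontier Ω) := ENNReal.ofReal_toReal htop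
  have hD0 : 0 < D := ENNReal.toReal_pos hpos.ne' htop
  obtain ⟨u, hum, hu, hut⟩ := exists_seq_strictMono_tendsto' hD0
  have hsub : Ω ∩ ball z r ⊆ ⋃ n, Ω ∩ ball z (u n) := by
    intro x hx
    have h1 := hd x hx.1
    rw [← hDe, edist_dist, ENNReal.ofReal_lt_ofReal_iff hD0] at h1
    obtain ⟨n, hn⟩ := (hut.eventually (lt_mem_nhds h1)).exists
    exact mem_iUnion.2 ⟨n, hx.1, hn⟩
  have hmono : Monotone fun n => Ω ∩ ball z (u n) := fun m n hmn =>
    inter_subset_inter_right _ (ball_subset_ball (hum.monotone hmn))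
  refine (measure_mono hsub).trans ?_
  rw [hmono.measure_iUnion]
  refine iSup_le fun n => ?_
  have hle : ENNReal.ofReal (u n) < ediam (frontier Ω) := by
    rw [← hDe, ENNReal.ofReal_lt_ofReal_iff hD0]; exact (hu n).2
  exact (measure_inter_ball_le_of_lt hz (hu n).1 hle).trans (mul_le_mul_right (hle.le.trans h) _)

lemma frontier_unitDisk : frontier unitDisk = sphere (0 : ℂ) 1 :=
  frontier_ball (0 : ℂ) one_ne_zero

lemma diam_frontier_unitDisk : ediam (frontier unitDisk) = ENNReal.ofReal 2 := by
  rw [frontier_unitDisk]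
  refine le_antisymm (ediam_le fun x hx y hy => ?_) ?_
  · rw [edist_dist]
    refine ENNReal.ofReal_le_ofReal ?_
    rw [mem_sphere_zero_iff_norm] at hx hy
    rw [dist_eq_norm]
    linarith [norm_sub_le x y]
  · refine le_trans ?_ (edist_le_ediam_of_mem (x := (1 : ℂ)) (y := (-1 : ℂ)) (by simp)
      (by simp))
    rw [edist_dist, dist_eq_norm]
    norm_num

lemma measure_disk_inter_ball_le {ν : Measure ℂ} {ξ : ℂ} (hξ : ‖ξ‖ = 1) {s : ℝ} (hs : 0 < s) :
    ν (unitDisk ∩ ball ξ s) ≤ carlesonNorm unitDisk ν * ENNReal.ofReal s := by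
  refine measure_inter_ball_le (by rw [frontier_unitDisk]; simpa using hξ) ?_
    (by rw [diam_frontier_unitDisk]; simp) hs
  intro x hx
  have hx1 : ‖x‖ < 1 := by simpa [unitDisk] using hx
  rw [diam_frontier_unitDisk, edist_dist, ENNReal.ofReal_lt_ofReal_iff (by norm_num), dist_eq_norm]
  linarith [norm_sub_le x ξ]

/-! ## The Garsia kernel -/

/-- The modulus of the derivative of the disk automorphism sending `b` to `0`. -/
noncomputable def garsiaK (b z : ℂ) : ℝ := (1 - ‖b‖ ^ 2) / ‖1 - conj b * z‖ ^ 2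

/-- The Garsia transform of a measure. -/
noncomputable def garsia (ν : Measure ℂ) (b : ℂ) : ℝ≥0∞ := ∫⁻ z, ENNReal.ofReal (garsiaK b z) ∂ν

lemma garsiaK_nonneg {b : ℂ} (hb : ‖b‖ ≤ 1) (z : ℂ) : 0 ≤ garsiaK b z :=
  div_nonneg (by nlinarith [norm_nonneg b]) (by positivity)

lemma measurable_garsiaK (b : ℂ) : Measurable (garsiaK b) := by
  unfold garsiaK; fun_prop

lemma one_sub_den_pos {b z : ℂ} (hb : ‖b‖ < 1) (hz : ‖z‖ ≤ 1) : 0 < ‖1 - conj b * z‖ := by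
  have := den_pos (b := -b) (z := z) (by simpa using hb) hz
  simpa [sub_eq_add_neg] using this

lemma exists_unit_mul (b : ℂ) : ∃ ξ : ℂ, ‖ξ‖ = 1 ∧ b = ‖b‖ * ξ := by
  rcases eq_or_ne b 0 with rfl | h
  · exact ⟨1, by simp⟩
  · have : (‖b‖ : ℂ) ≠ 0 := by simpa using h
    exact ⟨b / ‖b‖, by simp [h], by field_simp⟩

lemma garsiaK_le {b z ξ : ℂ} (hb : ‖b‖ < 1) (hξ : ‖ξ‖ = 1) (hbξ : b = ‖b‖ * ξ) (hz : ‖z‖ ≤ 1)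
    {c : ℝ} (hc : 0 < c) (hcz : c ≤ 1 - ‖b‖ ∨ 2 * c ≤ ‖z - ξ‖) :
    garsiaK b z ≤ 2 * (1 - ‖b‖) / c ^ 2 := by
  have h1 : 1 - ‖b‖ ≤ ‖1 - conj b * z‖ := by
    simpa [sub_eq_add_neg] using one_sub_le_norm_den (b := -b) hz
  have h2 : ‖z - ξ‖ ≤ ‖1 - conj b * z‖ + (1 - ‖b‖) := by
    have h3 : z - ξ = ξ * (-(1 - conj b * z) + (1 - ‖b‖) * (conj ξ * z)) := by
      have h4 : ξ * conj ξ = 1 := by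
        rw [Complex.mul_conj, Complex.normSq_eq_norm_sq, hξ]; simp
      have h5 : conj b = ‖b‖ * conj ξ := by
        conv_lhs => rw [hbξ]
        simp
      rw [h5]
      linear_combination (-z) * h4
    rw [h3, norm_mul, hξ, one_mul]
    refine (norm_add_le _ _).trans ?_
    rw [norm_neg, norm_mul, norm_mul, Complex.norm_conj, hξ, one_mul]
    have h6 : ‖(1 - ‖b‖ : ℂ)‖ = 1 - ‖b‖ := by
      rw [← Complex.ofReal_one, ← Complex.ofReal_sub, Complex.norm_real, Real.norm_eq_abs,
        abs_of_pos (by linarith)]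
    rw [h6]
    nlinarith
  have h7 : c ≤ ‖1 - conj b * z‖ := by rcases hcz with h | h <;> linarith
  unfold garsiaK
  exact div_le_div₀ (by linarith) (by nlinarith [sq_nonneg (1 - ‖b‖)]) (by positivity) (by gcongr)

lemma garsia_restrict_le_of_ball {ν : Measure ℂ} {M : ℝ≥0∞}
    (h : ∀ ξ : ℂ, ‖ξ‖ = 1 → ∀ s : ℝ, 0 < s → ν (unitDisk ∩ ball ξ s) ≤ M * ENNReal.ofReal s)
    {b : ℂ} (hb : ‖b‖ < 1) : garsia (ν.restrict unitDisk) b ≤ 32 * M := by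
  obtain ⟨ξ, hξ, hbξ⟩ := exists_unit_mul b
  set t := 1 - ‖b‖ with ht
  have ht0 : 0 < t := by linarith
  set c : ℕ → ℝ≥0∞ := fun k => ENNReal.ofReal (8 / t * (1 / 4) ^ k) with hc
  have hpt : ∀ z ∈ unitDisk, ENNReal.ofReal (garsiaK b z) ≤
      ∑' k, (ball ξ (2 ^ (k + 1) * t)).indicator (fun _ => c k) z := by
    intro z hz
    have hz1 : ‖z‖ < 1 := by simpa [unitDisk] using hz
    have hex : ∃ k : ℕ, ‖z - ξ‖ < 2 ^ (k + 1) * t := by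
      obtain ⟨k, hk⟩ := pow_unbounded_of_one_lt (‖z - ξ‖ / t) (one_lt_two)
      rw [div_lt_iff₀ ht0] at hk
      refine ⟨k, hk.trans_le ?_⟩
      gcongr <;> norm_num
    classical
    set k := Nat.find hex with hk
    have hk1 := Nat.find_spec hex
    refine le_trans ?_ (ENNReal.le_tsum k)
    rw [indicator_of_mem (by rw [mem_ball, dist_eq_norm]; exact hk1)]
    refine ENNReal.ofReal_le_ofReal ?_
    have hcond : (2 ^ k * t / 2) ≤ 1 - ‖b‖ ∨ 2 * (2 ^ k * t / 2) ≤ ‖z - ξ‖ := by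
      rcases Nat.eq_zero_or_pos k with h0 | h0
      · left; rw [h0]; linarith
      · right
        have h1 := Nat.find_min hex (m := k - 1) (by omega)
        rw [not_lt, Nat.sub_add_cancel h0] at h1
        linarith
    refine (garsiaK_le hb hξ hbξ hz1.le (by positivity) hcond).trans (le_of_eq ?_)
    rw [← ht, one_div, inv_pow, show (4 : ℝ) = 2 ^ 2 by norm_num, ← pow_mul, mul_comm 2 k, pow_mul]
    field_simp
    norm_num
  have hu : MeasurableSet unitDisk := isOpen_ball.measurableSet
  calc garsia (ν.restrict unitDisk) b
      ≤ ∫⁻ z in unitDisk, ∑' k, (ball ξ (2 ^ (k + 1) * t)).indicator (fun _ => c k) z ∂ν :=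
        setLIntegral_mono' hu hpt
    _ = ∑' k, ∫⁻ z in unitDisk, (ball ξ (2 ^ (k + 1) * t)).indicator (fun _ => c k) z ∂ν :=
        lintegral_tsum fun k => (measurable_const.indicator isOpen_ball.measurableSet).aemeasurable
    _ ≤ ∑' k, 16 * M * (2⁻¹ : ℝ≥0∞) ^ k := by
        refine ENNReal.tsum_le_tsum fun k => ?_
        rw [lintegral_indicator_const isOpen_ball.measurableSet,
          Measure.restrict_apply isOpen_ball.measurableSet, inter_comm]
        refine (mul_le_mul_right (h ξ hξ (2 ^ (k + 1) * t) (by positivity)) (c k)).trans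
          (le_of_eq ?_)
        have e1 : ENNReal.ofReal (8 / t * (1 / 4) ^ k) * ENNReal.ofReal (2 ^ (k + 1) * t) =
            16 * 2⁻¹ ^ k := by
          rw [← ENNReal.ofReal_mul (by positivity)]
          have : 8 / t * (1 / 4) ^ k * (2 ^ (k + 1) * t) = 16 * (1 / 2 : ℝ) ^ k := by
            rw [show (1 / 4 : ℝ) = (1 / 2) * (1 / 2) by norm_num, mul_pow,
              pow_succ, one_div, inv_pow]
            field_simp
            norm_num
          rw [this, ENNReal.ofReal_mul (by norm_num), ENNReal.ofReal_pow (by norm_num), one_div,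
            ENNReal.ofReal_inv_of_pos (by norm_num)]
          norm_num
        rw [hc]
        dsimp only
        rw [mul_comm M, ← mul_assoc, e1]
        ring
    _ = 32 * M := by
        rw [ENNReal.tsum_mul_left, ENNReal.tsum_geometric, ENNReal.one_sub_inv_two, inv_inv]
        ring

lemma garsia_restrict_le {ν : Measure ℂ} {b : ℂ} (hb : ‖b‖ < 1) :
    garsia (ν.restrict unitDisk) b ≤ 32 * carlesonNorm unitDisk ν :=
  garsia_restrict_le_of_ball (fun _ hξ _ hs => measure_disk_inter_ball_le hξ hs) hb

lemma le_garsiaK {ξ z : ℂ} (hξ : ‖ξ‖ = 1) (hz : ‖z‖ ≤ 1) {s : ℝ} (hs : 0 < s) (hs2 : s < 2)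
    (hzs : ‖z - ξ‖ < s) : 2 / (9 * s) ≤ garsiaK ((1 - s / 2 : ℝ) * ξ) z := by
  have hb : ‖((1 - s / 2 : ℝ) * ξ : ℂ)‖ = 1 - s / 2 := by
    rw [norm_mul, hξ, mul_one, Complex.norm_real, Real.norm_eq_abs, abs_of_pos (by linarith)]
  have hpos := one_sub_den_pos (b := (1 - s / 2 : ℝ) * ξ) (z := z) (by rw [hb]; linarith) hz
  have h1 : ‖1 - conj ((1 - s / 2 : ℝ) * ξ : ℂ) * z‖ ≤ 3 * s / 2 := by
    have h4 : ξ * conj ξ = 1 := by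
      rw [Complex.mul_conj, Complex.normSq_eq_norm_sq, hξ]; simp
    have h3 : 1 - conj ((1 - s / 2 : ℝ) * ξ : ℂ) * z =
        conj ξ * (-(z - ξ) + (s / 2 : ℝ) * z) := by
      rw [map_mul, Complex.conj_ofReal]
      push_cast
      linear_combination (-1) * h4
    rw [h3, norm_mul, Complex.norm_conj, hξ, one_mul]
    refine (norm_add_le _ _).trans ?_
    rw [norm_neg, norm_mul, Complex.norm_real, Real.norm_eq_abs, abs_of_pos (by linarith)]
    nlinarith
  unfold garsiaK
  rw [hb, div_le_div_iff₀ (by positivity) (by positivity)]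
  have h2 : ‖1 - conj ((1 - s / 2 : ℝ) * ξ : ℂ) * z‖ ^ 2 ≤ (3 * s / 2) ^ 2 := by gcongr
  nlinarith

lemma carlesonNorm_le_of_garsia {ν : Measure ℂ} {S : ℝ≥0∞}
    (h : ∀ b : ℂ, ‖b‖ < 1 → garsia (ν.restrict unitDisk) b ≤ S) :
    carlesonNorm unitDisk ν ≤ 5 * S := by
  unfold carlesonNorm
  refine iSup₂_le fun ξ hξ => iSup₂_le fun s hs => ?_
  replace hs : 0 < s ∧ ENNReal.ofReal s < ediam (frontier unitDisk) := hs
  rw [diam_frontier_unitDisk, ENNReal.ofReal_lt_ofReal_iff (by norm_num)] at hs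
  obtain ⟨hs0, hs2⟩ := hs
  rw [frontier_unitDisk, mem_sphere_zero_iff_norm] at hξ
  set b : ℂ := (1 - s / 2 : ℝ) * ξ with hbd
  have hb : ‖b‖ < 1 := by
    rw [hbd, norm_mul, hξ, mul_one, Complex.norm_real, Real.norm_eq_abs, abs_of_pos (by linarith)]
    linarith
  have hm : MeasurableSet (unitDisk ∩ ball ξ s) :=
    isOpen_ball.measurableSet.inter isOpen_ball.measurableSet
  have h1 : ENNReal.ofReal (2 / (9 * s)) * ν (unitDisk ∩ ball ξ s) ≤ S := by
    refine le_trans ?_ (h b hb)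
    unfold garsia
    calc _ = ∫⁻ z in unitDisk ∩ ball ξ s, ENNReal.ofReal (2 / (9 * s)) ∂ν := by
          rw [lintegral_const, Measure.restrict_apply_univ]
      _ ≤ ∫⁻ z in unitDisk ∩ ball ξ s, ENNReal.ofReal (garsiaK b z) ∂ν := by
          refine setLIntegral_mono' hm fun z hz => ENNReal.ofReal_le_ofReal ?_
          have hz1 : ‖z‖ < 1 := by simpa [unitDisk] using hz.1
          have hz2 := hz.2
          rw [mem_ball, dist_eq_norm] at hz2
          exact le_garsiaK hξ hz1.le hs0 hs2 hz2
      _ ≤ _ := lintegral_mono_set inter_subset_left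
  rw [ENNReal.div_le_iff (by simpa using hs0) ENNReal.ofReal_ne_top]
  calc ν (unitDisk ∩ ball ξ s)
      = ENNReal.ofReal (9 / 2 * s) * (ENNReal.ofReal (2 / (9 * s)) * ν (unitDisk ∩ ball ξ s)) := by
        rw [← mul_assoc, ← ENNReal.ofReal_mul (by positivity)]
        have : 9 / 2 * s * (2 / (9 * s)) = 1 := by field_simp
        rw [this]; simp
    _ ≤ ENNReal.ofReal (5 * s) * S := by gcongr; norm_num
    _ = 5 * S * ENNReal.ofReal s := by
        rw [ENNReal.ofReal_mul (by norm_num)]; norm_num; ring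

/-! ## Polar coordinates and the Littlewood-Paley identity -/

open Real in
lemma lintegral_polar {f : ℂ → ℝ≥0∞} (hf : Measurable f) :
    ∫⁻ z, f z = ∫⁻ r in Ioi (0 : ℝ), ENNReal.ofReal r *
      ∫⁻ θ in Ioo (-π) π, f (circleMap 0 r θ) := by
  rw [← Complex.lintegral_comp_polarCoord_symm, polarCoord_target, Measure.volume_eq_prod,
    ← Measure.prod_restrict, lintegral_prod]
  · refine lintegral_congr fun r => ?_
    rw [← lintegral_const_mul]
    · refine lintegral_congr fun θ => ?_
      rw [smul_eq_mul, Complex.polarCoord_symm_apply, circleMap, Complex.exp_mul_I]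
      simp
    · fun_prop
  · have h : Measurable fun p : ℝ × ℝ => Complex.polarCoord.symm p := by
      simp_rw [Complex.polarCoord_symm_apply]
      fun_prop
    exact ((ENNReal.measurable_ofReal.comp measurable_fst).smul (hf.comp h)).aemeasurable

open Real in
lemma circleAverage_eq_setIntegral (f : ℂ → ℝ) (r : ℝ) :
    circleAverage f 0 r = (2 * π)⁻¹ * ∫ θ in Ioo (-π) π, f (circleMap 0 r θ) := by
  rw [circleAverage_eq_integral_add (-π), smul_eq_mul,
    intervalIntegral.integral_comp_add_right (fun θ => f (circleMap 0 r θ)),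
    intervalIntegral.integral_of_le (by linarith [pi_pos]), integral_Ioc_eq_integral_Ioo]
  congr 4 <;> ring

open Real in
lemma CircleIntegrable.integrableOn_Ioo {f : ℂ → ℝ} {r : ℝ} (hf : CircleIntegrable f 0 r) :
    IntegrableOn (fun θ => f (circleMap 0 r θ)) (Ioo (-π) π) := by
  have h1 : Function.Periodic (fun θ => f (circleMap 0 r θ)) (2 * π) := fun θ => by
    simp only [periodic_circleMap 0 r θ]
  have h2 := h1.intervalIntegrable₀ two_pi_pos.ne' hf (-π) π
  rw [intervalIntegrable_iff_integrableOn_Ioo_of_le (by linarith [pi_pos])] at h2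
  exact h2

open Real in
lemma lintegral_circle {f : ℂ → ℝ} {r : ℝ} (hf : CircleIntegrable f 0 r)
    (h0 : ∀ z, 0 ≤ f z) :
    ∫⁻ θ in Ioo (-π) π, ENNReal.ofReal (f (circleMap 0 r θ)) =
      ENNReal.ofReal (2 * π * circleAverage f 0 r) := by
  rw [circleAverage_eq_setIntegral, mul_inv_cancel_left₀ two_pi_pos.ne',
    ofReal_integral_eq_lintegral_ofReal hf.integrableOn_Ioo
    (Eventually.of_forall fun θ => h0 _)]

open Real Polynomial in
lemma sum_range_sq_coeff (p : ℂ[X]) {N : ℕ} (hN : p.natDegree < N) :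
    ∑ i ∈ Finset.range N, ‖p.coeff i‖ ^ 2 = circleAverage (fun z => ‖p.eval z‖ ^ 2) 0 1 := by
  rw [← p.sum_sq_norm_coeff_eq_circleAverage]
  symm
  refine Finset.sum_subset (fun i hi => ?_) fun i _ hi => ?_
  · exact Finset.mem_range.2 ((le_natDegree_of_mem_supp i hi).trans_lt hN)
  · simp [notMem_support_iff.1 hi]

open Real Polynomial in
lemma circleAverage_sq_polynomial (p : ℂ[X]) {N : ℕ} (hN : p.natDegree < N) (r : ℝ) :
    circleAverage (fun z => ‖p.eval z‖ ^ 2) 0 r =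
      ∑ i ∈ Finset.range N, ‖p.coeff i‖ ^ 2 * r ^ (2 * i) := by
  have h1 := sum_range_sq_coeff (p.comp (C (r : ℂ) * X)) (N := N) ?_
  · rw [circleAverage_eq_circleAverage_zero_one]
    simp only [eval_comp, eval_mul, eval_C, eval_X] at h1
    simp only [add_zero]
    rw [← h1]
    refine Finset.sum_congr rfl fun i _ => ?_
    rw [comp_C_mul_X_coeff, norm_mul, mul_pow, norm_pow, Complex.norm_real, Real.norm_eq_abs,
      ← pow_mul, mul_comm i 2, pow_mul, sq_abs, pow_mul]
  · refine (natDegree_comp_le.trans ?_).trans_lt hN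
    calc p.natDegree * (C (r : ℂ) * X).natDegree ≤ p.natDegree * 1 := by
          gcongr; exact (natDegree_C_mul_le _ _).trans natDegree_X_le
      _ = _ := mul_one _

/-- The weighted Dirichlet integral `∫ |F'|² (1 - |z|²)` over the unit disk. -/
noncomputable def dirichlet (G : ℂ → ℂ) : ℝ≥0∞ :=
  ∫⁻ z in ball (0 : ℂ) 1, ENNReal.ofReal (‖G z‖ ^ 2 * (1 - ‖z‖ ^ 2))

open Real Polynomial in
lemma dirichlet_polynomial (p : ℂ[X]) {N : ℕ} (hN : p.natDegree < N) :
    dirichlet (fun z => (derivative p).eval z) = ENNReal.ofReal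
      (π * ∑ i ∈ Finset.range N, ((i + 1 : ℝ) / (i + 2)) * ‖p.coeff (i + 1)‖ ^ 2) := by
  have hN' : (derivative p).natDegree < N :=
    ((natDegree_derivative_le p).trans (Nat.sub_le _ _)).trans_lt hN
  have hcont : Continuous fun z => (derivative p).eval z := (derivative p).continuous
  set f : ℂ → ℝ := fun z => ‖(derivative p).eval z‖ ^ 2 * (1 - ‖z‖ ^ 2) with hf
  have hfm : Measurable fun z => ENNReal.ofReal (f z) := by
    have : Continuous f := by fun_prop
    fun_prop
  set q : ℝ → ℝ := fun r => ∑ i ∈ Finset.range N,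
    2 * π * (‖(derivative p).coeff i‖ ^ 2 * (r ^ (2 * i + 1) - r ^ (2 * i + 3))) with hq
  have hqc : Continuous q := by fun_prop
  have hinner : ∀ r ∈ Ioo (0 : ℝ) 1, ENNReal.ofReal r *
      ∫⁻ θ in Ioo (-π) π, (ball (0 : ℂ) 1).indicator (fun z => ENNReal.ofReal (f z))
        (circleMap 0 r θ) = ENNReal.ofReal (q r) := by
    intro r hr
    have hci : CircleIntegrable (fun z => ‖(derivative p).eval z‖ ^ 2) 0 r :=
      ContinuousOn.circleIntegrable' (by fun_prop)
    have h1 : ∀ θ, (ball (0 : ℂ) 1).indicator (fun z => ENNReal.ofReal (f z)) (circleMap 0 r θ) =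
        ENNReal.ofReal (1 - r ^ 2) *
          ENNReal.ofReal (‖(derivative p).eval (circleMap 0 r θ)‖ ^ 2) := by
      intro θ
      have hn : ‖circleMap 0 r θ‖ = r := by rw [norm_circleMap_zero, abs_of_pos hr.1]
      rw [indicator_of_mem (by rw [mem_ball_zero_iff, hn]; exact hr.2), hf]
      simp only [hn]
      rw [ENNReal.ofReal_mul (by positivity), mul_comm]
    simp_rw [h1]
    rw [lintegral_const_mul _ (by fun_prop), lintegral_circle hci (fun z => by positivity),
      circleAverage_sq_polynomial _ hN', ← ENNReal.ofReal_mul (by nlinarith [hr.1, hr.2]),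
      ← ENNReal.ofReal_mul hr.1.le, hq]
    congr 1
    simp only [Finset.mul_sum]
    refine Finset.sum_congr rfl fun i _ => ?_
    ring
  have hq0 : ∀ r ∈ Ioo (0 : ℝ) 1, 0 ≤ q r := by
    intro r hr
    refine Finset.sum_nonneg fun i _ => ?_
    have : r ^ (2 * i + 3) ≤ r ^ (2 * i + 1) :=
      pow_le_pow_of_le_one hr.1.le hr.2.le (by omega)
    have := pi_pos
    have : 0 ≤ r ^ (2 * i + 1) - r ^ (2 * i + 3) := by linarith
    positivity
  unfold dirichlet
  rw [← lintegral_indicator measurableSet_ball,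
    lintegral_polar (hfm.indicator measurableSet_ball)]
  have hsplit : Ioi (0 : ℝ) = Ioo 0 1 ∪ Ici 1 := (Ioo_union_Ici_eq_Ioi one_pos).symm
  rw [hsplit, lintegral_union measurableSet_Ici
    (Set.disjoint_left.2 fun r hr hr' => (not_lt.2 hr') hr.2),
    setLIntegral_congr_fun measurableSet_Ioo hinner]
  have hzero : ∫⁻ r in Ici (1 : ℝ), ENNReal.ofReal r *
      ∫⁻ θ in Ioo (-π) π, (ball (0 : ℂ) 1).indicator (fun z => ENNReal.ofReal (f z))
        (circleMap 0 r θ) = 0 := by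
    rw [setLIntegral_congr_fun (g := fun _ => 0) measurableSet_Ici, lintegral_zero]
    intro r hr
    have hr1 : (1 : ℝ) ≤ r := hr
    have h1 : ∀ θ, (ball (0 : ℂ) 1).indicator (fun z => ENNReal.ofReal (f z))
        (circleMap 0 r θ) = 0 := by
      intro θ
      refine indicator_of_notMem ?_ _
      rw [mem_ball_zero_iff, norm_circleMap_zero, abs_of_nonneg (by linarith)]
      exact not_lt.2 hr1
    simp [h1]
  rw [hzero, add_zero, ← ofReal_integral_eq_lintegral_ofReal
    (hqc.integrableOn_Icc.mono_set Ioo_subset_Icc_self)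
    ((ae_restrict_iff' measurableSet_Ioo).2 (Eventually.of_forall hq0)),
    ← integral_Ioc_eq_integral_Ioo, ← intervalIntegral.integral_of_le zero_le_one]
  congr 1
  rw [hq, intervalIntegral.integral_finsetSum (fun i _ =>
    Continuous.intervalIntegrable (by fun_prop) _ _), Finset.mul_sum]
  refine Finset.sum_congr rfl fun i _ => ?_
  rw [intervalIntegral.integral_const_mul, intervalIntegral.integral_const_mul,
    intervalIntegral.integral_sub (Continuous.intervalIntegrable (by fun_prop) _ _)
      (Continuous.intervalIntegrable (by fun_prop) _ _), integral_pow, integral_pow,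
    coeff_derivative, norm_mul, mul_pow]
  have : ‖(i + 1 : ℂ)‖ = i + 1 := by
    rw [← Nat.cast_succ, Complex.norm_natCast]; simp
  rw [this]
  push_cast
  simp only [one_pow, ne_eq, Nat.add_eq_zero_iff, one_ne_zero, and_false, not_false_eq_true,
    zero_pow,
    sub_zero, OfNat.ofNat_ne_zero]
  have : (i : ℝ) + 1 ≠ 0 := by positivity
  have : (i : ℝ) + 2 ≠ 0 := by positivity
  have : (2 * i : ℝ) + 1 + 1 ≠ 0 := by positivity
  have : (2 * i : ℝ) + 3 + 1 ≠ 0 := by positivity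
  field_simp
  ring

open Real Polynomial in
lemma littlewoodPaley_polynomial (p : ℂ[X]) :
    ENNReal.ofReal (circleAverage (fun z => ‖p.eval z - p.eval 0‖ ^ 2) 0 1) ≤
        dirichlet (fun z => (derivative p).eval z) ∧
      dirichlet (fun z => (derivative p).eval z) ≤
        ENNReal.ofReal (π * circleAverage (fun z => ‖p.eval z - p.eval 0‖ ^ 2) 0 1) := by
  set N := p.natDegree + 1 with hN
  have h1 : (p - C (p.eval 0)).natDegree < N + 1 := by
    rw [natDegree_sub_C]; omega
  have h2 := sum_range_sq_coeff _ h1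
  simp only [eval_sub, eval_C] at h2
  rw [← h2, dirichlet_polynomial p (N := N) (by omega), Finset.sum_range_succ']
  have h3 : ‖(p - C (p.eval 0)).coeff 0‖ ^ 2 = 0 := by
    simp [coeff_zero_eq_eval_zero]
  have h4 : ∀ i, (p - C (p.eval 0)).coeff (i + 1) = p.coeff (i + 1) := by
    intro i; simp
  simp_rw [h3, h4, add_zero]
  constructor
  · refine ENNReal.ofReal_le_ofReal ?_
    rw [Finset.mul_sum]
    refine Finset.sum_le_sum fun i _ => ?_
    have h5 : (1 : ℝ) / 2 ≤ (i + 1) / (i + 2) := by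
      rw [div_le_div_iff₀ (by positivity) (by positivity)]
      linarith [(Nat.cast_nonneg i : (0 : ℝ) ≤ i)]
    have h6 : 1 ≤ π * ((i + 1) / (i + 2)) := by nlinarith [pi_gt_three]
    rw [← mul_assoc]
    exact le_mul_of_one_le_left (by positivity) h6
  · refine ENNReal.ofReal_le_ofReal ?_
    refine mul_le_mul_of_nonneg_left (Finset.sum_le_sum fun i _ => ?_) pi_pos.le
    have h5 : ((i : ℝ) + 1) / (i + 2) ≤ 1 := by
      rw [div_le_one (by positivity)]; linarith
    exact mul_le_of_le_one_left (by positivity) h5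

open Polynomial in
lemma exists_polynomial_tendsto {F : ℂ → ℂ} {R : ℝ} (hR : 1 < R)
    (hF : DifferentiableOn ℂ F (ball 0 R)) :
    ∃ P : ℕ → ℂ[X], TendstoUniformlyOn (fun n z => (P n).eval z) F atTop (closedBall 0 1) ∧
      TendstoUniformlyOn (fun n z => (derivative (P n)).eval z) (deriv F) atTop
        (closedBall 0 1) := by
  obtain ⟨r, hr1, hrR⟩ := exists_between hR
  have hr0 : 0 < r := by linarith
  lift r to ℝ≥0 using hr0.le
  have hpos : (0 : ℝ≥0) < r := by exact_mod_cast hr0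
  have hps := (hF.mono (closedBall_subset_ball hrR)).hasFPowerSeriesOnBall hpos
  set p := cauchyPowerSeries F 0 r
  have hloc := hps.tendstoLocallyUniformlyOn'
  rw [eball_coe] at hloc
  set P : ℕ → ℂ[X] := fun n => ∑ k ∈ Finset.range n, monomial k (p.coeff k) with hP
  have heq : ∀ n z, p.partialSum n (z - 0) = (P n).eval z := by
    intro n z
    simp only [hP, FormalMultilinearSeries.partialSum, sub_zero, eval_finsetSum, eval_monomial]
    refine Finset.sum_congr rfl fun k _ => ?_
    rw [FormalMultilinearSeries.apply_eq_pow_smul_coeff, smul_eq_mul, mul_comm]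
  simp only [heq] at hloc
  have hsub : closedBall (0 : ℂ) 1 ⊆ ball 0 r := closedBall_subset_ball hr1
  have hK := isCompact_closedBall (0 : ℂ) 1
  have hder := hloc.deriv (Eventually.of_forall fun n => (P n).differentiable.differentiableOn)
    isOpen_ball
  refine ⟨P, (tendstoLocallyUniformlyOn_iff_forall_isCompact isOpen_ball).1 hloc _ hsub hK, ?_⟩
  have h2 := (tendstoLocallyUniformlyOn_iff_forall_isCompact isOpen_ball).1 hder _ hsub hK
  refine h2.congr (Eventually.of_forall fun n z _ => ?_)
  simp [Polynomial.deriv]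

lemma tendsto_circleAverage_of_tendstoUniformlyOn {f : ℕ → ℂ → ℝ} {g : ℂ → ℝ}
    (hf : ∀ n, Continuous (f n)) (hg : ContinuousOn g (sphere 0 1))
    (h : TendstoUniformlyOn f g atTop (sphere 0 1)) :
    Tendsto (fun n => Real.circleAverage (f n) 0 1) atTop (𝓝 (Real.circleAverage g 0 1)) := by
  have hci : ∀ n, CircleIntegrable (f n) 0 1 := fun n => (hf n).continuousOn.circleIntegrable'
  have hcg : CircleIntegrable g 0 1 := ContinuousOn.circleIntegrable' (by simpa using hg)
  rw [Metric.tendsto_atTop]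
  intro ε hε
  rw [Metric.tendstoUniformlyOn_iff] at h
  obtain ⟨N, hN⟩ := eventually_atTop.1 (h (ε / 2) (by positivity))
  refine ⟨N, fun n hn => ?_⟩
  rw [Real.dist_eq, ← Real.circleAverage_fun_sub (hci n) hcg]
  refine (Real.abs_circleAverage_le_circleAverage_abs).trans_lt ?_
  refine lt_of_le_of_lt (Real.circleAverage_mono_on_of_le_circle (a := ε / 2) ?_ ?_) (by linarith)
  · refine ContinuousOn.circleIntegrable' ?_
    exact (ContinuousOn.abs ((hf n).continuousOn.sub (by simpa using hg)))
  · intro z hz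
    have := hN n hn z (by simpa using hz)
    rw [dist_comm, Real.dist_eq] at this
    exact this.le

lemma TendstoUniformlyOn.normSq_sub {f : ℕ → ℂ → ℂ} {F : ℂ → ℂ} {s : Set ℂ} {c : ℕ → ℂ} {d : ℂ}
    (h : TendstoUniformlyOn f F atTop s) (hc : Tendsto c atTop (𝓝 d)) {M : ℝ}
    (hM : ∀ z ∈ s, ‖F z - d‖ ≤ M) :
    TendstoUniformlyOn (fun n z => ‖f n z - c n‖ ^ 2) (fun z => ‖F z - d‖ ^ 2) atTop s := by
  rw [Metric.tendstoUniformlyOn_iff] at h ⊢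
  intro ε hε
  set M' := max M 0 with hM'
  set δ := min 1 (ε / (2 * (2 * M' + 2))) with hδ
  have hM0 : 0 ≤ M' := le_max_right _ _
  have hδ0 : 0 < δ := by positivity
  filter_upwards [h (δ / 2) (by positivity), Metric.tendsto_nhds.1 hc (δ / 2) (by positivity)]
    with n hn hcn z hz
  have h1 := hn z hz
  have h2 := (hM z hz).trans (le_max_left M 0)
  rw [dist_eq_norm] at h1 hcn
  have h3 : ‖(f n z - c n) - (F z - d)‖ ≤ δ := by
    have : (f n z - c n) - (F z - d) = -(F z - f n z) - (c n - d) := by ring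
    rw [this]
    refine (norm_sub_le _ _).trans ?_
    rw [norm_neg]; linarith
  have h4 := abs_norm_sub_norm_le (f n z - c n) (F z - d)
  have h5 : |‖f n z - c n‖ - ‖F z - d‖| ≤ δ := h4.trans h3
  have h6 : δ ≤ 1 := min_le_left _ _
  have h7 : δ * (2 * (2 * M' + 2)) ≤ ε := by
    rw [← le_div_iff₀ (by positivity)]; exact min_le_right _ _
  rw [Real.dist_eq, abs_sub_comm]
  have h8 : ‖f n z - c n‖ ^ 2 - ‖F z - d‖ ^ 2 =
    (‖f n z - c n‖ - ‖F z - d‖) * (‖f n z - c n‖ + ‖F z - d‖) := by ring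
  rw [h8, abs_mul, abs_of_nonneg (a := ‖f n z - c n‖ + ‖F z - d‖) (by positivity)]
  have h9 : ‖f n z - c n‖ + ‖F z - d‖ ≤ 2 * M' + 1 := by
    have := (abs_le.1 h5).2
    linarith
  calc _ ≤ δ * (2 * M' + 1) := by gcongr
    _ < ε := by nlinarith

open Real in
lemma littlewoodPaley {F : ℂ → ℂ} {R : ℝ} (hR : 1 < R) (hF : DifferentiableOn ℂ F (ball 0 R)) :
    ENNReal.ofReal (circleAverage (fun z => ‖F z - F 0‖ ^ 2) 0 1) ≤ dirichlet (deriv F) ∧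
      dirichlet (deriv F) ≤ ENNReal.ofReal (π * circleAverage (fun z => ‖F z - F 0‖ ^ 2) 0 1) := by
  obtain ⟨P, hP, hP'⟩ := exists_polynomial_tendsto hR hF
  have hsub : closedBall (0 : ℂ) 1 ⊆ ball 0 R := closedBall_subset_ball hR
  have hFc : ContinuousOn F (closedBall 0 1) := hF.continuousOn.mono hsub
  have hF'c : ContinuousOn (deriv F) (closedBall 0 1) :=
    (hF.deriv isOpen_ball).continuousOn.mono hsub
  have hK := isCompact_closedBall (0 : ℂ) 1
  have hP0 : Tendsto (fun n => (P n).eval 0) atTop (𝓝 (F 0)) :=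
    hP.tendsto_at (mem_closedBall_self zero_le_one)
  obtain ⟨M, hM⟩ := hK.exists_bound_of_continuousOn (hFc.sub (continuousOn_const (c := F 0)))
  obtain ⟨M1, hM1⟩ := hK.exists_bound_of_continuousOn hF'c
  have hA : Tendsto (fun n => circleAverage (fun z => ‖(P n).eval z - (P n).eval 0‖ ^ 2) 0 1)
      atTop (𝓝 (circleAverage (fun z => ‖F z - F 0‖ ^ 2) 0 1)) := by
    refine tendsto_circleAverage_of_tendstoUniformlyOn (fun n => ?_) ?_ ?_
    · have := (P n).continuous
      fun_prop
    · have := hFc.mono (sphere_subset_closedBall)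
      fun_prop
    · exact (hP.mono sphere_subset_closedBall).normSq_sub hP0
        fun z hz => hM z (sphere_subset_closedBall hz)
  have hD : Tendsto (fun n => dirichlet fun z => (Polynomial.derivative (P n)).eval z) atTop
      (𝓝 (dirichlet (deriv F))) := by
    unfold dirichlet
    refine tendsto_lintegral_filter_of_dominated_convergence
      (fun _ => ENNReal.ofReal ((M1 + 1) ^ 2)) ?_ ?_ ?_ ?_
    · refine Eventually.of_forall fun n => ?_
      have := (Polynomial.derivative (P n)).continuous
      fun_prop
    · rw [Metric.tendstoUniformlyOn_iff] at hP'
      filter_upwards [hP' 1 one_pos] with n hn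
      refine (ae_restrict_iff' measurableSet_ball).2 (Eventually.of_forall fun z hz => ?_)
      have h1 := hn z (ball_subset_closedBall hz)
      have h2 := hM1 z (ball_subset_closedBall hz)
      refine ENNReal.ofReal_le_ofReal ?_
      rw [dist_eq_norm] at h1
      have h3 : ‖(Polynomial.derivative (P n)).eval z‖ ≤ M1 + 1 := by
        have := norm_le_norm_add_norm_sub (deriv F z) ((Polynomial.derivative (P n)).eval z)
        linarith
      calc _ ≤ ‖(Polynomial.derivative (P n)).eval z‖ ^ 2 * 1 := by
            gcongr; nlinarith [norm_nonneg z]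
        _ ≤ _ := by rw [mul_one]; gcongr
    · rw [lintegral_const]
      refine ENNReal.mul_ne_top ENNReal.ofReal_ne_top ?_
      rw [Measure.restrict_apply_univ]
      exact measure_ball_lt_top.ne
    · refine (ae_restrict_iff' measurableSet_ball).2 (Eventually.of_forall fun z hz => ?_)
      have h1 := hP'.tendsto_at (ball_subset_closedBall hz)
      exact (ENNReal.continuous_ofReal.tendsto _).comp ((h1.norm.pow 2).mul_const _)
  constructor
  · exact le_of_tendsto_of_tendsto' ((ENNReal.continuous_ofReal.tendsto _).comp hA) hD
      fun n => (littlewoodPaley_polynomial (P n)).1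
  · exact le_of_tendsto_of_tendsto' hD
      ((ENNReal.continuous_ofReal.tendsto _).comp (hA.const_mul π))
      fun n => (littlewoodPaley_polynomial (P n)).2

/-- The mean square over `|z| = s` is controlled by the weighted Dirichlet integral. -/
lemma circleAverage_sq_le_dirichlet {F : ℂ → ℂ} (hF : DifferentiableOn ℂ F (ball 0 1)) {s : ℝ}
    (hs : 0 < s) (hs1 : s < 1) :
    ENNReal.ofReal (Real.circleAverage (fun z => ‖F (s * z) - F 0‖ ^ 2) 0 1) ≤
      dirichlet (deriv F) := by
  have hsc : ∀ z : ℂ, ‖(s : ℂ) * z‖ = s * ‖z‖ := fun z => by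
    rw [norm_mul, Complex.norm_real, Real.norm_eq_abs, abs_of_pos hs]
  have hmaps : MapsTo (fun z : ℂ => (s : ℂ) * z) (ball 0 s⁻¹) (ball 0 1) := by
    intro z hz
    rw [mem_ball_zero_iff] at hz ⊢
    rw [hsc]
    calc s * ‖z‖ < s * s⁻¹ := by gcongr
      _ = 1 := mul_inv_cancel₀ hs.ne'
  have hFs : DifferentiableOn ℂ (fun z => F (s * z)) (ball 0 s⁻¹) :=
    hF.comp (by fun_prop) hmaps
  have h1 := (littlewoodPaley ((one_lt_inv₀ hs).2 hs1) hFs).1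
  simp only [mul_zero] at h1
  refine h1.trans ?_
  have hderiv : ∀ z, deriv (fun z => F (s * z)) z = s * deriv F (s * z) := fun z => by
    rw [deriv_comp_mul_left]; simp
  unfold dirichlet
  have hinj : InjOn (fun z : ℂ => (s : ℂ) * z) (ball 0 1) := fun a _ b _ hab =>
    mul_left_cancel₀ (by exact_mod_cast hs.ne') hab
  have hsub : (fun z : ℂ => (s : ℂ) * z) '' ball 0 1 ⊆ ball 0 1 := by
    rintro _ ⟨z, hz, rfl⟩
    rw [mem_ball_zero_iff] at hz ⊢
    rw [hsc]
    nlinarith [norm_nonneg z]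
  refine le_trans ?_ (lintegral_mono_set hsub)
  have hfd : ∀ z ∈ ball (0 : ℂ) 1, HasFDerivWithinAt (fun z : ℂ => (s : ℂ) * z)
      (s • ContinuousLinearMap.id ℝ ℂ) (ball 0 1) z := by
    intro z _
    have := ((s • ContinuousLinearMap.id ℝ ℂ).hasFDerivAt (x := z)).hasFDerivWithinAt
      (s := ball 0 1)
    refine this.congr (fun y _ => ?_) ?_ <;> simp
  rw [lintegral_image_eq_lintegral_abs_det_fderiv_mul volume measurableSet_ball hfd hinj]
  refine setLIntegral_mono' measurableSet_ball fun z hz => ?_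
  have hdet : (s • ContinuousLinearMap.id ℝ ℂ).det = s ^ 2 := by
    simp [ContinuousLinearMap.det]
  rw [hdet, ← ENNReal.ofReal_mul (abs_nonneg _), hderiv, hsc, hsc]
  refine ENNReal.ofReal_le_ofReal ?_
  rw [abs_of_nonneg (by positivity)]
  have h2 : s ^ 2 * ‖z‖ ^ 2 ≤ ‖z‖ ^ 2 :=
    mul_le_of_le_one_left (sq_nonneg _) (pow_le_one₀ hs.le hs1.le)
  have h3 : 0 ≤ s ^ 2 * ‖deriv F (s * z)‖ ^ 2 := by positivity
  nlinarith

/-! ## Harmonic extension and the maximum principle -/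

lemma exists_polynomial_re_near {h : ℂ → ℝ} (hh : ContinuousOn h (sphere 0 1)) {ε : ℝ}
    (hε : 0 < ε) : ∃ P : Polynomial ℂ, ∀ ξ ∈ sphere (0 : ℂ) 1, |(P.eval ξ).re - h ξ| ≤ ε := by
  have : Fact ((0 : ℝ) < 1) := ⟨one_pos⟩
  set f : C(AddCircle (1 : ℝ), ℂ) := ⟨fun x => (h (AddCircle.toCircle x : ℂ) : ℂ), by
    refine Complex.continuous_ofReal.comp (hh.comp_continuous ?_ fun x =>
      mem_sphere_zero_iff_norm.2 (Circle.norm_coe _))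
    exact continuous_subtype_val.comp AddCircle.continuous_toCircle⟩ with hf
  have hspan : ∀ g ∈ Submodule.span ℂ (range (@fourier 1)), ∃ P Q : Polynomial ℂ,
      ∀ x : AddCircle (1 : ℝ), g x = P.eval (AddCircle.toCircle x : ℂ) +
        conj (Q.eval (AddCircle.toCircle x : ℂ)) := by
    intro g hg
    induction hg using Submodule.span_induction with
    | mem g hg =>
      obtain ⟨n, rfl⟩ := hg
      rcases Int.eq_nat_or_neg n with ⟨k, rfl | rfl⟩
      · exact ⟨Polynomial.X ^ k, 0, fun x => by simp [AddCircle.toCircle_nsmul]⟩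
      · exact ⟨0, Polynomial.X ^ k, fun x => by
          rw [fourier_neg]; simp [AddCircle.toCircle_nsmul]⟩
    | zero => exact ⟨0, 0, fun x => by simp⟩
    | add g₁ g₂ _ _ h₁ h₂ =>
      obtain ⟨P₁, Q₁, h₁⟩ := h₁
      obtain ⟨P₂, Q₂, h₂⟩ := h₂
      exact ⟨P₁ + P₂, Q₁ + Q₂, fun x => by simp [h₁, h₂]; ring⟩
    | smul c g _ h₁ =>
      obtain ⟨P₁, Q₁, h₁⟩ := h₁
      exact ⟨Polynomial.C c * P₁, Polynomial.C (conj c) * Q₁, fun x => by simp [h₁]; ring⟩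
  have hmem : f ∈ closure (Submodule.span ℂ (range (@fourier 1)) :
      Set C(AddCircle (1 : ℝ), ℂ)) := by
    have := span_fourier_closure_eq_top (T := 1)
    rw [← Submodule.topologicalClosure_coe, this]
    trivial
  obtain ⟨g, hg, hfg⟩ := Metric.mem_closure_iff.1 hmem ε hε
  obtain ⟨P, Q, hPQ⟩ := hspan g hg
  refine ⟨P + Q, fun ξ hξ => ?_⟩
  obtain ⟨x, hx⟩ := (AddCircle.homeomorphCircle (one_ne_zero)).surjective
    (⟨ξ, hξ⟩ : Circle)
  rw [AddCircle.homeomorphCircle_apply] at hx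
  have hx' : (AddCircle.toCircle x : ℂ) = ξ := by rw [hx]
  have h1 := (ContinuousMap.dist_apply_le_dist x).trans hfg.le
  rw [dist_comm, dist_eq_norm, hPQ x, hx'] at h1
  refine le_trans ?_ ((Complex.abs_re_le_norm _).trans h1)
  simp [hf, hx']

/-- The harmonic extension of `h` evaluated at `z`. -/
noncomputable def diskAvg (z : ℂ) (h : ℂ → ℝ) : ℝ :=
  Real.circleAverage (fun ξ => h (mob z ξ)) 0 1

lemma continuousOn_mob {b : ℂ} (hb : ‖b‖ < 1) : ContinuousOn (mob b) (closedBall 0 1) :=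
  fun _ hz => (hasDerivAt_mob hb (mem_closedBall_zero_iff.1 hz)).continuousAt.continuousWithinAt

lemma mapsTo_mob_sphere {b : ℂ} (hb : ‖b‖ < 1) : MapsTo (mob b) (sphere 0 1) (sphere 0 1) :=
  fun _ hz => mem_sphere_zero_iff_norm.2 (norm_mob_eq_one hb (mem_sphere_zero_iff_norm.1 hz))

lemma mapsTo_mob_closedBall {b : ℂ} (hb : ‖b‖ < 1) :
    MapsTo (mob b) (closedBall 0 1) (closedBall 0 1) :=
  fun _ hz => mem_closedBall_zero_iff.2 (norm_mob_le_one hb (mem_closedBall_zero_iff.1 hz))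

lemma continuousOn_comp_mob {h : ℂ → ℝ} (hh : ContinuousOn h (sphere 0 1)) {z : ℂ} (hz : ‖z‖ < 1) :
    ContinuousOn (fun ξ => h (mob z ξ)) (sphere 0 1) :=
  hh.comp ((continuousOn_mob hz).mono sphere_subset_closedBall) (mapsTo_mob_sphere hz)

lemma circleIntegrable_comp_mob {h : ℂ → ℝ} (hh : ContinuousOn h (sphere 0 1)) {z : ℂ}
    (hz : ‖z‖ < 1) : CircleIntegrable (fun ξ => h (mob z ξ)) 0 1 :=
  ContinuousOn.circleIntegrable' (by simpa using continuousOn_comp_mob hh hz)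

lemma diskAvg_mono {h₁ h₂ : ℂ → ℝ} (hh₁ : ContinuousOn h₁ (sphere 0 1))
    (hh₂ : ContinuousOn h₂ (sphere 0 1)) (h : ∀ ξ ∈ sphere (0 : ℂ) 1, h₁ ξ ≤ h₂ ξ) {z : ℂ}
    (hz : ‖z‖ < 1) : diskAvg z h₁ ≤ diskAvg z h₂ :=
  Real.circleAverage_mono (circleIntegrable_comp_mob hh₁ hz) (circleIntegrable_comp_mob hh₂ hz)
    fun ξ hξ => h _ (mapsTo_mob_sphere hz (by simpa using hξ))

lemma diskAvg_add {h₁ h₂ : ℂ → ℝ} (hh₁ : ContinuousOn h₁ (sphere 0 1))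
    (hh₂ : ContinuousOn h₂ (sphere 0 1)) {z : ℂ} (hz : ‖z‖ < 1) :
    diskAvg z (fun ξ => h₁ ξ + h₂ ξ) = diskAvg z h₁ + diskAvg z h₂ :=
  Real.circleAverage_fun_add (circleIntegrable_comp_mob hh₁ hz) (circleIntegrable_comp_mob hh₂ hz)

lemma diskAvg_sub {h₁ h₂ : ℂ → ℝ} (hh₁ : ContinuousOn h₁ (sphere 0 1))
    (hh₂ : ContinuousOn h₂ (sphere 0 1)) {z : ℂ} (hz : ‖z‖ < 1) :
    diskAvg z (fun ξ => h₁ ξ - h₂ ξ) = diskAvg z h₁ - diskAvg z h₂ :=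
  Real.circleAverage_fun_sub (circleIntegrable_comp_mob hh₁ hz) (circleIntegrable_comp_mob hh₂ hz)

lemma diskAvg_const_mul (c : ℝ) (h : ℂ → ℝ) (z : ℂ) :
    diskAvg z (fun ξ => c * h ξ) = c * diskAvg z h := by
  simpa [diskAvg] using Real.circleAverage_fun_smul (a := c) (f := fun ξ => h (mob z ξ))
    (c := 0) (R := 1)

lemma diskAvg_const (c : ℝ) (z : ℂ) : diskAvg z (fun _ => c) = c :=
  Real.circleAverage_const c 0 1

lemma diskAvg_re {F : ℂ → ℂ} {R : ℝ} (hR : 1 < R) (hF : DifferentiableOn ℂ F (ball 0 R)) {z : ℂ}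
    (hz : ‖z‖ < 1) : diskAvg z (fun ξ => (F ξ).re) = (F z).re := by
  have hsub : closedBall (0 : ℂ) 1 ⊆ ball 0 R := closedBall_subset_ball hR
  have hc : ContinuousOn (F ∘ mob z) (closedBall 0 1) :=
    (hF.continuousOn.mono hsub).comp (continuousOn_mob hz) (mapsTo_mob_closedBall hz)
  have hd : DiffContOnCl ℂ (F ∘ mob z) (ball 0 |1|) := by
    refine ⟨?_, ?_⟩
    · rw [abs_one]
      exact hF.comp (differentiableOn_mob hz)
        ((mapsTo_mob hz).mono_right (ball_subset_ball hR.le))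
    · rw [abs_one, closure_ball _ one_ne_zero]; exact hc
  have h1 := hd.circleAverage
  have h2 := Complex.reCLM.circleAverage_comp_comm (f := F ∘ mob z) (c := 0) (R := 1)
    (ContinuousOn.circleIntegrable' (by simpa using hc.mono sphere_subset_closedBall))
  rw [h1] at h2
  simpa [diskAvg, Function.comp_def] using h2

lemma abs_re_sub_diskAvg_le {h : ℂ → ℝ} (hh : ContinuousOn h (sphere 0 1)) {ε : ℝ}
    {P : Polynomial ℂ} (hP : ∀ ξ ∈ sphere (0 : ℂ) 1, |(P.eval ξ).re - h ξ| ≤ ε) {z : ℂ}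
    (hz : ‖z‖ < 1) : |(P.eval z).re - diskAvg z h| ≤ ε := by
  have hPc : ContinuousOn (fun ξ => (P.eval ξ).re) (sphere 0 1) :=
    (Complex.continuous_re.comp P.continuous).continuousOn
  have h1 : diskAvg z (fun ξ => (P.eval ξ).re) = (P.eval z).re :=
    diskAvg_re one_lt_two P.differentiable.differentiableOn hz
  rw [← h1, abs_le, ← diskAvg_sub hPc hh hz]
  constructor
  · rw [← diskAvg_const (-ε) z]
    exact diskAvg_mono continuousOn_const (hPc.sub hh) (fun ξ hξ => (abs_le.1 (hP ξ hξ)).1) hz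
  · rw [← diskAvg_const ε z]
    exact diskAvg_mono (hPc.sub hh) continuousOn_const (fun ξ hξ => (abs_le.1 (hP ξ hξ)).2) hz

lemma circleAverage_lt_of_exists_lt {f : ℂ → ℝ} {c : ℂ} {ρ m : ℝ}
    (hf : ContinuousOn f (sphere c |ρ|)) (hle : ∀ z ∈ sphere c |ρ|, f z ≤ m)
    (hlt : f (c + ρ) < m) : Real.circleAverage f c ρ < m := by
  rw [Real.circleAverage_def, smul_eq_mul, inv_mul_lt_iff₀ Real.two_pi_pos]
  have hmem : ∀ θ, circleMap c ρ θ ∈ sphere c |ρ| := fun θ => by simp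
  have h1 : ∫ θ in (0 : ℝ)..2 * Real.pi, f (circleMap c ρ θ) <
      ∫ _ in (0 : ℝ)..2 * Real.pi, m := by
    refine intervalIntegral.integral_lt_integral_of_continuousOn_of_le_of_exists_lt
      Real.two_pi_pos ?_ continuousOn_const (fun θ _ => hle _ (hmem θ)) ⟨0, ?_, ?_⟩
    · exact (hf.comp_continuous (continuous_circleMap c ρ) hmem).continuousOn
    · exact ⟨le_rfl, Real.two_pi_pos.le⟩
    · simpa [circleMap] using hlt
  simpa using h1

lemma maximum_principle_sublevel {D H : ℂ → ℝ} {c M : ℝ} (hD : ContinuousOn D (closedBall 0 1))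
    (hH : ContinuousOn H (closedBall 0 1))
    (hmean : ∀ z ∈ ball (0 : ℂ) 1, H z < c →
      ∃ ρ₀ > 0, ∀ ρ ∈ Ioo 0 ρ₀, Real.circleAverage D z ρ = D z)
    (hcirc : ∀ z ∈ sphere (0 : ℂ) 1, H z ≤ c → D z ≤ M)
    (hlev : ∀ z ∈ ball (0 : ℂ) 1, H z = c → D z ≤ M) {z : ℂ} (hz : z ∈ closedBall (0 : ℂ) 1)
    (hHz : H z ≤ c) : D z ≤ M := by
  set K : Set ℂ := {z ∈ closedBall (0 : ℂ) 1 | H z ≤ c} with hK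
  have hKc : IsCompact K := (isCompact_closedBall (0 : ℂ) 1).of_isClosed_subset
    (hH.preimage_isClosed_of_isClosed isClosed_closedBall isClosed_Iic) fun z hz => hz.1
  have hDK : ContinuousOn D K := hD.mono fun z hz => hz.1
  obtain ⟨y, hyK, hy⟩ := hKc.exists_isMaxOn ⟨z, hz, hHz⟩ hDK
  by_contra hcon
  have hyM : M < D y := (not_le.1 hcon).trans_le (hy ⟨hz, hHz⟩)
  set K' : Set ℂ := {x ∈ K | D y ≤ D x} with hK'
  have hK'c : IsCompact K' := hKc.of_isClosed_subset
    (hDK.preimage_isClosed_of_isClosed hKc.isClosed isClosed_Ici) fun z hz => hz.1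
  obtain ⟨x, hxK', hx⟩ := hK'c.exists_isMaxOn ⟨y, hyK, le_rfl⟩ Complex.continuous_re.continuousOn
  obtain ⟨⟨hx1, hxH⟩, hxD⟩ := hxK'
  have hxM : M < D x := hyM.trans_le hxD
  have hx2 : x ∈ ball (0 : ℂ) 1 := by
    rcases (mem_closedBall_zero_iff.1 hx1).lt_or_eq with h | h
    · exact mem_ball_zero_iff.2 h
    · exact absurd (hcirc x (mem_sphere_zero_iff_norm.2 h) hxH) (not_le.2 hxM)
  have hxH' : H x < c := by
    rcases hxH.lt_or_eq with h | h
    · exact h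
    · exact absurd (hlev x hx2 h) (not_le.2 hxM)
  obtain ⟨ρ₀, hρ₀, hρ⟩ := hmean x hx2 hxH'
  have hnhds : {w | w ∈ ball (0 : ℂ) 1 ∧ H w < c} ∈ 𝓝 x := by
    have hxn : closedBall (0 : ℂ) 1 ∈ 𝓝 x :=
      mem_of_superset (isOpen_ball.mem_nhds hx2) ball_subset_closedBall
    filter_upwards [isOpen_ball.mem_nhds hx2, (hH.continuousAt hxn).eventually (gt_mem_nhds hxH')]
      with w h1 h2 using ⟨h1, h2⟩
  obtain ⟨δ, hδ, hball⟩ := Metric.mem_nhds_iff.1 hnhds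
  set ρ := min ρ₀ δ / 2 with hρdef
  have hρ0 : 0 < ρ := by positivity
  have hmin : 0 < min ρ₀ δ := lt_min hρ₀ hδ
  have hρlt : ρ < ρ₀ := by have := min_le_left ρ₀ δ; linarith
  have hρδ : ρ < δ := by have := min_le_right ρ₀ δ; linarith
  have hsub : sphere x |ρ| ⊆ ball x δ := by
    rw [abs_of_pos hρ0]; exact sphere_subset_closedBall.trans (closedBall_subset_ball hρδ)
  have hKsub : ∀ w ∈ sphere x |ρ|, w ∈ K := fun w hw =>
    ⟨ball_subset_closedBall (hball (hsub hw)).1, (hball (hsub hw)).2.le⟩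
  have hle : ∀ w ∈ sphere x |ρ|, D w ≤ D x := fun w hw => (hy (hKsub w hw)).trans hxD
  have hw0 : x + ρ ∈ sphere x |ρ| := by simp
  have hlt : D (x + ρ) < D x := by
    refine lt_of_not_ge fun hge => ?_
    have h1 : (x + ρ).re ≤ x.re := hx ⟨hKsub _ hw0, hxD.trans hge⟩
    simp at h1
    linarith
  have := circleAverage_lt_of_exists_lt (hD.mono fun w hw => (hKsub w hw).1) hle hlt
  rw [hρ ρ ⟨hρ0, hρlt⟩] at this
  exact lt_irrefl _ this

/-! ## A John-Nirenberg type inequality -/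

section JohnNirenberg

variable {F : ℂ → ℂ} {R : ℝ}

lemma continuousOn_re_of_differentiableOn (hR : 1 < R) (hF : DifferentiableOn ℂ F (ball 0 R)) :
    ContinuousOn (fun z => (F z).re) (closedBall 0 1) :=
  Complex.continuous_re.comp_continuousOn (hF.continuousOn.mono (closedBall_subset_ball hR))

lemma circleAverage_re_of_differentiable {G : ℂ → ℂ} (hG : Differentiable ℂ G) (z : ℂ) (ρ : ℝ) :
    Real.circleAverage (fun w => (G w).re) z ρ = (G z).re := by
  have h1 := hG.diffContOnCl (s := ball z |ρ|) |>.circleAverage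
  have h2 := Complex.reCLM.circleAverage_comp_comm (f := G) (c := z) (R := ρ)
    hG.continuous.continuousOn.circleIntegrable'
  rw [h1] at h2
  simpa [Function.comp_def] using h2

lemma diskAvg_posPart_sq_le (hR : 1 < R) (hF : DifferentiableOn ℂ F (ball 0 R)) {B s c : ℝ}
    (hB : ∀ b : ℂ, ‖b‖ < 1 → diskAvg b (fun ξ => ((F ξ).re - (F b).re) ^ 2) ≤ B) (hs : 0 < s)
    {z : ℂ} (hz : ‖z‖ < 1) (hc : (F z).re ≤ c) :
    diskAvg z (fun ξ => (max ((F ξ).re - c) 0) ^ 2) ≤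
      B / s * diskAvg z (fun ξ => max ((F ξ).re - c + s) 0) := by
  have hu := continuousOn_re_of_differentiableOn hR hF
  have hus := hu.mono (sphere_subset_closedBall (x := (0 : ℂ)))
  set h₁ : ℂ → ℝ := fun ξ => (max ((F ξ).re - c) 0) ^ 2 with hh₁
  set h₂ : ℂ → ℝ := fun ξ => max ((F ξ).re - c + s) 0 with hh₂
  have hc₁ : ContinuousOn h₁ (sphere 0 1) := by fun_prop
  have hc₂ : ContinuousOn h₂ (sphere 0 1) := by fun_prop
  have hB0 : 0 ≤ B := by
    refine le_trans ?_ (hB 0 (by simp))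
    rw [← diskAvg_const 0 0]
    exact diskAvg_mono continuousOn_const (by fun_prop) (fun ξ _ => by positivity) (by simp)
  refine le_of_forall_pos_le_add fun ε hε => ?_
  set η := ε / (2 * (1 + B / s)) with hη
  have hBs : 0 ≤ B / s := by positivity
  have hη0 : 0 < η := by positivity
  obtain ⟨P₁, hP₁⟩ := exists_polynomial_re_near hc₁ hη0
  obtain ⟨P₂, hP₂⟩ := exists_polynomial_re_near hc₂ hη0
  set G : ℂ → ℂ := fun w => P₁.eval w - (B / s : ℝ) * P₂.eval w with hG
  have hGd : Differentiable ℂ G := by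
    have := P₁.differentiable
    have := P₂.differentiable
    fun_prop
  have hGre : ∀ w, (G w).re = (P₁.eval w).re - B / s * (P₂.eval w).re := fun w => by
    simp [hG]
  have hmain : (G z).re ≤ η * (1 + B / s) := by
    refine maximum_principle_sublevel (D := fun w => (G w).re) (H := fun w => (F w).re) (c := c)
      (Complex.continuous_re.comp hGd.continuous).continuousOn hu
      (fun w _ _ => ⟨1, one_pos, fun ρ _ => circleAverage_re_of_differentiable hGd w ρ⟩)
      ?_ ?_ (mem_closedBall_zero_iff.2 hz.le) hc
    · intro w hw hwc
      have h1 := (abs_le.1 (hP₁ w hw)).2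
      have h2 := (abs_le.1 (hP₂ w hw)).1
      have h3 : h₁ w = 0 := by simp only [hh₁]; rw [max_eq_right (by linarith)]; simp
      have h4 : 0 ≤ h₂ w := le_max_right _ _
      rw [hGre]
      have : B / s * (-η) ≤ B / s * (P₂.eval w).re := by gcongr; linarith
      linarith
    · intro w hw hwc
      have hw1 := mem_ball_zero_iff.1 hw
      have h1 := (abs_le.1 (abs_re_sub_diskAvg_le hc₁ hP₁ hw1)).2
      have h2 := (abs_le.1 (abs_re_sub_diskAvg_le hc₂ hP₂ hw1)).1
      have h3 : diskAvg w h₁ ≤ B := by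
        refine le_trans (diskAvg_mono hc₁ (by fun_prop) (fun ξ _ => ?_) hw1) (hB w hw1)
        simp only [hh₁]
        rw [hwc]
        rcases max_cases ((F ξ).re - c) 0 with h | h <;> rw [h.1]
        nlinarith
      have h4 : s ≤ diskAvg w h₂ := by
        have h5 : diskAvg w (fun ξ => (F ξ).re - c + s) = s := by
          rw [diskAvg_add (by fun_prop) (by fun_prop) hw1, diskAvg_sub hus (by fun_prop) hw1,
            diskAvg_re hR hF hw1, diskAvg_const, diskAvg_const, hwc]
          ring
        rw [← h5]
        exact diskAvg_mono (by fun_prop) hc₂ (fun ξ _ => le_max_left _ _) hw1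
      rw [hGre]
      have h6 : B / s * (s - η) ≤ B / s * (P₂.eval w).re := by gcongr; linarith
      have h7 : B / s * s = B := by field_simp
      linarith
  have h1 := (abs_le.1 (abs_re_sub_diskAvg_le hc₁ hP₁ hz)).1
  have h2 := (abs_le.1 (abs_re_sub_diskAvg_le hc₂ hP₂ hz)).2
  rw [hGre] at hmain
  have h3 : B / s * (P₂.eval z).re ≤ B / s * (diskAvg z h₂ + η) := by gcongr; linarith
  have h4 : 2 * (η * (1 + B / s)) = ε := by rw [hη]; field_simp
  linarith

lemma diskAvg_posPart_le (hR : 1 < R) (hF : DifferentiableOn ℂ F (ball 0 R)) {A B : ℝ} (hA : 0 < A)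
    (hB : ∀ b : ℂ, ‖b‖ < 1 → diskAvg b (fun ξ => ((F ξ).re - (F b).re) ^ 2) ≤ B)
    (h : ∀ b : ℂ, ‖b‖ < 1 → diskAvg b (fun ξ => |(F ξ).re - (F b).re|) ≤ A) {b : ℂ}
    (hb : ‖b‖ < 1) :
    diskAvg b (fun ξ => (max ((F ξ).re - (F b).re) 0) ^ 2) ≤ B / 4 + 128 * A ^ 2 := by
  have hus := (continuousOn_re_of_differentiableOn hR hF).mono
    (sphere_subset_closedBall (x := (0 : ℂ)))
  have hs : 0 < 8 * A := by positivity
  have h1 := diskAvg_posPart_sq_le hR hF hB hs (c := (F b).re + 8 * A) hb (by linarith)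
  have hB0 : 0 ≤ B := by
    refine le_trans ?_ (hB 0 (by simp))
    rw [← diskAvg_const 0 0]
    exact diskAvg_mono continuousOn_const (by fun_prop) (fun ξ _ => by positivity) (by simp)
  have h2 : diskAvg b (fun ξ => max ((F ξ).re - ((F b).re + 8 * A) + 8 * A) 0) ≤ A := by
    refine (diskAvg_mono (by fun_prop) (by fun_prop) (fun ξ _ => ?_) hb).trans (h b hb)
    refine max_le ?_ (abs_nonneg _)
    refine le_trans (le_of_eq ?_) (le_abs_self _)
    ring
  have h3 : diskAvg b (fun ξ => (max ((F ξ).re - (F b).re) 0) ^ 2) ≤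
      diskAvg b (fun ξ => 2 * (max ((F ξ).re - ((F b).re + 8 * A)) 0) ^ 2 + 2 * (8 * A) ^ 2) := by
    refine diskAvg_mono (by fun_prop) (by fun_prop) (fun ξ _ => ?_) hb
    set t := (F ξ).re - (F b).re with ht
    have e : (F ξ).re - ((F b).re + 8 * A) = t - 8 * A := by rw [ht]; ring
    rw [e]
    rcases max_cases t 0 with h4 | h4 <;> rcases max_cases (t - 8 * A) 0 with h5 | h5 <;>
      rw [h4.1, h5.1] <;> nlinarith [sq_nonneg (t - 16 * A)]
  rw [diskAvg_add (by fun_prop) (by fun_prop) hb, diskAvg_const_mul, diskAvg_const] at h3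
  have h4 : B / (8 * A) * diskAvg b (fun ξ => max ((F ξ).re - ((F b).re + 8 * A) + 8 * A) 0) ≤
      B / (8 * A) * A := by gcongr
  have h5 : B / (8 * A) * A = B / 8 := by field_simp
  linarith

lemma diskAvg_sq_le (hR : 1 < R) (hF : DifferentiableOn ℂ F (ball 0 R)) {A : ℝ} (hA : 0 < A)
    (h : ∀ b : ℂ, ‖b‖ < 1 → diskAvg b (fun ξ => |(F ξ).re - (F b).re|) ≤ A) {b : ℂ}
    (hb : ‖b‖ < 1) :
    diskAvg b (fun ξ => ((F ξ).re - (F b).re) ^ 2) ≤ 512 * A ^ 2 := by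
  have hu := continuousOn_re_of_differentiableOn hR hF
  have hus := hu.mono (sphere_subset_closedBall (x := (0 : ℂ)))
  have himp : ∀ B, (∀ b : ℂ, ‖b‖ < 1 → diskAvg b (fun ξ => ((F ξ).re - (F b).re) ^ 2) ≤ B) →
      ∀ b : ℂ, ‖b‖ < 1 → diskAvg b (fun ξ => ((F ξ).re - (F b).re) ^ 2) ≤
        B / 2 + 256 * A ^ 2 := by
    intro B hB b hb
    have h1 := diskAvg_posPart_le hR hF hA hB h hb
    have h2 := diskAvg_posPart_le hR hF.neg hA (B := B) (fun b hb => by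
      refine le_of_eq_of_le ?_ (hB b hb)
      congr 1; ext ξ; simp; ring) (fun b hb => by
      refine le_of_eq_of_le ?_ (h b hb)
      congr 1; ext ξ; simp only [Pi.neg_apply, Complex.neg_re]; rw [← abs_neg]; congr 1; ring) hb
    have h3 : diskAvg b (fun ξ => ((F ξ).re - (F b).re) ^ 2) =
        diskAvg b (fun ξ => (max ((F ξ).re - (F b).re) 0) ^ 2 +
          (max (((-F) ξ).re - ((-F) b).re) 0) ^ 2) := by
      congr 1; ext ξ
      simp only [Pi.neg_apply, Complex.neg_re]
      rcases max_cases ((F ξ).re - (F b).re) 0 with h4 | h4 <;>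
        rcases max_cases (-(F ξ).re - -(F b).re) 0 with h5 | h5 <;> rw [h4.1, h5.1] <;> nlinarith
    rw [h3, diskAvg_add (by fun_prop) (by simp only [Pi.neg_apply, Complex.neg_re]; fun_prop) hb]
    linarith
  obtain ⟨M, hM⟩ := (isCompact_closedBall (0 : ℂ) 1).exists_bound_of_continuousOn hu
  set S : Set ℝ := (fun b => diskAvg b (fun ξ => ((F ξ).re - (F b).re) ^ 2)) '' ball 0 1 with hS
  have hbdd : BddAbove S := by
    refine ⟨(2 * M) ^ 2, ?_⟩
    rintro _ ⟨b, hb, rfl⟩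
    have hb1 := mem_ball_zero_iff.1 hb
    simp only
    rw [← diskAvg_const ((2 * M) ^ 2) b]
    refine diskAvg_mono (by fun_prop) continuousOn_const (fun ξ hξ => ?_) hb1
    have h1 := abs_le.1 (hM ξ (sphere_subset_closedBall hξ))
    have h2 := abs_le.1 (hM b (ball_subset_closedBall hb))
    exact sq_le_sq' (by linarith) (by linarith)
  have hne : S.Nonempty := ⟨_, 0, by simp, rfl⟩
  have hle : ∀ b : ℂ, ‖b‖ < 1 → diskAvg b (fun ξ => ((F ξ).re - (F b).re) ^ 2) ≤ sSup S :=
    fun b hb => le_csSup hbdd ⟨b, mem_ball_zero_iff.2 hb, rfl⟩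
  have h1 : sSup S ≤ sSup S / 2 + 256 * A ^ 2 := by
    refine csSup_le hne ?_
    rintro _ ⟨b, hb, rfl⟩
    exact himp _ hle b (mem_ball_zero_iff.1 hb)
  linarith [hle b hb]

lemma exists_ball_subset_of_closedBall_subset {U : Set ℂ} (hU : IsOpen U)
    (h : closedBall (0 : ℂ) 1 ⊆ U) : ∃ r > 1, ball (0 : ℂ) r ⊆ U := by
  obtain ⟨δ, hδ, hsub⟩ := (isCompact_closedBall (0 : ℂ) 1).exists_thickening_subset_open hU h
  rw [thickening_closedBall hδ zero_le_one] at hsub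
  exact ⟨δ + 1, by linarith, hsub⟩

lemma exists_differentiableOn_comp_mob (hR : 1 < R) (hF : DifferentiableOn ℂ F (ball 0 R)) {b : ℂ}
    (hb : ‖b‖ < 1) : ∃ r > 1, DifferentiableOn ℂ (F ∘ mob b) (ball 0 r) := by
  have hUo : IsOpen {z : ℂ | 1 + conj b * z ≠ 0} := isOpen_ne_fun (by fun_prop) (by fun_prop)
  have hd : DifferentiableOn ℂ (mob b) {z : ℂ | 1 + conj b * z ≠ 0} := by
    intro z hz
    have hz' : 1 + conj b * z ≠ 0 := hz
    have h1 : DifferentiableAt ℂ (fun z : ℂ => 1 + conj b * z) z :=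
      (differentiableAt_id.const_mul (conj b)).const_add 1
    exact ((differentiableAt_id.add_const b).div h1 hz').differentiableWithinAt
  obtain ⟨r, hr, hsub⟩ := exists_ball_subset_of_closedBall_subset
    (hd.continuousOn.isOpen_inter_preimage hUo (isOpen_ball (x := (0 : ℂ)) (ε := R)))
    (fun z hz => ⟨den_ne_zero hb (mem_closedBall_zero_iff.1 hz),
      closedBall_subset_ball hR (mapsTo_mob_closedBall hb hz)⟩)
  exact ⟨r, hr, hF.comp (hd.mono fun z hz => (hsub hz).1) fun z hz => (hsub hz).2⟩

lemma diskAvg_norm_sq (hR : 1 < R) (hF : DifferentiableOn ℂ F (ball 0 R)) {b : ℂ} (hb : ‖b‖ < 1) :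
    diskAvg b (fun ξ => ‖F ξ - F b‖ ^ 2) = 2 * diskAvg b (fun ξ => ((F ξ).re - (F b).re) ^ 2) := by
  have hFs : ContinuousOn F (sphere 0 1) :=
    hF.continuousOn.mono (sphere_subset_closedBall.trans (closedBall_subset_ball hR))
  have hu := (continuousOn_re_of_differentiableOn hR hF).mono
    (sphere_subset_closedBall (x := (0 : ℂ)))
  have h1 : diskAvg b (fun ξ => ((F ξ - F b) ^ 2).re) = 0 := by
    rw [diskAvg_re (F := fun ξ => (F ξ - F b) ^ 2) hR (by fun_prop) hb]
    simp
  have h2 : (fun ξ => ‖F ξ - F b‖ ^ 2) =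
      fun ξ => 2 * ((F ξ).re - (F b).re) ^ 2 - ((F ξ - F b) ^ 2).re := by
    ext ξ
    rw [← Complex.normSq_eq_norm_sq, Complex.normSq_apply]
    simp [pow_two]
    ring
  have h3 : ContinuousOn (fun ξ => ((F ξ - F b) ^ 2).re) (sphere 0 1) :=
    Complex.continuous_re.comp_continuousOn ((hFs.sub continuousOn_const).pow 2)
  rw [h2, diskAvg_sub (by fun_prop) h3 hb, h1, diskAvg_const_mul, sub_zero]

/-- A one-sided mean oscillation bound controls the Dirichlet integral. -/
lemma dirichlet_comp_mob_le (hR : 1 < R) (hF : DifferentiableOn ℂ F (ball 0 R)) {A : ℝ}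
    (hA : 0 < A)
    (h : ∀ b : ℂ, ‖b‖ < 1 → diskAvg b (fun ξ => max ((F b).re - (F ξ).re) 0) ≤ A) {b : ℂ}
    (hb : ‖b‖ < 1) : dirichlet (deriv (F ∘ mob b)) ≤ ENNReal.ofReal (2 ^ 14 * A ^ 2) := by
  have hu := (continuousOn_re_of_differentiableOn hR hF).mono
    (sphere_subset_closedBall (x := (0 : ℂ)))
  have h1 : ∀ b : ℂ, ‖b‖ < 1 → diskAvg b (fun ξ => |(F ξ).re - (F b).re|) ≤ 2 * A := by
    intro b hb
    have h2 : (fun ξ => |(F ξ).re - (F b).re|) =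
        fun ξ => 2 * max ((F b).re - (F ξ).re) 0 + ((F ξ).re - (F b).re) := by
      ext ξ
      rcases max_cases ((F b).re - (F ξ).re) 0 with h4 | h4 <;> rw [h4.1]
      · rw [abs_of_nonpos (by linarith)]; ring
      · rw [abs_of_nonneg (by linarith)]; ring
    rw [h2, diskAvg_add (by fun_prop) (by fun_prop) hb, diskAvg_const_mul,
      diskAvg_sub hu (by fun_prop) hb, diskAvg_re hR hF hb, diskAvg_const]
    linarith [h b hb]
  have h2 := diskAvg_sq_le hR hF (by positivity) h1 hb
  obtain ⟨r, hr, hd⟩ := exists_differentiableOn_comp_mob hR hF hb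
  refine (littlewoodPaley hr hd).2.trans (ENNReal.ofReal_le_ofReal ?_)
  have h3 := diskAvg_norm_sq hR hF hb
  have h4 : Real.circleAverage (fun z => ‖(F ∘ mob b) z - (F ∘ mob b) 0‖ ^ 2) 0 1 =
      diskAvg b (fun ξ => ‖F ξ - F b‖ ^ 2) := by
    simp only [diskAvg, Function.comp_apply, mob_zero]
  rw [h4, h3]
  have h5 := Real.pi_lt_four
  have h6 : 0 ≤ diskAvg b (fun ξ => ((F ξ).re - (F b).re) ^ 2) := by
    rw [← diskAvg_const 0 b]
    exact diskAvg_mono continuousOn_const (by fun_prop) (fun ξ _ => by positivity) hb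
  calc Real.pi * (2 * diskAvg b (fun ξ => ((F ξ).re - (F b).re) ^ 2))
      ≤ 4 * (2 * (512 * (2 * A) ^ 2)) := by gcongr
    _ = 2 ^ 14 * A ^ 2 := by ring

end JohnNirenberg

/-! ## A weak-type estimate for Carleson measures -/

/-- The truncated Green kernel of the disk. -/
noncomputable def greenK (z w : ℂ) : ℝ := -Real.log (max (1 / 2) ‖mob (-w) z‖)

lemma measurable_greenK : Measurable fun p : ℂ × ℂ => greenK p.1 p.2 := by
  have : Measurable fun p : ℂ × ℂ => mob (-p.2) p.1 := by unfold mob; fun_prop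
  exact (Real.measurable_log.comp (measurable_const.max this.norm)).neg

lemma measurable_greenK_right (z : ℂ) : Measurable (greenK z) := by
  have : Measurable fun p : ℂ => mob (-p) z := by unfold mob; fun_prop
  exact (Real.measurable_log.comp (measurable_const.max this.norm)).neg

lemma greenK_le_log_two (z w : ℂ) : greenK z w ≤ Real.log 2 := by
  have h := Real.log_le_log (by norm_num) (le_max_left (1 / 2 : ℝ) ‖mob (-w) z‖)
  rw [one_div, Real.log_inv] at h
  unfold greenK
  rw [one_div]; linarith

lemma greenK_nonneg {z w : ℂ} (hw : ‖w‖ < 1) (hz : ‖z‖ ≤ 1) : 0 ≤ greenK z w := by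
  have h : ‖mob (-w) z‖ ≤ 1 := norm_mob_le_one (by simpa using hw) hz
  refine neg_nonneg.2 (Real.log_nonpos ?_ ?_)
  · exact le_max_of_le_left (by norm_num)
  · exact max_le (by norm_num) h

lemma norm_one_sub_conj_mul_comm (z w : ℂ) : ‖1 - conj w * z‖ = ‖1 - conj z * w‖ := by
  rw [← Complex.norm_conj]; simp [mul_comm]

lemma one_sub_normSq_mob_neg {z w : ℂ} (hw : ‖w‖ < 1) (hz : ‖z‖ ≤ 1) :
    1 - ‖mob (-w) z‖ ^ 2 = (1 - ‖w‖ ^ 2) * garsiaK z w := by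
  rw [one_sub_normSq_mob (by simpa using hw) hz, garsiaK, mul_div_assoc, norm_neg]
  have h := norm_one_sub_conj_mul_comm z w
  simp only [map_neg, neg_mul, ← sub_eq_add_neg]
  rw [h]

lemma greenK_le {z w : ℂ} (hw : ‖w‖ < 1) (hz : ‖z‖ ≤ 1) :
    greenK z w ≤ 2 * ((1 - ‖w‖ ^ 2) * garsiaK z w) := by
  rw [← one_sub_normSq_mob_neg hw hz]
  have h : ‖mob (-w) z‖ ≤ 1 := norm_mob_le_one (by simpa using hw) hz
  set t := ‖mob (-w) z‖ with ht
  have ht0 : 0 ≤ t := norm_nonneg _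
  have h1 : greenK z w ≤ 2 * (1 - max (1 / 2) t) := by
    have hm : (1 / 2 : ℝ) ≤ max (1 / 2) t := le_max_left _ _
    have hm1 : max (1 / 2) t ≤ 1 := max_le (by norm_num) h
    have h2 := Real.log_le_sub_one_of_pos (x := (max (1 / 2) t)⁻¹) (by positivity)
    rw [Real.log_inv] at h2
    refine h2.trans ?_
    have h3 : (max (1 / 2) t)⁻¹ - 1 = (1 - max (1 / 2) t) * (max (1 / 2) t)⁻¹ := by
      field_simp
    have h4 : (max (1 / 2) t)⁻¹ ≤ 2 := by
      rw [inv_le_comm₀ (by positivity) (by norm_num)]; linarith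
    rw [h3]
    nlinarith
  have h5 : t ≤ max (1 / 2) t := le_max_right _ _
  nlinarith

lemma greenK_eq_zero {z w : ℂ} (hw : ‖w‖ < 1) (hz : ‖z‖ = 1) : greenK z w = 0 := by
  unfold greenK
  rw [norm_mob_eq_one (by simpa using hw) hz, max_eq_right (by norm_num)]
  simp

lemma le_greenK_zero {w : ℂ} (hw : ‖w‖ < 1) : (1 - ‖w‖ ^ 2) / 2 ≤ greenK 0 w := by
  have h : greenK 0 w = -Real.log (max (1 / 2) ‖w‖) := by simp [greenK]
  rw [h]
  have hp : 0 < max (1 / 2) ‖w‖ := lt_of_lt_of_le (by norm_num) (le_max_left _ _)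
  have h2 := Real.log_le_sub_one_of_pos hp
  have h3 : max (1 / 2) ‖w‖ ≤ 1 - (1 - ‖w‖ ^ 2) / 2 :=
    max_le (by nlinarith [norm_nonneg w]) (by nlinarith [norm_nonneg w])
  linarith

lemma continuousOn_greenK {w : ℂ} (hw : ‖w‖ < 1) :
    ContinuousOn (fun z => greenK z w) (closedBall 0 1) := by
  have h := continuousOn_mob (b := -w) (by simpa using hw)
  refine (ContinuousOn.log (continuousOn_const.sup h.norm) fun z _ => ?_).neg
  exact (lt_of_lt_of_le (by norm_num) (le_max_left (1 / 2 : ℝ) _)).ne'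

lemma circleAverage_greenK {w z : ℂ} (hw : ‖w‖ < 1) {ρ : ℝ} (hρ : 0 < ρ)
    (hs : closedBall z ρ ⊆ ball 0 1) (ht : ∀ y ∈ closedBall z ρ, 1 / 2 ≤ ‖mob (-w) y‖) :
    Real.circleAverage (fun y => greenK y w) z ρ = greenK z w := by
  have hk : ∀ y ∈ closedBall z ρ, greenK y w = -Real.log ‖mob (-w) y‖ := fun y hy => by
    rw [greenK, max_eq_right (ht y hy)]
  have hh : InnerProductSpace.HarmonicOnNhd (fun y => Real.log ‖mob (-w) y‖)
      (closedBall z |ρ|) := by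
    intro y hy
    rw [abs_of_pos hρ] at hy
    refine AnalyticAt.harmonicAt_log_norm ?_ ?_
    · exact (differentiableOn_mob (by simpa using hw)).analyticAt (isOpen_ball.mem_nhds (hs hy))
    · exact norm_pos_iff.1 (lt_of_lt_of_le (by norm_num) (ht y hy))
  have h1 := hh.circleAverage_eq
  rw [hk z (mem_closedBall_self hρ.le), ← h1, ← neg_one_smul ℝ (Real.circleAverage _ _ _),
    ← Real.circleAverage_smul]
  refine Real.circleAverage_congr_sphere fun y hy => ?_
  rw [abs_of_pos hρ] at hy
  rw [hk y (sphere_subset_closedBall hy)]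
  simp

/-- Harnack's inequality. -/
lemma re_le_of_re_nonneg {G : ℂ → ℂ} {R : ℝ} (hR : 1 < R) (hG : DifferentiableOn ℂ G (ball 0 R))
    (h0 : ∀ z ∈ closedBall (0 : ℂ) 1, 0 ≤ (G z).re) {ζ : ℂ} (hζ : ‖ζ‖ ≤ 1 / 2) :
    (G ζ).re ≤ 3 * (G 0).re := by
  have hcb : closedBall (0 : ℂ) 1 ⊆ ball 0 R := closedBall_subset_ball hR
  have hd : DiffContOnCl ℂ G (ball 0 1) := by
    refine DifferentiableOn.diffContOnCl (hG.mono ?_)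
    exact closure_ball_subset_closedBall.trans hcb
  have hζ1 : ζ ∈ ball (0 : ℂ) 1 := by rw [mem_ball_zero_iff]; linarith
  have h1 := hd.circleAverage_re_herglotzRieszKernel_smul' hζ1
  have hGc : ContinuousOn G (sphere 0 1) :=
    hG.continuousOn.mono (sphere_subset_closedBall.trans hcb)
  have hne : ∀ z ∈ sphere (0 : ℂ) 1, z - ζ ≠ 0 := fun z hz h => by
    rw [sub_eq_zero] at h
    subst h
    rw [mem_sphere_zero_iff_norm] at hz; linarith
  have hKc : ContinuousOn (fun z : ℂ => ((z - 0 + (ζ - 0)) / ((z - 0) - (ζ - 0))).re)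
      (sphere 0 1) := by
    refine Complex.continuous_re.comp_continuousOn (ContinuousOn.div (by fun_prop) (by fun_prop) ?_)
    simpa using hne
  have h3 : Real.circleAverage
      (fun z : ℂ => ((z - 0 + (ζ - 0)) / ((z - 0) - (ζ - 0))).re * (G z).re) 0 1 = (G ζ).re := by
    rw [← h1]
    have := Complex.reCLM.circleAverage_comp_comm (c := 0) (R := 1)
      (f := fun z : ℂ => ((z - 0 + (ζ - 0)) / ((z - 0) - (ζ - 0))).re • G z)
      (ContinuousOn.circleIntegrable' (by rw [abs_one]; exact hKc.smul hGc))
    simpa [Function.comp_def] using this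
  have h4 : Real.circleAverage (fun z : ℂ => (G z).re) 0 1 = (G 0).re := by
    have h5 : Real.circleAverage G 0 1 = G 0 := DiffContOnCl.circleAverage (by simpa using hd)
    have := Complex.reCLM.circleAverage_comp_comm (c := 0) (R := 1) (f := G)
      (ContinuousOn.circleIntegrable' (by simpa using hGc))
    rw [h5] at this
    simpa [Function.comp_def] using this
  have hre : ContinuousOn (fun z => (G z).re) (sphere 0 1) :=
    Complex.continuous_re.comp_continuousOn hGc
  rw [← h3, ← h4, ← smul_eq_mul (3 : ℝ), ← Real.circleAverage_fun_smul]
  refine Real.circleAverage_mono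
    (ContinuousOn.circleIntegrable' (by rw [abs_one]; exact hKc.mul hre))
    (ContinuousOn.circleIntegrable' (by rw [abs_one]; exact hre.const_smul (3 : ℝ))) fun z hz => ?_
  have hz' : z ∈ sphere (0 : ℂ) 1 := by simpa using hz
  have h6 := re_herglotzRieszKernel_le hz' hζ1
  have h7 : (1 + ‖ζ - 0‖) / (1 - ‖ζ - 0‖) ≤ 3 := by
    rw [sub_zero, div_le_iff₀ (by linarith)]; linarith
  rw [smul_eq_mul]
  exact mul_le_mul_of_nonneg_right (h6.trans h7) (h0 z (sphere_subset_closedBall hz'))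

set_option linter.unusedSectionVars false

section Potential

variable {ν : Measure ℂ} [IsFiniteMeasure ν] {r S : ℝ}

/-- The truncated Green potential of a measure with density `1 / (1 - ‖w‖ ^ 2)`. -/
noncomputable def greenPot (ν : Measure ℂ) (z : ℂ) : ℝ := ∫ w, greenK z w / (1 - ‖w‖ ^ 2) ∂ν

lemma norm_greenK_div_le {z w : ℂ} (hr : r < 1) (hw : ‖w‖ ≤ r) (hz : ‖z‖ ≤ 1) :
    ‖greenK z w / (1 - ‖w‖ ^ 2)‖ ≤ Real.log 2 / (1 - r ^ 2) := by
  have hw1 : ‖w‖ < 1 := hw.trans_lt hr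
  have h0 := norm_nonneg w
  have h1 : 0 < 1 - r ^ 2 := by nlinarith
  have h2 : 1 - r ^ 2 ≤ 1 - ‖w‖ ^ 2 := by nlinarith
  rw [norm_div, Real.norm_of_nonneg (greenK_nonneg hw1 hz), Real.norm_of_nonneg (h1.le.trans h2)]
  exact div_le_div₀ (Real.log_nonneg (by norm_num)) (greenK_le_log_two z w) h1 h2

lemma measurable_greenK_div (z : ℂ) : Measurable fun w => greenK z w / (1 - ‖w‖ ^ 2) :=
  (measurable_greenK_right z).div (by fun_prop)

lemma integrable_greenK_div (hr : r < 1) (hν : ∀ᵐ w ∂ν, ‖w‖ ≤ r) {z : ℂ} (hz : ‖z‖ ≤ 1) :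
    Integrable (fun w => greenK z w / (1 - ‖w‖ ^ 2)) ν :=
  Integrable.of_bound (measurable_greenK_div z).aestronglyMeasurable _
    (hν.mono fun _ hw => norm_greenK_div_le hr hw hz)

lemma continuousOn_greenPot (hr : r < 1) (hν : ∀ᵐ w ∂ν, ‖w‖ ≤ r) :
    ContinuousOn (greenPot ν) (closedBall 0 1) := by
  refine continuousOn_of_dominated (bound := fun _ => Real.log 2 / (1 - r ^ 2)) ?_ ?_ ?_ ?_
  · exact fun z _ => (measurable_greenK_div z).aestronglyMeasurable
  · exact fun z hz => hν.mono fun w hw =>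
      norm_greenK_div_le hr hw (mem_closedBall_zero_iff.1 hz)
  · exact integrable_const _
  · exact hν.mono fun w hw => (continuousOn_greenK (hw.trans_lt hr)).div_const _

lemma greenPot_eq_zero (hr : r < 1) (hν : ∀ᵐ w ∂ν, ‖w‖ ≤ r) {z : ℂ} (hz : ‖z‖ = 1) :
    greenPot ν z = 0 := by
  refine integral_eq_zero_of_ae (hν.mono fun w hw => ?_)
  simp [greenK_eq_zero (hw.trans_lt hr) hz]

lemma greenPot_le (hr : r < 1) (hν : ∀ᵐ w ∂ν, ‖w‖ ≤ r) (hS : 0 ≤ S) {z : ℂ} (hz : ‖z‖ < 1)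
    (h : garsia ν z ≤ ENNReal.ofReal S) : greenPot ν z ≤ 2 * S := by
  have h1 : ENNReal.ofReal (greenPot ν z) ≤ ENNReal.ofReal (2 * S) := by
    rw [greenPot, ofReal_integral_eq_lintegral_ofReal (integrable_greenK_div hr hν hz.le)]
    · calc ∫⁻ w, ENNReal.ofReal (greenK z w / (1 - ‖w‖ ^ 2)) ∂ν
          ≤ ∫⁻ w, 2 * ENNReal.ofReal (garsiaK z w) ∂ν := by
            refine lintegral_mono_ae (hν.mono fun w hw => ?_)
            have hw1 := hw.trans_lt hr
            have h2 : 0 < 1 - ‖w‖ ^ 2 := by nlinarith [norm_nonneg w]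
            rw [show (2 : ℝ≥0∞) = ENNReal.ofReal 2 by simp, ← ENNReal.ofReal_mul (by norm_num)]
            refine ENNReal.ofReal_le_ofReal ?_
            rw [div_le_iff₀ h2]
            linarith [greenK_le hw1 hz.le]
        _ = 2 * garsia ν z := lintegral_const_mul _ (measurable_garsiaK z).ennreal_ofReal
        _ ≤ 2 * ENNReal.ofReal S := by gcongr
        _ = ENNReal.ofReal (2 * S) := by rw [ENNReal.ofReal_mul (by norm_num)]; simp
    · exact hν.mono fun w hw => div_nonneg (greenK_nonneg (hw.trans_lt hr) hz.le)
        (by nlinarith [norm_nonneg w])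
  exact (ENNReal.ofReal_le_ofReal_iff (by positivity)).1 h1

lemma circleAverage_greenPot (hr : r < 1) (hν : ∀ᵐ w ∂ν, ‖w‖ ≤ r) {z : ℂ} {ρ : ℝ} (hρ : 0 < ρ)
    (hs : closedBall z ρ ⊆ ball 0 1)
    (ht : ∀ᵐ w ∂ν, ∀ y ∈ closedBall z ρ, 1 / 2 ≤ ‖mob (-w) y‖) :
    Real.circleAverage (greenPot ν) z ρ = greenPot ν z := by
  have hmem : ∀ θ, ‖circleMap z ρ θ‖ ≤ 1 := fun θ =>
    (mem_ball_zero_iff.1 (hs (circleMap_mem_closedBall z hρ.le θ))).le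
  have hm : Measurable fun p : ℝ × ℂ => greenK (circleMap z ρ p.1) p.2 / (1 - ‖p.2‖ ^ 2) := by
    have h1 : Measurable fun p : ℝ × ℂ => (circleMap z ρ p.1, p.2) := by
      have := (continuous_circleMap z ρ).measurable
      fun_prop
    exact (measurable_greenK.comp h1).div (by fun_prop)
  rw [Real.circleAverage_def]
  simp only [greenPot]
  rw [intervalIntegral_integral_swap, ← integral_smul]
  · refine integral_congr_ae ((hν.and ht).mono fun w hw => ?_)
    have h2 := circleAverage_greenK (hw.1.trans_lt hr) hρ hs hw.2
    rw [Real.circleAverage_def] at h2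
    simp only
    rw [intervalIntegral.integral_div, ← h2, smul_eq_mul, smul_eq_mul, mul_div_assoc]
  · set f : ℝ × ℂ → ℝ := fun p => greenK (circleMap z ρ p.1) p.2 / (1 - ‖p.2‖ ^ 2) with hf
    have hbd : ∀ θ, ∀ᵐ w ∂ν, ‖f (θ, w)‖ ≤ Real.log 2 / (1 - r ^ 2) := fun θ =>
      hν.mono fun w hw => norm_greenK_div_le hr hw (hmem θ)
    clear_value f
    have : IsFiniteMeasure (volume.restrict (uIoc (0 : ℝ) (2 * Real.pi))) := by
      rw [uIoc_of_le Real.two_pi_pos.le]; infer_instance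
    have hprod : Integrable f ((volume.restrict (uIoc 0 (2 * Real.pi))).prod ν) := by
      refine (integrable_prod_iff hm.aestronglyMeasurable).2 ⟨?_, ?_⟩
      · exact ae_of_all _ fun θ => Integrable.of_bound
          (hm.comp measurable_prodMk_left).aestronglyMeasurable _ (hbd θ)
      · have hsm : StronglyMeasurable fun θ : ℝ => ∫ w, ‖f (θ, w)‖ ∂ν :=
          StronglyMeasurable.integral_prod_right' (ν := ν) hm.norm.stronglyMeasurable
        refine Integrable.of_bound hsm.aestronglyMeasurable
          (Real.log 2 / (1 - r ^ 2) * ν.real univ) (ae_of_all _ fun θ => ?_)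
        refine norm_integral_le_of_norm_le_const ((hbd θ).mono fun w hw => ?_)
        rwa [norm_norm]
    rw [hf] at hprod
    exact hprod

lemma half_norm_le_mob {P : Polynomial ℂ} (hP : ∀ z ∈ closedBall (0 : ℂ) 1, 0 ≤ (P.eval z).re)
    {y w : ℂ} (hy : ‖y‖ < 1) (hw : ‖w‖ < 1) (hyP : (P.eval y).re < 1 / 3)
    (hwP : 1 ≤ (P.eval w).re) : 1 / 2 ≤ ‖mob (-w) y‖ := by
  by_contra! hcon
  have hPd : DifferentiableOn ℂ (fun z => P.eval z) (ball 0 2) := P.differentiable.differentiableOn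
  obtain ⟨R, hR, hd⟩ := exists_differentiableOn_comp_mob (by norm_num) hPd hy
  have h1 : ‖mob (-y) w‖ = ‖mob (-w) y‖ := by
    simp only [mob, norm_div, map_neg, neg_mul, ← sub_eq_add_neg]
    rw [norm_sub_rev, norm_one_sub_conj_mul_comm]
  have h2 := re_le_of_re_nonneg hR hd (fun z hz => hP _ (mapsTo_mob_closedBall hy hz))
    (ζ := mob (-y) w) (by rw [h1]; exact hcon.le)
  rw [Function.comp_apply, Function.comp_apply, mob_mob_neg hy hw.le, mob_zero] at h2
  linarith

lemma measure_univ_le_of_re_polynomial (hr : r < 1) (hS : 0 ≤ S)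
    (h : ∀ b : ℂ, ‖b‖ < 1 → garsia ν b ≤ ENNReal.ofReal S) {P : Polynomial ℂ}
    (hP : ∀ z ∈ closedBall (0 : ℂ) 1, 0 ≤ (P.eval z).re)
    (hν : ∀ᵐ w ∂ν, ‖w‖ ≤ r ∧ 1 ≤ (P.eval w).re) :
    ν univ ≤ ENNReal.ofReal (12 * S * (P.eval 0).re) := by
  have hνr : ∀ᵐ w ∂ν, ‖w‖ ≤ r := hν.mono fun _ h => h.1
  have hP0 := hP 0 (by simp)
  rcases lt_or_ge (1 / 3) (P.eval 0).re with h3 | h3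
  · have h4 : garsia ν 0 = ν univ := by simp [garsia, garsiaK]
    rw [← h4]
    exact (h 0 (by simp)).trans (ENNReal.ofReal_le_ofReal (by nlinarith))
  have hHc : ContinuousOn (fun z => (P.eval z).re) (closedBall 0 1) :=
    (Complex.continuous_re.comp P.continuous).continuousOn
  have key : greenPot ν 0 - 6 * S * (P.eval 0).re ≤ 0 := by
    refine maximum_principle_sublevel (D := fun z => greenPot ν z - 6 * S * (P.eval z).re)
      (H := fun z => (P.eval z).re) (c := 1 / 3) ((continuousOn_greenPot hr hνr).sub
        (hHc.const_mul _)) hHc ?_ ?_ ?_ (by simp) h3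
    · intro z hz hHz
      have hU : IsOpen (ball (0 : ℂ) 1 ∩ {y | (P.eval y).re < 1 / 3}) :=
        isOpen_ball.inter (isOpen_lt (Complex.continuous_re.comp P.continuous) continuous_const)
      obtain ⟨ρ₀, hρ₀, hsub⟩ := Metric.isOpen_iff.1 hU z ⟨hz, hHz⟩
      refine ⟨ρ₀, hρ₀, fun ρ hρ => ?_⟩
      have hsub' : closedBall z ρ ⊆ ball (0 : ℂ) 1 ∩ {y | (P.eval y).re < 1 / 3} :=
        (closedBall_subset_ball hρ.2).trans hsub
      have hsph : sphere z |ρ| ⊆ closedBall 0 1 := by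
        rw [abs_of_pos hρ.1]
        exact (sphere_subset_closedBall.trans hsub').trans
          (inter_subset_left.trans ball_subset_closedBall)
      rw [Real.circleAverage_fun_sub
        ((continuousOn_greenPot hr hνr).mono hsph).circleIntegrable'
        ((hHc.const_mul (6 * S)).mono hsph).circleIntegrable',
        circleAverage_greenPot hr hνr hρ.1 (hsub'.trans inter_subset_left)]
      · congr 1
        have := circleAverage_re_of_differentiable P.differentiable z ρ
        rw [← this, ← smul_eq_mul (6 * S), ← Real.circleAverage_fun_smul]
        rfl
      · exact hν.mono fun w hw y hy => half_norm_le_mob hP (mem_ball_zero_iff.1 (hsub' hy).1)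
          (hw.1.trans_lt hr) (hsub' hy).2 hw.2
    · intro z hz _
      have := hP z (sphere_subset_closedBall hz)
      rw [greenPot_eq_zero hr hνr (mem_sphere_zero_iff_norm.1 hz)]
      nlinarith [mul_nonneg hS this]
    · intro z hz hHz
      have := greenPot_le hr hνr hS (mem_ball_zero_iff.1 hz) (h z (mem_ball_zero_iff.1 hz))
      simp only [hHz]
      linarith
  have h5 : ν.real univ ≤ 2 * greenPot ν 0 := by
    have h6 : ∫ _, (1 / 2 : ℝ) ∂ν ≤ greenPot ν 0 := by
      refine integral_mono_ae (integrable_const _) (integrable_greenK_div hr hνr (by simp))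
        (hνr.mono fun w hw => ?_)
      have hw1 := hw.trans_lt hr
      have h2 : 0 < 1 - ‖w‖ ^ 2 := by nlinarith [norm_nonneg w]
      simp only
      rw [le_div_iff₀ h2]
      linarith [le_greenK_zero hw1]
    rw [integral_const, smul_eq_mul] at h6
    linarith
  rw [← ENNReal.ofReal_toReal (measure_ne_top ν univ)]
  refine ENNReal.ofReal_le_ofReal ?_
  rw [← Measure.real]
  linarith

end Potential

lemma normSq_le_diskAvg {F : ℂ → ℂ} {R : ℝ} (hR : 1 < R) (hF : DifferentiableOn ℂ F (ball 0 R))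
    {z : ℂ} (hz : ‖z‖ < 1) : ‖F z‖ ^ 2 ≤ diskAvg z (fun ξ => ‖F ξ‖ ^ 2) := by
  have hFc : ContinuousOn F (sphere 0 1) :=
    hF.continuousOn.mono (sphere_subset_closedBall.trans (closedBall_subset_ball hR))
  have h1 := diskAvg_re hR (hF.const_mul (conj (F z))) hz
  have h2 : (conj (F z) * F z).re = ‖F z‖ ^ 2 := by
    rw [mul_comm, Complex.mul_conj, Complex.ofReal_re, Complex.normSq_eq_norm_sq]
  have h3 : diskAvg z (fun ξ => (conj (F z) * F ξ).re) ≤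
      diskAvg z (fun ξ => 1 / 2 * ‖F z‖ ^ 2 + 1 / 2 * ‖F ξ‖ ^ 2) := by
    refine diskAvg_mono (Complex.continuous_re.comp_continuousOn (hFc.const_smul (conj (F z))))
      (by fun_prop) (fun ξ _ => ?_) hz
    have h4 := Complex.re_le_norm (conj (F z) * F ξ)
    rw [norm_mul, Complex.norm_conj] at h4
    simp only [Function.comp_apply, Pi.smul_apply, smul_eq_mul]
    nlinarith [sq_nonneg (‖F z‖ - ‖F ξ‖)]
  rw [diskAvg_add (by fun_prop) (by fun_prop) hz, diskAvg_const, diskAvg_const_mul, h1, h2] at h3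
  linarith

lemma garsiaK_mul_le {b z : ℂ} {r : ℝ} (hb : ‖b‖ < 1) (hr : r < 1) (hz : ‖z‖ ≤ r) :
    garsiaK b (((1 + (1 - r) / 4 : ℝ) : ℂ) * z) ≤ 2 * garsiaK b z := by
  have h0 := norm_nonneg z
  have hbz : ‖conj b * z‖ ≤ r := by
    rw [norm_mul, Complex.norm_conj]; nlinarith
  have h1 : 1 - r ≤ ‖1 - conj b * z‖ := by
    have := norm_sub_norm_le (1 : ℂ) (conj b * z)
    rw [norm_one] at this; linarith
  have h2 : 3 / 4 * ‖1 - conj b * z‖ ≤ ‖1 - conj b * (((1 + (1 - r) / 4 : ℝ) : ℂ) * z)‖ := by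
    have h3 : 1 - conj b * (((1 + (1 - r) / 4 : ℝ) : ℂ) * z) =
        (1 - conj b * z) - ((1 - r) / 4 : ℝ) * (conj b * z) := by push_cast; ring
    have h4 := norm_sub_norm_le (1 - conj b * z) (((1 - r) / 4 : ℝ) * (conj b * z))
    rw [norm_mul, Complex.norm_real, Real.norm_of_nonneg (by linarith)] at h4
    rw [h3]
    nlinarith
  have h5 : 0 < ‖1 - conj b * z‖ := by linarith
  have h6 : 0 ≤ 1 - ‖b‖ ^ 2 := by nlinarith [norm_nonneg b]
  unfold garsiaK
  rw [← mul_div_assoc, div_le_div_iff₀ (by nlinarith) (by positivity)]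
  nlinarith [mul_le_mul_of_nonneg_left (pow_le_pow_left₀ (by positivity) h2 2) h6,
    mul_nonneg h6 (sq_nonneg ‖1 - conj b * z‖)]

lemma measure_norm_ge_le {ν : Measure ℂ} {r S Q N : ℝ} {F : ℂ → ℂ} (hr0 : 0 < r) (hr : r < 1)
    (hν : ∀ᵐ w ∂ν, ‖w‖ ≤ r) (hS : 0 ≤ S)
    (h : ∀ b : ℂ, ‖b‖ < 1 → garsia ν b ≤ ENNReal.ofReal S)
    (hF : DifferentiableOn ℂ F (ball 0 1))
    (hQ : ∀ s ∈ Ioo (0 : ℝ) 1, Real.circleAverage (fun z => ‖F (s * z)‖ ^ 2) 0 1 ≤ Q)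
    (hN : 0 < N) : ν {z | N ≤ ‖F z‖} ≤ ENNReal.ofReal (24 * S * Q / N ^ 2) := by
  have hfin : IsFiniteMeasure ν := ⟨by
    have h4 : garsia ν 0 = ν univ := by simp [garsia, garsiaK]
    rw [← h4]
    exact (h 0 (by simp)).trans_lt ENNReal.ofReal_lt_top⟩
  set lam : ℝ := 1 + (1 - r) / 4 with hlam
  have hlam1 : 1 < lam := by linarith
  have hlr : lam * r < 1 := by nlinarith
  set s : ℝ := lam⁻¹ with hs
  have hs0 : 0 < s := by positivity
  have hs1 : s < 1 := inv_lt_one_of_one_lt₀ hlam1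
  have hsl : (s : ℂ) * lam = 1 := by
    rw [hs]; push_cast; exact inv_mul_cancel₀ (by exact_mod_cast (by positivity : lam ≠ 0))
  set E : Set ℂ := {z ∈ closedBall (0 : ℂ) r | N ≤ ‖F z‖} with hE
  have hFcr : ContinuousOn F (closedBall 0 r) :=
    hF.continuousOn.mono (closedBall_subset_ball hr)
  have hEm : MeasurableSet E :=
    (hFcr.norm.preimage_isClosed_of_isClosed isClosed_closedBall isClosed_Ici).measurableSet
  have hEν : ν {z | N ≤ ‖F z‖} = ν E := by
    refine measure_congr (hν.mono fun z hz => ?_)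
    refine propext ⟨fun h => ⟨mem_closedBall_zero_iff.2 hz, h⟩, fun h => h.2⟩
  set νs : Measure ℂ := (ν.restrict E).map (fun z => (lam : ℂ) * z) with hνs
  have hmeas : Measurable fun z : ℂ => (lam : ℂ) * z := by fun_prop
  have hfins : IsFiniteMeasure νs := by rw [hνs]; infer_instance
  have hgar : ∀ b : ℂ, ‖b‖ < 1 → garsia νs b ≤ ENNReal.ofReal (2 * S) := fun b hb => by
    calc garsia νs b = ∫⁻ z in E, ENNReal.ofReal (garsiaK b (lam * z)) ∂ν := by
          rw [garsia, hνs, lintegral_map (measurable_garsiaK b).ennreal_ofReal hmeas]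
      _ ≤ ∫⁻ z in E, 2 * ENNReal.ofReal (garsiaK b z) ∂ν := by
          refine setLIntegral_mono
            ((measurable_garsiaK b).ennreal_ofReal.const_mul _) fun z hz => ?_
          rw [show (2 : ℝ≥0∞) = ENNReal.ofReal 2 by simp, ← ENNReal.ofReal_mul (by norm_num)]
          exact ENNReal.ofReal_le_ofReal
            (garsiaK_mul_le hb hr (mem_closedBall_zero_iff.1 hz.1))
      _ ≤ ∫⁻ z, 2 * ENNReal.ofReal (garsiaK b z) ∂ν := setLIntegral_le_lintegral _ _
      _ = 2 * garsia ν b := lintegral_const_mul _ (measurable_garsiaK b).ennreal_ofReal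
      _ ≤ 2 * ENNReal.ofReal S := by gcongr; exact h b hb
      _ = ENNReal.ofReal (2 * S) := by rw [ENNReal.ofReal_mul (by norm_num)]; simp
  set G : ℂ → ℂ := fun z => F (s * z) with hG
  have hGd : DifferentiableOn ℂ G (ball 0 lam) := by
    refine hF.comp (differentiableOn_id.const_mul (s : ℂ)) fun z hz => ?_
    rw [mem_ball_zero_iff] at hz ⊢
    rw [norm_mul, Complex.norm_real, Real.norm_of_nonneg hs0.le, hs,
      inv_mul_lt_iff₀ (by positivity)]
    simpa using hz
  have hGc : ContinuousOn G (sphere 0 1) :=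
    hGd.continuousOn.mono (sphere_subset_closedBall.trans (closedBall_subset_ball hlam1))
  have hhc : ContinuousOn (fun z => (N ^ 2)⁻¹ * ‖G z‖ ^ 2) (sphere 0 1) := by fun_prop
  have key : ∀ ε : ℝ, 0 < ε → ν E ≤ ENNReal.ofReal (24 * S * ((N ^ 2)⁻¹ * Q + 2 * ε)) := by
    intro ε hε
    obtain ⟨P, hP⟩ := exists_polynomial_re_near (hhc.add continuousOn_const) (ε := ε) hε
      (h := fun z => (N ^ 2)⁻¹ * ‖G z‖ ^ 2 + ε)
    have hPd : DifferentiableOn ℂ (fun z => P.eval z) (ball 0 2) :=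
      P.differentiable.differentiableOn
    have hPc : ContinuousOn (fun z => (P.eval z).re) (sphere 0 1) :=
      (Complex.continuous_re.comp P.continuous).continuousOn
    have hlow : ∀ z ∈ ball (0 : ℂ) 1, (N ^ 2)⁻¹ * ‖G z‖ ^ 2 ≤ (P.eval z).re := fun z hz => by
      rw [mem_ball_zero_iff] at hz
      rw [← diskAvg_re (by norm_num) hPd hz]
      refine le_trans ?_ (diskAvg_mono hhc hPc (fun ξ hξ => ?_) hz)
      · rw [diskAvg_const_mul]
        gcongr
        exact normSq_le_diskAvg hlam1 hGd hz
      · have := (abs_le.1 (hP ξ hξ)).1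
        linarith
    have hPnn : ∀ z ∈ closedBall (0 : ℂ) 1, 0 ≤ (P.eval z).re := fun z hz => by
      rcases (mem_closedBall_zero_iff.1 hz).lt_or_eq with h1 | h1
      · exact le_trans (by positivity) (hlow z (mem_ball_zero_iff.2 h1))
      · have := (abs_le.1 (hP z (mem_sphere_zero_iff_norm.2 h1))).1
        have h2 : 0 ≤ (N ^ 2)⁻¹ * ‖G z‖ ^ 2 := by positivity
        linarith
    have hup : (P.eval 0).re ≤ (N ^ 2)⁻¹ * Q + 2 * ε := by
      rw [← diskAvg_re (by norm_num) hPd (z := 0) (by simp)]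
      have h1 := diskAvg_mono hPc (h₂ := fun z => (N ^ 2)⁻¹ * ‖G z‖ ^ 2 + 2 * ε)
        (hhc.add continuousOn_const) (fun ξ hξ => by
          have := (abs_le.1 (hP ξ hξ)).2
          linarith) (z := 0) (by simp)
      rw [diskAvg_add hhc continuousOn_const (by simp), diskAvg_const, diskAvg_const_mul] at h1
      have h2 : diskAvg 0 (fun z => ‖G z‖ ^ 2) ≤ Q := by
        refine le_trans (le_of_eq ?_) (hQ s ⟨hs0, hs1⟩)
        simp [diskAvg, mob, hG]
      have h3 : (N ^ 2)⁻¹ * diskAvg 0 (fun z => ‖G z‖ ^ 2) ≤ (N ^ 2)⁻¹ * Q := by gcongr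
      linarith
    have hsupp : ∀ᵐ w ∂νs, ‖w‖ ≤ lam * r ∧ 1 ≤ (P.eval w).re := by
      have hset : MeasurableSet {w : ℂ | ‖w‖ ≤ lam * r ∧ 1 ≤ (P.eval w).re} :=
        (measurableSet_le measurable_norm measurable_const).inter (measurableSet_le
          measurable_const (Complex.continuous_re.comp P.continuous).measurable)
      rw [hνs, ae_map_iff hmeas.aemeasurable hset]
      refine (ae_restrict_iff' hEm).2 (ae_of_all _ fun z hz => ?_)
      have hz1 : ‖(lam : ℂ) * z‖ ≤ lam * r := by
        rw [norm_mul, Complex.norm_real, Real.norm_of_nonneg (by positivity)]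
        have := mem_closedBall_zero_iff.1 hz.1
        gcongr
      refine ⟨hz1, le_trans ?_ (hlow _ (mem_ball_zero_iff.2 (hz1.trans_lt hlr)))⟩
      have h1 : G (lam * z) = F z := by rw [hG]; simp only; rw [← mul_assoc, hsl, one_mul]
      rw [h1, inv_mul_eq_div, one_le_div (by positivity)]
      exact pow_le_pow_left₀ hN.le hz.2 2
    have h1 := measure_univ_le_of_re_polynomial hlr (by positivity : 0 ≤ 2 * S) hgar hPnn hsupp
    rw [hνs, Measure.map_apply hmeas MeasurableSet.univ, preimage_univ,
      Measure.restrict_apply_univ] at h1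
    refine h1.trans (ENNReal.ofReal_le_ofReal ?_)
    have := hPnn 0 (by simp)
    nlinarith
  rw [hEν]
  have hlim : Tendsto (fun ε : ℝ => ENNReal.ofReal (24 * S * ((N ^ 2)⁻¹ * Q + 2 * ε))) (𝓝[>] 0)
      (𝓝 (ENNReal.ofReal (24 * S * ((N ^ 2)⁻¹ * Q + 2 * 0)))) := by
    refine (ENNReal.continuous_ofReal.tendsto _).comp ?_
    refine Tendsto.mono_left ?_ nhdsWithin_le_nhds
    exact (by fun_prop : Continuous fun ε : ℝ => 24 * S * ((N ^ 2)⁻¹ * Q + 2 * ε)).tendsto 0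
  refine (ge_of_tendsto hlim (eventually_mem_nhdsWithin.mono fun ε hε => key ε hε)).trans
    (le_of_eq ?_)
  congr 1
  field_simp
  ring

/-! ## Boundary geometry of conformal images -/

lemma IsPreconnected.subset_of_disjoint_frontier {X : Type*} [TopologicalSpace X] {S U : Set X}
    (hS : IsPreconnected S) (hU : IsOpen U) (h : (S ∩ U).Nonempty)
    (hd : Disjoint S (frontier U)) : S ⊆ U := by
  refine hS.subset_left_of_subset_union hU isClosed_closure.isOpen_compl
    (disjoint_compl_right.mono_left subset_closure) (fun x hx => ?_) h
  by_cases hxc : x ∈ closure U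
  · by_contra hcon
    simp only [mem_union, not_or] at hcon
    exact disjoint_left.1 hd hx (by rw [hU.frontier_eq]; exact ⟨hxc, hcon.1⟩)
  · exact Or.inr hxc

section Frontier


lemma isOpen_image_ball {f : ℂ → ℂ} (hf : DifferentiableOn ℂ f (ball 0 1))
    (hinj : InjOn f (ball 0 1)) : IsOpen (f '' ball 0 1) :=
  isOpen_image_of_injOn hf hinj Subset.rfl isOpen_ball

lemma notMem_of_mem_frontier_image {f : ℂ → ℂ} (hf : DifferentiableOn ℂ f (ball 0 1))
    (hinj : InjOn f (ball 0 1)) {w : ℂ} (hw : w ∈ frontier (f '' ball 0 1)) :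
    w ∉ f '' ball 0 1 := by
  rw [(isOpen_image_ball hf hinj).frontier_eq] at hw
  exact hw.2

lemma not_sphere_subset_image {f : ℂ → ℂ} (hf : DifferentiableOn ℂ f (ball 0 1))
    (hinj : InjOn f (ball 0 1)) {w : ℂ} (hw : w ∉ f '' ball 0 1) {ρ : ℝ} (hρ : 0 < ρ) :
    ¬ sphere w ρ ⊆ f '' ball 0 1 := by
  intro hsub
  obtain ⟨l, hl, -⟩ := exists_log_of_ne_zero (f := fun z => f z - w) (hf.sub_const w)
    fun z hz h => hw ⟨z, hz, sub_eq_zero.1 h⟩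
  have hleft : ∀ z ∈ ball (0 : ℂ) 1, Function.invFunOn f (ball 0 1) (f z) = z :=
    fun z hz => hinj.leftInvOn_invFunOn hz
  have h1 := circleIntegral.integral_eq_zero_of_hasDerivWithinAt
    (f := l ∘ Function.invFunOn f (ball 0 1)) (f' := fun z => (z - w)⁻¹) (c := w) hρ.le
    fun y hy => by
      obtain ⟨z, hz, rfl⟩ := hsub hy
      have h2 := hasDerivAt_inverse_of_injOn hf hinj hleft hz
      have h3 := (hl z hz)
      rw [← hleft z hz] at h3
      refine ((h3.comp (f z) h2).congr_deriv ?_).hasDerivWithinAt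
      rw [hleft z hz, deriv_sub_const, div_mul_eq_mul_div,
        mul_inv_cancel₀ (deriv_ne_zero_of_injOn hf hinj hz), one_div]
  rw [circleIntegral.integral_sub_center_inv w hρ.ne'] at h1
  exact Complex.two_pi_I_ne_zero h1

lemma edist_lt_ediam_frontier {f : ℂ → ℂ} (hf : DifferentiableOn ℂ f (ball 0 1))
    (hinj : InjOn f (ball 0 1)) {x z : ℂ} (hx : x ∈ f '' ball 0 1)
    (hz : z ∈ frontier (f '' ball 0 1)) : edist x z < ediam (frontier (f '' ball 0 1)) := by
  set Ω := f '' ball 0 1 with hΩ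
  have hΩo : IsOpen Ω := isOpen_image_ball hf hinj
  have hzΩ := notMem_of_mem_frontier_image hf hinj hz
  by_cases htop : ediam (frontier Ω) = ⊤
  · rw [htop]; exact edist_lt_top _ _
  have hxz : x ≠ z := fun h => hzΩ (h ▸ hx)
  have hbd : ∀ y ∈ frontier Ω, dist y z ≤ (ediam (frontier Ω)).toReal := fun y hy => by
    rw [dist_edist]
    exact ENNReal.toReal_mono htop (edist_le_ediam_of_mem hy hz)
  have hΩb : ∀ y ∈ Ω, dist y z ≤ (ediam (frontier Ω)).toReal := by
    intro y hy
    by_contra! hcon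
    have h0 : 0 < dist y z := lt_of_le_of_lt ENNReal.toReal_nonneg hcon
    refine not_sphere_subset_image hf hinj hzΩ h0 ?_
    refine IsPreconnected.subset_of_disjoint_frontier
      (isPreconnected_sphere (by rw [Complex.rank_real_complex]; norm_num) z _) hΩo
      ⟨y, mem_sphere.2 rfl, hy⟩ (disjoint_left.2 fun p hp hpf => ?_)
    have := hbd p hpf
    rw [mem_sphere.1 hp] at this
    linarith
  have hray : ¬ (fun t : ℝ => x + t * (x - z)) '' Ici 0 ⊆ Ω := by
    intro hsub
    have hd : 0 < ‖x - z‖ := norm_pos_iff.2 (sub_ne_zero.2 hxz)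
    have h1 := hΩb _ (hsub ⟨(ediam (frontier Ω)).toReal / ‖x - z‖,
      div_nonneg ENNReal.toReal_nonneg hd.le, rfl⟩)
    rw [dist_eq_norm] at h1
    have h2 : x + ((ediam (frontier Ω)).toReal / ‖x - z‖ : ℝ) * (x - z) - z =
        ((1 + (ediam (frontier Ω)).toReal / ‖x - z‖ : ℝ) : ℂ) * (x - z) := by push_cast; ring
    rw [h2, norm_mul, Complex.norm_real, Real.norm_of_nonneg (by positivity), add_mul, one_mul,
      div_mul_cancel₀ _ hd.ne'] at h1
    linarith
  have hpc : IsPreconnected ((fun t : ℝ => x + t * (x - z)) '' Ici 0) :=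
    isPreconnected_Ici.image _ (by fun_prop)
  have hex : ∃ t : ℝ, 0 ≤ t ∧ x + t * (x - z) ∈ frontier Ω := by
    by_contra! hcon
    refine hray (hpc.subset_of_disjoint_frontier hΩo ⟨x, ⟨0, by simp, by simp⟩, hx⟩
      (disjoint_left.2 ?_))
    rintro _ ⟨t, ht, rfl⟩ hp
    exact hcon t ht hp
  obtain ⟨t, ht, hp⟩ := hex
  have ht0 : 0 < t := by
    refine lt_of_le_of_ne ht fun h => notMem_of_mem_frontier_image hf hinj hp ?_
    rw [← h, Complex.ofReal_zero, zero_mul, add_zero]; exact hx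
  refine lt_of_lt_of_le ?_ (edist_le_ediam_of_mem hp hz)
  rw [edist_dist, edist_dist]
  refine (ENNReal.ofReal_lt_ofReal_iff_of_nonneg dist_nonneg).2 ?_
  have hd : 0 < ‖x - z‖ := norm_pos_iff.2 (sub_ne_zero.2 hxz)
  have h2 : x + t * (x - z) - z = ((1 + t : ℝ) : ℂ) * (x - z) := by push_cast; ring
  rw [dist_eq_norm, dist_eq_norm, h2, norm_mul, Complex.norm_real,
    Real.norm_of_nonneg (by positivity)]
  nlinarith

lemma measure_image_inter_ball_le {f : ℂ → ℂ} (hf : DifferentiableOn ℂ f (ball 0 1))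
    (hinj : InjOn f (ball 0 1)) {μ : Measure ℂ} {z : ℂ}
    (hz : z ∈ frontier (f '' ball 0 1)) {r : ℝ} (hr : 0 < r) :
    μ (f '' ball 0 1 ∩ ball z r) ≤ carlesonNorm (f '' ball 0 1) μ * ENNReal.ofReal r := by
  have hx : f 0 ∈ f '' ball 0 1 := mem_image_of_mem f (by simp)
  exact measure_inter_ball_le hz (fun x hx => edist_lt_ediam_frontier hf hinj hx hz)
    (lt_of_le_of_lt zero_le (edist_lt_ediam_frontier hf hinj hx hz)) hr

end Frontier

/-! ## Change of variables -/

lemma lintegral_image_of_injOn {f : ℂ → ℂ} {s : Set ℂ} (hs : MeasurableSet s)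
    (hf : ∀ z ∈ s, DifferentiableAt ℂ f z) (hinj : InjOn f s) (h : ℂ → ℝ≥0∞) :
    ∫⁻ w in f '' s, h w = ∫⁻ z in s, ENNReal.ofReal (‖deriv f z‖ ^ 2) * h (f z) := by
  rw [lintegral_image_eq_lintegral_abs_det_fderiv_mul volume hs (fun z hz =>
    ((hf z hz).hasDerivAt.hasFDerivAt.restrictScalars ℝ).hasFDerivWithinAt) hinj]
  refine setLIntegral_congr_fun hs fun z _ => ?_
  have hdet : |((ContinuousLinearMap.toSpanSingleton ℂ (deriv f z)).restrictScalars ℝ).det| =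
      ‖deriv f z‖ ^ 2 := by
    simp [ContinuousLinearMap.det, LinearMap.det_restrictScalars, Algebra.norm_complex_apply,
      Complex.normSq_eq_norm_sq]
  simp only [hdet]

lemma garsiaK_mul_one_sub {b z : ℂ} (hb : ‖b‖ < 1) (hz : ‖z‖ ≤ 1) :
    garsiaK b z * (1 - ‖z‖ ^ 2) = 1 - ‖mob (-b) z‖ ^ 2 := by
  rw [one_sub_normSq_mob (by simpa using hb) hz, garsiaK]
  simp only [map_neg, neg_mul, ← sub_eq_add_neg, norm_neg]
  ring

lemma dirichlet_comp_mob {G : ℂ → ℂ} (hG : DifferentiableOn ℂ G (ball 0 1)) {b : ℂ}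
    (hb : ‖b‖ < 1) :
    dirichlet (deriv (G ∘ mob b)) =
      ∫⁻ z in ball (0 : ℂ) 1, ENNReal.ofReal (garsiaK b z * (‖deriv G z‖ ^ 2 * (1 - ‖z‖ ^ 2))) := by
  conv_rhs => rw [← image_mob hb]
  rw [lintegral_image_of_injOn measurableSet_ball (fun z hz =>
    (hasDerivAt_mob hb (mem_ball_zero_iff.1 hz).le).differentiableAt)
    ((injOn_mob hb).mono ball_subset_closedBall), dirichlet]
  refine setLIntegral_congr_fun measurableSet_ball fun z hz => ?_
  rw [mem_ball_zero_iff] at hz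
  rw [← ENNReal.ofReal_mul (sq_nonneg _), deriv_comp_mob hG hb hz, norm_mul]
  congr 1
  rw [mul_left_comm (garsiaK _ _), garsiaK_mul_one_sub hb (mob_mem_ball hb hz).le,
    mob_neg_mob hb hz.le]
  ring

lemma garsia_bmoaMeasure {φ L : ℂ → ℂ}
    (hL : ∀ z ∈ ball (0 : ℂ) 1, HasDerivAt L (deriv (deriv φ) z / deriv φ z) z) {b : ℂ}
    (hb : ‖b‖ < 1) :
    garsia ((bmoaMeasure φ).restrict unitDisk) b = dirichlet (deriv (L ∘ mob b)) := by
  have hLd : DifferentiableOn ℂ L (ball 0 1) := fun z hz =>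
    (hL z hz).differentiableAt.differentiableWithinAt
  have hm : Measurable fun z : ℂ =>
      ENNReal.ofReal (‖deriv (deriv φ) z / deriv φ z‖ ^ 2 * (1 - ‖z‖ ^ 2)) := by
    have h1 := measurable_deriv (deriv φ)
    have h2 := measurable_deriv φ
    fun_prop
  rw [dirichlet_comp_mob hLd hb, garsia, bmoaMeasure, show unitDisk = ball 0 1 from rfl,
    restrict_withDensity measurableSet_ball,
    Measure.restrict_restrict measurableSet_ball, inter_self,
    lintegral_withDensity_eq_lintegral_mul _ hm (measurable_garsiaK b).ennreal_ofReal]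
  refine setLIntegral_congr_fun measurableSet_ball fun z hz => ?_
  have hz' := mem_ball_zero_iff.1 hz
  simp only [Pi.mul_apply]
  rw [(hL z hz).deriv, ← ENNReal.ofReal_mul (mul_nonneg (sq_nonneg _)
    (by nlinarith [norm_nonneg z])), mul_comm]

lemma lintegral_pushForward {Ω : Set ℂ} {ψ : ℂ → ℂ} (hΩ : MeasurableSet Ω)
    (hψ : ContinuousOn ψ Ω) (μ : Measure ℂ) {h : ℂ → ℝ≥0∞} (hh : Measurable h) :
    ∫⁻ z, h z ∂(pushForward Ω ψ μ) = ∫⁻ w in Ω, (‖deriv ψ w‖₊ : ℝ≥0∞) * h (ψ w) ∂μ := by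
  have hψm : AEMeasurable ψ (μ.restrict Ω) := hψ.aemeasurable hΩ
  have hd : Measurable fun w => (‖deriv ψ w‖₊ : ℝ≥0∞) :=
    (measurable_deriv ψ).nnnorm.coe_nnreal_ennreal
  rw [pushForward, lintegral_map' hh.aemeasurable
    (hψm.mono_ac (withDensity_absolutelyContinuous _ _))]
  exact lintegral_withDensity_eq_lintegral_mul₀ hd.aemeasurable (hh.comp_aemeasurable hψm)

lemma garsiaK_mob {a b z : ℂ} (ha : ‖a‖ < 1) (hb : ‖b‖ < 1) (hz : ‖z‖ < 1) :
    garsiaK b z * garsiaK a (mob (-b) z) = garsiaK (mob b a) z := by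
  have h1 : (1 - conj b * z : ℂ) ≠ 0 := by
    have := den_ne_zero (b := -b) (by simpa using hb) hz.le
    simpa [← sub_eq_add_neg] using this
  have h2 := den_ne_zero hb ha.le
  have h3 : (1 + b * conj a : ℂ) ≠ 0 := fun h => h2 (by
    have := congrArg conj h
    simpa using this)
  have h4 : 1 - conj a * mob (-b) z =
      (1 + b * conj a) * (1 - conj (mob b a) * z) / (1 - conj b * z) := by
    simp only [mob, map_neg, map_div₀, map_add, map_one, map_mul, Complex.conj_conj]
    generalize conj a = p at *
    generalize conj b = q at *
    have h1' : (1 + -q * z : ℂ) ≠ 0 := by rwa [neg_mul, ← sub_eq_add_neg]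
    have h3' : (1 + p * b : ℂ) ≠ 0 := by rwa [mul_comm]
    have h1'' : (1 - z * q : ℂ) ≠ 0 := by rwa [mul_comm]
    rw [show 1 + -q * z = 1 - z * q by ring, show 1 - q * z = 1 - z * q by ring,
      show 1 + b * p = 1 + p * b by ring]
    field_simp
    ring
  have h5 : ‖1 + b * conj a‖ = ‖1 + conj b * a‖ := by
    rw [← Complex.norm_conj]; simp
  have h6 : ‖1 - conj b * z‖ ≠ 0 := norm_ne_zero_iff.2 h1
  have h7 : ‖1 + conj b * a‖ ≠ 0 := norm_ne_zero_iff.2 h2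
  simp only [garsiaK]
  rw [h4, one_sub_normSq_mob hb ha.le, norm_div, norm_mul, h5]
  field_simp

lemma norm_deriv_mob_neg {b z : ℂ} (hb : ‖b‖ < 1) (hz : ‖z‖ ≤ 1) :
    ‖deriv (mob (-b)) z‖ = garsiaK b z := by
  rw [norm_deriv_mob (by simpa using hb) hz, garsiaK]
  simp [← sub_eq_add_neg]

lemma lintegral_pushForward_mob {Ω : Set ℂ} {ψ : ℂ → ℂ} (hΩ : IsOpen Ω)
    (hψ : DifferentiableOn ℂ ψ Ω) (hmaps : MapsTo ψ Ω (ball 0 1)) (μ : Measure ℂ) {b : ℂ}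
    (hb : ‖b‖ < 1) {h : ℂ → ℝ≥0∞} (hh : Measurable h) :
    ∫⁻ z, h z ∂(pushForward Ω (mob (-b) ∘ ψ) μ) =
      ∫⁻ z, ENNReal.ofReal (garsiaK b z) * h (mob (-b) z) ∂(pushForward Ω ψ μ) := by
  have hmm : Measurable (mob (-b)) := by unfold mob; fun_prop
  have hc : ContinuousOn (mob (-b) ∘ ψ) Ω :=
    ((continuousOn_mob (by simpa using hb)).mono ball_subset_closedBall).comp hψ.continuousOn hmaps
  have hm : Measurable fun z => ENNReal.ofReal (garsiaK b z) * h (mob (-b) z) :=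
    (measurable_garsiaK b).ennreal_ofReal.mul (hh.comp hmm)
  rw [lintegral_pushForward hΩ.measurableSet hc μ hh,
    lintegral_pushForward hΩ.measurableSet hψ.continuousOn μ hm]
  refine setLIntegral_congr_fun hΩ.measurableSet fun w hw => ?_
  have hw1 := mem_ball_zero_iff.1 (hmaps hw)
  simp only [Function.comp_apply]
  have h1 : deriv (mob (-b) ∘ ψ) w = deriv (mob (-b)) (ψ w) * deriv ψ w :=
    deriv_comp w (hasDerivAt_mob (by simpa using hb) hw1.le).differentiableAt
      (hψ.differentiableAt (hΩ.mem_nhds hw))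
  have h2 : (‖deriv (mob (-b) ∘ ψ) w‖₊ : ℝ≥0∞) =
      ENNReal.ofReal (garsiaK b (ψ w)) * ‖deriv ψ w‖₊ := by
    rw [h1, nnnorm_mul, ENNReal.coe_mul, ← norm_deriv_mob_neg hb hw1.le, ← enorm_eq_nnnorm,
      ← ofReal_norm]
  rw [h2]
  ring

lemma garsia_pushForward_mob {Ω : Set ℂ} {ψ : ℂ → ℂ} (hΩ : IsOpen Ω)
    (hψ : DifferentiableOn ℂ ψ Ω) (hmaps : MapsTo ψ Ω (ball 0 1)) (μ : Measure ℂ) {a b : ℂ}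
    (ha : ‖a‖ < 1) (hb : ‖b‖ < 1) :
    garsia (pushForward Ω (mob (-b) ∘ ψ) μ) a = garsia (pushForward Ω ψ μ) (mob b a) := by
  rw [garsia, lintegral_pushForward_mob hΩ hψ hmaps μ hb (measurable_garsiaK a).ennreal_ofReal,
    garsia]
  have hmm : Measurable (mob (-b)) := by unfold mob; fun_prop
  have hm : Measurable fun z =>
      ENNReal.ofReal (garsiaK b z) * ENNReal.ofReal (garsiaK a (mob (-b) z)) :=
    (measurable_garsiaK b).ennreal_ofReal.mul ((measurable_garsiaK a).comp hmm).ennreal_ofReal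
  rw [lintegral_pushForward hΩ.measurableSet hψ.continuousOn μ hm,
    lintegral_pushForward hΩ.measurableSet hψ.continuousOn μ (measurable_garsiaK _).ennreal_ofReal]
  refine setLIntegral_congr_fun hΩ.measurableSet fun w hw => ?_
  have hw1 := mem_ball_zero_iff.1 (hmaps hw)
  rw [← ENNReal.ofReal_mul (garsiaK_nonneg hb.le _), garsiaK_mob ha hb hw1]

/-! ## Dirichlet integrals of logarithms of omitted-value functions -/

/-- An integrable weight on the plane dominating `(1 - ‖z‖ ^ 2) / ‖f z‖ ^ 2` in the image of a
nonvanishing normalized univalent function. -/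
noncomputable def logWeight (y : ℂ) : ℝ :=
  4 * Real.exp (-|Real.log ‖y‖| / 16) / ‖y‖ ^ 2

lemma measurable_logWeight : Measurable logWeight := by
  unfold logWeight
  exact ((Real.measurable_exp.comp ((((Real.measurable_log.comp measurable_norm).abs).neg).div_const
    16)).const_mul 4).div (measurable_norm.pow_const 2)

lemma lintegral_logWeight_lt_top : ∫⁻ y, ENNReal.ofReal (logWeight y) < ∞ := by
  have hpi := Real.pi_pos
  have h1 : ∀ r ∈ Ioi (0 : ℝ), ENNReal.ofReal r *
      ∫⁻ θ in Ioo (-Real.pi) Real.pi, ENNReal.ofReal (logWeight (circleMap 0 r θ)) =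
      ENNReal.ofReal (8 * Real.pi * (Real.exp (-|Real.log r| / 16) / r)) := by
    intro r hr
    have hr' : (0 : ℝ) < r := hr
    have hn : ∀ θ, ‖circleMap 0 r θ‖ = r := fun θ => by simp [abs_of_pos hr']
    simp only [logWeight, hn, lintegral_const, Measure.restrict_apply_univ, Real.volume_Ioo]
    rw [← ENNReal.ofReal_mul (by positivity), ← ENNReal.ofReal_mul hr'.le]
    congr 1
    field_simp
    ring
  rw [lintegral_polar measurable_logWeight.ennreal_ofReal,
    setLIntegral_congr_fun measurableSet_Ioi h1, ← Ioc_union_Ioi_eq_Ioi zero_le_one,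
    lintegral_union measurableSet_Ioi (Ioc_disjoint_Ioi le_rfl)]
  refine ENNReal.add_lt_top.2 ⟨?_, ?_⟩
  · have h2 : IntegrableOn (fun r : ℝ => r ^ (-15 / 16 : ℝ)) (Ioc 0 1) :=
      (intervalIntegrable_iff_integrableOn_Ioc_of_le zero_le_one).1
        (intervalIntegral.intervalIntegrable_rpow' (by norm_num))
    rw [setLIntegral_congr_fun (g := fun r => ENNReal.ofReal
      (8 * Real.pi * r ^ (-15 / 16 : ℝ))) measurableSet_Ioc fun r hr => ?_]
    · exact (h2.const_mul (8 * Real.pi)).lintegral_lt_top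
    · dsimp only
      rw [abs_of_nonpos (Real.log_nonpos hr.1.le hr.2), Real.rpow_def_of_pos hr.1]
      congr 2
      rw [div_eq_iff hr.1.ne']
      nth_rw 3 [← Real.exp_log hr.1]
      rw [← Real.exp_add]
      ring_nf
  · have h2 : IntegrableOn (fun r : ℝ => r ^ (-17 / 16 : ℝ)) (Ioi 1) :=
      integrableOn_Ioi_rpow_of_lt (by norm_num) one_pos
    rw [setLIntegral_congr_fun (g := fun r => ENNReal.ofReal
      (8 * Real.pi * r ^ (-17 / 16 : ℝ))) measurableSet_Ioi fun r hr => ?_]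
    · exact (h2.const_mul (8 * Real.pi)).lintegral_lt_top
    · have hr1 : (1 : ℝ) < r := hr
      have hr0 : 0 < r := by linarith
      dsimp only
      rw [abs_of_nonneg (Real.log_nonneg hr1.le), Real.rpow_def_of_pos hr0]
      congr 2
      rw [div_eq_iff hr0.ne']
      nth_rw 3 [← Real.exp_log hr0]
      rw [← Real.exp_add]
      ring_nf

/-- The Dirichlet-type integral of `log (f - w)`, for `f` univalent omitting `w`, is bounded by a
universal constant. -/
lemma dirichlet_log_le {f l : ℂ → ℂ} (hf : DifferentiableOn ℂ f (ball 0 1))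
    (hinj : InjOn f (ball 0 1)) {w : ℂ} (hw : w ∉ f '' ball 0 1)
    (hl : ∀ z ∈ ball (0 : ℂ) 1, HasDerivAt l (deriv f z / (f z - w)) z)
    (hle : ∀ z ∈ ball (0 : ℂ) 1, Complex.exp (l z) = f z - w) :
    dirichlet (deriv l) ≤ ∫⁻ y, ENNReal.ofReal (logWeight y) := by
  set g : ℂ → ℂ := fun z => Complex.exp (l z - l 0) with hg
  have hgd : ∀ z ∈ ball (0 : ℂ) 1, HasDerivAt g (g z * deriv l z) z := fun z hz => by
    have := (((hl z hz).differentiableAt.hasDerivAt).sub_const (l 0)).cexp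
    exact this
  have hginj : InjOn g (ball 0 1) := fun x hx y hy hxy => by
    simp only [hg, Complex.exp_sub, hle x hx, hle y hy] at hxy
    rw [div_left_inj' (Complex.exp_ne_zero _), sub_left_inj] at hxy
    exact hinj hx hy hxy
  refine le_trans ?_ (setLIntegral_le_lintegral (g '' ball 0 1) _)
  rw [lintegral_image_of_injOn measurableSet_ball (fun z hz => (hgd z hz).differentiableAt) hginj,
    dirichlet]
  refine setLIntegral_mono' measurableSet_ball fun z hz => ?_
  have hz1 := mem_ball_zero_iff.1 hz
  have hr0 := norm_nonneg z
  rw [(hgd z hz).deriv, ← ENNReal.ofReal_mul (sq_nonneg _)]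
  refine ENNReal.ofReal_le_ofReal ?_
  have hgp : 0 < ‖g z‖ := norm_pos_iff.2 (Complex.exp_ne_zero _)
  have h1 : ‖g z * deriv l z‖ ^ 2 * logWeight (g z) =
      ‖deriv l z‖ ^ 2 * (4 * Real.exp (-|Real.log ‖g z‖| / 16)) := by
    rw [logWeight, norm_mul]
    field_simp
  rw [h1]
  gcongr
  have h2 : |Real.log ‖g z‖| ≤ 16 * (Real.log (1 + ‖z‖) - Real.log (1 - ‖z‖)) := by
    rw [hg, Complex.norm_exp, Real.log_exp]
    exact (Complex.abs_re_le_norm _).trans (norm_log_sub_le hf hinj hw hl hz1)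
  have h3 : (1 - ‖z‖) / (1 + ‖z‖) ≤ Real.exp (-|Real.log ‖g z‖| / 16) := by
    rw [← Real.exp_log (show 0 < (1 - ‖z‖) / (1 + ‖z‖) by
      exact div_pos (by linarith) (by linarith)), Real.log_div (by linarith) (by linarith)]
    exact Real.exp_le_exp.2 (by linarith)
  have h4 : (1 - ‖z‖ ^ 2) ≤ 4 * ((1 - ‖z‖) / (1 + ‖z‖)) := by
    rw [← mul_div_assoc, le_div_iff₀ (by linarith)]
    nlinarith [mul_nonneg hr0 (sub_nonneg.2 hz1.le)]
  linarith

/-! ## Bounded mean oscillation implies boundedness of the pull-back -/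

/-- The mass that the pull-back puts on an open set on which the conformal map is distorted by a
bounded factor. -/
lemma pushForward_le_of_deriv_bound {f g : ℂ → ℂ} (hf : DifferentiableOn ℂ f (ball 0 1))
    (hinj : InjOn f (ball 0 1)) (hg : ∀ z ∈ ball (0 : ℂ) 1, g (f z) = z) {μ : Measure ℂ}
    {W : Set ℂ} (hW : MeasurableSet W) {c R : ℝ} {w₀ : ℂ}
    (hd : ∀ z ∈ W ∩ ball 0 1, ‖(deriv f z)⁻¹‖ ≤ c) (hR : ∀ z ∈ W ∩ ball 0 1, f z ∈ ball w₀ R) :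
    pushForward (f '' ball 0 1) g μ W ≤
      ENNReal.ofReal c * μ (f '' ball 0 1 ∩ ball w₀ R) := by
  have ho := isOpen_image_ball hf hinj
  have hgd : ∀ z ∈ ball (0 : ℂ) 1, HasDerivAt g (deriv f z)⁻¹ (f z) := fun z hz =>
    hasDerivAt_inverse_of_injOn hf hinj hg hz
  have hgc : ContinuousOn g (f '' ball 0 1) := by
    rintro _ ⟨z, hz, rfl⟩
    exact (hgd z hz).continuousAt.continuousWithinAt
  rw [← lintegral_indicator_one hW, lintegral_pushForward ho.measurableSet hgc μ
    (measurable_one.indicator hW)]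
  calc ∫⁻ w in f '' ball 0 1, (‖deriv g w‖₊ : ℝ≥0∞) * W.indicator 1 (g w) ∂μ
      ≤ ∫⁻ w in f '' ball 0 1, (ball w₀ R).indicator (fun _ => ENNReal.ofReal c) w ∂μ := by
        refine setLIntegral_mono' ho.measurableSet ?_
        rintro _ ⟨z, hz, rfl⟩
        rw [hg z hz, (hgd z hz).deriv]
        by_cases hzW : z ∈ W
        · rw [indicator_of_mem hzW, indicator_of_mem (hR z ⟨hzW, hz⟩), Pi.one_apply, mul_one,
            ← enorm_eq_nnnorm, ← ofReal_norm]
          exact ENNReal.ofReal_le_ofReal (hd z ⟨hzW, hz⟩)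
        · rw [indicator_of_notMem hzW]; simp
    _ = _ := by
        rw [lintegral_indicator_const measurableSet_ball,
          Measure.restrict_apply measurableSet_ball, inter_comm]

lemma pushForward_univ_le {f g F : ℂ → ℂ} (hf : DifferentiableOn ℂ f (ball 0 1))
    (hinj : InjOn f (ball 0 1)) (hne : f '' ball 0 1 ≠ univ)
    (hg : ∀ z ∈ ball (0 : ℂ) 1, g (f z) = z) (hF : DifferentiableOn ℂ F (ball 0 1))
    (hFf : ∀ z ∈ ball (0 : ℂ) 1, ‖deriv f 0‖ ≤ 4 * Real.exp ‖F z - F 0‖ * ‖deriv f z‖)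
    {A B M S r N : ℝ} (hA0 : 0 ≤ A) (hB0 : 0 ≤ B) (hM0 : 0 ≤ M) (hS0 : 0 ≤ S) (hN : 0 < N)
    (hr0 : 0 < r) (hr : r < 1) (hA : dirichlet (deriv F) ≤ ENNReal.ofReal A)
    (hB : ∫⁻ y, ENNReal.ofReal (logWeight y) ≤ ENNReal.ofReal B) {μ : Measure ℂ}
    (hμ : ∀ w ∈ frontier (f '' ball 0 1), ∀ R : ℝ, 0 < R →
      μ (f '' ball 0 1 ∩ ball w R) ≤ ENNReal.ofReal (M * R))
    (hν : ∀ᵐ z ∂(pushForward (f '' ball 0 1) g μ), ‖z‖ ≤ r)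
    (hS : ∀ b : ℂ, ‖b‖ < 1 → garsia (pushForward (f '' ball 0 1) g μ) b ≤ ENNReal.ofReal S) :
    pushForward (f '' ball 0 1) g μ univ ≤
      ENNReal.ofReal (4 * Real.exp (2 * N) * M + 24 * S * (A + B) / N ^ 2) := by
  set ν := pushForward (f '' ball 0 1) g μ with hνdef
  have h0 : (0 : ℂ) ∈ ball (0 : ℂ) 1 := by simp
  obtain ⟨w₀, hw₀, hd⟩ := exists_near_omitted_zero hf hinj hne
  have hw := notMem_of_mem_frontier_image hf hinj hw₀
  obtain ⟨l, hl, hle⟩ := exists_log_of_ne_zero (f := fun z => f z - w₀) (hf.sub_const w₀)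
    fun z hz h => hw ⟨z, hz, sub_eq_zero.1 h⟩
  simp only [deriv_sub_const] at hl
  have hld : DifferentiableOn ℂ l (ball 0 1) := fun z hz =>
    (hl z hz).differentiableAt.differentiableWithinAt
  have key : ∀ {G : ℂ → ℂ} {Q : ℝ}, DifferentiableOn ℂ G (ball 0 1) → 0 ≤ Q →
      dirichlet (deriv G) ≤ ENNReal.ofReal Q →
      ν {z | N ≤ ‖G z - G 0‖} ≤ ENNReal.ofReal (24 * S * Q / N ^ 2) := by
    intro G Q hG hQ0 hQ
    exact measure_norm_ge_le (F := fun z => G z - G 0) hr0 hr hν hS0 hS (hG.sub_const _)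
      (fun s hs => (ENNReal.ofReal_le_ofReal_iff hQ0).1
        ((circleAverage_sq_le_dirichlet hG hs.1 hs.2).trans hQ)) hN
  have h1 := key hF hA0 hA
  have h2 := key hld hB0 ((dirichlet_log_le hf hinj hw hl hle).trans hB)
  set W : Set ℂ := (ball 0 1 ∩ (fun z => ‖F z - F 0‖) ⁻¹' Iio N) ∩
    (ball 0 1 ∩ (fun z => ‖l z - l 0‖) ⁻¹' Iio N) with hWdef
  have hWo : IsOpen W :=
    (((hF.continuousOn.sub continuousOn_const).norm).isOpen_inter_preimage isOpen_ball
      isOpen_Iio).inter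
    (((hld.continuousOn.sub continuousOn_const).norm).isOpen_inter_preimage isOpen_ball isOpen_Iio)
  have hd0 : 0 < ‖f 0 - w₀‖ := norm_pos_iff.2 fun h => hw ⟨0, h0, sub_eq_zero.1 h⟩
  have hf0 : 0 < ‖deriv f 0‖ := norm_pos_iff.2 (deriv_ne_zero_of_injOn hf hinj h0)
  have h3 : ν W ≤ ENNReal.ofReal (4 * Real.exp (2 * N) * M) := by
    have hc0 : 0 ≤ 4 * Real.exp N / ‖deriv f 0‖ := by positivity
    refine (pushForward_le_of_deriv_bound hf hinj hg hWo.measurableSet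
      (c := 4 * Real.exp N / ‖deriv f 0‖) (R := Real.exp N * ‖f 0 - w₀‖) (w₀ := w₀) ?_ ?_).trans
      ((mul_le_mul_right (hμ w₀ hw₀ _ (by positivity)) _).trans ?_)
    · rintro z ⟨hz, hzb⟩
      have hz2 : ‖F z - F 0‖ < N := hz.1.2
      have hp : 0 < ‖deriv f z‖ := norm_pos_iff.2 (deriv_ne_zero_of_injOn hf hinj hzb)
      rw [norm_inv, inv_le_iff_one_le_mul₀ hp, div_mul_eq_mul_div, le_div_iff₀ hf0, one_mul]
      refine (hFf z hzb).trans ?_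
      gcongr
    · rintro z ⟨hz, hzb⟩
      have hz2 : ‖l z - l 0‖ < N := hz.2.2
      rw [mem_ball, dist_eq_norm, ← hle z hzb, ← hle 0 h0, Complex.norm_exp, Complex.norm_exp,
        ← Real.exp_add]
      refine Real.exp_lt_exp.2 ?_
      have := (Complex.re_le_norm (l z - l 0))
      rw [Complex.sub_re] at this
      linarith
    · rw [← ENNReal.ofReal_mul hc0]
      refine ENNReal.ofReal_le_ofReal ?_
      rw [two_mul, Real.exp_add]
      have : ‖f 0 - w₀‖ / ‖deriv f 0‖ ≤ 1 := (div_le_one hf0).2 hd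
      calc 4 * Real.exp N / ‖deriv f 0‖ * (M * (Real.exp N * ‖f 0 - w₀‖))
          = 4 * (Real.exp N * Real.exp N) * M * (‖f 0 - w₀‖ / ‖deriv f 0‖) := by ring
        _ ≤ 4 * (Real.exp N * Real.exp N) * M * 1 := by gcongr
        _ = _ := mul_one _
  have hsub : (univ : Set ℂ) ⊆ W ∪ {z | N ≤ ‖F z - F 0‖} ∪ {z | N ≤ ‖l z - l 0‖} ∪
      {z | ¬ ‖z‖ ≤ r} := by
    intro z _
    by_contra hcon
    simp only [mem_union, mem_ofPred_eq, not_or, not_le] at hcon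
    have hzb : z ∈ ball (0 : ℂ) 1 := mem_ball_zero_iff.2 ((not_lt.1 hcon.2).trans_lt hr)
    exact hcon.1.1.1 ⟨⟨hzb, hcon.1.1.2⟩, ⟨hzb, hcon.1.2⟩⟩
  have h4 : ν {z | ¬ ‖z‖ ≤ r} = 0 := hν
  calc ν univ ≤ ν W + ν {z | N ≤ ‖F z - F 0‖} + ν {z | N ≤ ‖l z - l 0‖} + ν {z | ¬ ‖z‖ ≤ r} :=
        (measure_mono hsub).trans ((measure_union_le _ _).trans (add_le_add_left
          ((measure_union_le _ _).trans (add_le_add_left (measure_union_le _ _) _)) _))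
    _ ≤ ENNReal.ofReal (4 * Real.exp (2 * N) * M) + ENNReal.ofReal (24 * S * A / N ^ 2) +
          ENNReal.ofReal (24 * S * B / N ^ 2) := by
        rw [h4, add_zero]; gcongr
    _ = _ := by
        rw [← ENNReal.ofReal_add (by positivity) (by positivity),
          ← ENNReal.ofReal_add (by positivity) (by positivity)]
        congr 1
        ring

lemma ae_norm_le_pushForward {Ω T : Set ℂ} {g : ℂ → ℂ} (hΩ : MeasurableSet Ω)
    (hT : MeasurableSet T) (hg : ContinuousOn g Ω) {r : ℝ} (h : ∀ w ∈ Ω ∩ T, ‖g w‖ ≤ r)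
    (μ : Measure ℂ) : ∀ᵐ z ∂(pushForward Ω g (μ.restrict T)), ‖z‖ ≤ r := by
  have hm : MeasurableSet {z : ℂ | ¬ ‖z‖ ≤ r} :=
    (measurableSet_le measurable_norm measurable_const).compl
  rw [ae_iff, ← lintegral_indicator_one hm,
    lintegral_pushForward hΩ hg _ (measurable_one.indicator hm), Measure.restrict_restrict hΩ]
  rw [setLIntegral_congr_fun (g := fun _ => 0) (hΩ.inter hT) fun w hw => ?_]
  · simp
  · rw [indicator_of_notMem (by simpa using h w hw)]
    simp

lemma norm_mob_le_of_norm_le {b z : ℂ} {r : ℝ} (hb : ‖b‖ < 1) (hr : r < 1) (hz : ‖z‖ ≤ r) :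
    ‖mob b z‖ ≤ √(1 - (1 - ‖b‖ ^ 2) * (1 - r ^ 2) / 4) := by
  have hz1 : ‖z‖ ≤ 1 := hz.trans hr.le
  have hb0 := norm_nonneg b
  have hz0 := norm_nonneg z
  have hq : 0 < 1 - ‖b‖ ^ 2 := by nlinarith
  refine Real.le_sqrt_of_sq_le ?_
  have h1 := one_sub_normSq_mob hb hz1
  have h2 := den_pos hb hz1
  have h3 : ‖1 + conj b * z‖ ≤ 2 := by
    refine (norm_add_le _ _).trans ?_
    rw [norm_one, norm_mul, Complex.norm_conj]
    nlinarith
  have h4 : (1 - ‖b‖ ^ 2) * (1 - r ^ 2) / 4 ≤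
      (1 - ‖b‖ ^ 2) * (1 - ‖z‖ ^ 2) / ‖1 + conj b * z‖ ^ 2 := by
    have : 0 ≤ 1 - ‖z‖ ^ 2 := by nlinarith
    have : ‖1 + conj b * z‖ ^ 2 ≤ 4 := by nlinarith
    gcongr
  linarith

section

variable {φ ψ : ℂ → ℂ}

lemma differentiableOn_inverse_of_injOn (hφ : DifferentiableOn ℂ φ (ball 0 1))
    (hinj : InjOn φ (ball 0 1))
    (hψ : ∀ z ∈ ball (0 : ℂ) 1, ψ (φ z) = z) : DifferentiableOn ℂ ψ (φ '' ball 0 1) := by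
  rintro _ ⟨z, hz, rfl⟩
  exact (hasDerivAt_inverse_of_injOn hφ hinj hψ hz).differentiableAt.differentiableWithinAt

lemma mapsTo_inverse (hψ : ∀ z ∈ ball (0 : ℂ) 1, ψ (φ z) = z) :
    MapsTo ψ (φ '' ball 0 1) (ball 0 1) := by
  rintro _ ⟨z, hz, rfl⟩
  rwa [hψ z hz]

lemma isCompact_image_closedBall (hφ : DifferentiableOn ℂ φ (ball 0 1)) {r : ℝ} (hr : r < 1) :
    IsCompact (φ '' closedBall 0 r) :=
  (isCompact_closedBall 0 r).image_of_continuousOn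
    (hφ.continuousOn.mono (closedBall_subset_ball hr))

lemma exists_garsia_pushForward_restrict_le (hφ : DifferentiableOn ℂ φ (ball 0 1))
    (hinj : InjOn φ (ball 0 1)) (hne : φ '' ball 0 1 ≠ univ)
    (hψ : ∀ z ∈ ball (0 : ℂ) 1, ψ (φ z) = z) {μ : Measure ℂ}
    (hμ : carlesonNorm (φ '' ball 0 1) μ < ∞) {r : ℝ} (hr : r < 1) :
    ∃ S : ℝ≥0∞, S < ∞ ∧ ∀ b : ℂ, ‖b‖ < 1 →
      garsia (pushForward (φ '' ball 0 1) ψ (μ.restrict (φ '' closedBall 0 r))) b ≤ S := by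
  set T := φ '' closedBall 0 r with hT
  set ν := pushForward (φ '' ball 0 1) ψ (μ.restrict T) with hν
  have ho := isOpen_image_ball hφ hinj
  have hTc : IsCompact T := isCompact_image_closedBall hφ hr
  have hae : ∀ᵐ z ∂ν, ‖z‖ ≤ r := by
    refine ae_norm_le_pushForward ho.measurableSet hTc.measurableSet
      (differentiableOn_inverse_of_injOn hφ hinj hψ).continuousOn ?_ μ
    rintro _ ⟨-, z, hz, rfl⟩
    rw [hψ z (closedBall_subset_ball hr hz)]
    exact mem_closedBall_zero_iff.1 hz
  obtain ⟨w₀, hw₀, -⟩ := exists_near_omitted_zero hφ hinj hne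
  obtain ⟨R, hR0, hR⟩ : ∃ R : ℝ, 0 < R ∧ T ⊆ ball w₀ R := by
    obtain ⟨R, hR⟩ := hTc.isBounded.subset_ball w₀
    exact ⟨max R 1, by positivity, hR.trans (ball_subset_ball (le_max_left _ _))⟩
  have hc1 : ContinuousOn (fun z => (deriv φ z)⁻¹) (closedBall 0 r) :=
    ((hφ.deriv isOpen_ball).continuousOn.mono (closedBall_subset_ball hr)).inv₀ fun z hz =>
      deriv_ne_zero_of_injOn hφ hinj (closedBall_subset_ball hr hz)
  obtain ⟨c, hc⟩ := (isCompact_closedBall (0 : ℂ) r).exists_bound_of_continuousOn hc1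
  have h1 : ν (closedBall 0 r) < ∞ := by
    refine (pushForward_le_of_deriv_bound hφ hinj hψ measurableSet_closedBall (c := c)
      (fun z hz => hc z hz.1) (fun z hz => hR (mem_image_of_mem φ hz.1))).trans_lt ?_
    refine ENNReal.mul_lt_top ENNReal.ofReal_lt_top ?_
    refine ((Measure.restrict_le_self _).trans
      (measure_image_inter_ball_le hφ hinj hw₀ hR0)).trans_lt ?_
    exact ENNReal.mul_lt_top hμ ENNReal.ofReal_lt_top
  have h2 : ν univ < ∞ := by
    have h3 : ν (closedBall 0 r)ᶜ = 0 := by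
      rw [ae_iff] at hae
      refine measure_mono_null (fun z hz => ?_) hae
      simpa using hz
    rw [← measure_add_measure_compl (measurableSet_closedBall (x := (0 : ℂ)) (ε := r)), h3,
      add_zero]
    exact h1
  refine ⟨ENNReal.ofReal (1 / (1 - r) ^ 2) * ν univ,
    ENNReal.mul_lt_top ENNReal.ofReal_lt_top h2, fun b hb => ?_⟩
  rw [garsia, ← lintegral_const]
  refine lintegral_mono_ae ?_
  filter_upwards [hae] with z hz
  refine ENNReal.ofReal_le_ofReal ?_
  have hr' : 0 < 1 - r := by linarith
  have h4 : 1 - r ≤ ‖1 - conj b * z‖ := by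
    have h5 : ‖conj b * z‖ ≤ r := by
      rw [norm_mul, Complex.norm_conj]; nlinarith [norm_nonneg b, norm_nonneg z]
    have h6 := norm_sub_norm_le (1 : ℂ) (conj b * z)
    rw [norm_one] at h6
    linarith
  rw [garsiaK]
  gcongr
  nlinarith [norm_nonneg b]

lemma garsia_pushForward_restrict_le {L : ℂ → ℂ} (hφ : DifferentiableOn ℂ φ (ball 0 1))
    (hinj : InjOn φ (ball 0 1)) (hne : φ '' ball 0 1 ≠ univ)
    (hψ : ∀ z ∈ ball (0 : ℂ) 1, ψ (φ z) = z)
    (hL : ∀ z ∈ ball (0 : ℂ) 1, HasDerivAt L (deriv (deriv φ) z / deriv φ z) z)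
    (hLe : ∀ z ∈ ball (0 : ℂ) 1, Complex.exp (L z) = deriv φ z)
    {A B N : ℝ} (hA0 : 0 ≤ A) (hB0 : 0 ≤ B) (hN : 0 < N) (hN2 : 48 * (A + B) ≤ N ^ 2)
    (hA : ∀ b : ℂ, ‖b‖ < 1 → dirichlet (deriv (L ∘ mob b)) ≤ ENNReal.ofReal A)
    (hB : ∫⁻ y, ENNReal.ofReal (logWeight y) ≤ ENNReal.ofReal B) {μ : Measure ℂ}
    (hμ : carlesonNorm (φ '' ball 0 1) μ < ∞) {r : ℝ} (hr0 : 0 < r) (hr : r < 1) {b : ℂ}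
    (hb : ‖b‖ < 1) :
    garsia (pushForward (φ '' ball 0 1) ψ (μ.restrict (φ '' closedBall 0 r))) b ≤
      ENNReal.ofReal (8 * Real.exp (2 * N)) * carlesonNorm (φ '' ball 0 1) μ := by
  set T := φ '' closedBall 0 r with hT
  set Ω := φ '' ball 0 1 with hΩ
  set ν := pushForward Ω ψ (μ.restrict T) with hν
  have ho : IsOpen Ω := isOpen_image_ball hφ hinj
  have hTc : IsCompact T := isCompact_image_closedBall hφ hr
  have hψd := differentiableOn_inverse_of_injOn hφ hinj hψ
  have hψm := mapsTo_inverse hψ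
  have hLd : DifferentiableOn ℂ L (ball 0 1) := fun z hz =>
    (hL z hz).differentiableAt.differentiableWithinAt
  obtain ⟨S₀, hS₀, hS₀b⟩ := exists_garsia_pushForward_restrict_le hφ hinj hne hψ hμ hr
  set S := ⨆ a : ball (0 : ℂ) 1, garsia ν a with hS
  have hSlt : S < ∞ := (iSup_le fun a : ball (0 : ℂ) 1 =>
    hS₀b a (mem_ball_zero_iff.1 a.2)).trans_lt hS₀
  have hSb : ∀ a : ℂ, ‖a‖ < 1 → garsia ν a ≤ ENNReal.ofReal S.toReal := fun a ha => by
    rw [ENNReal.ofReal_toReal hSlt.ne]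
    exact le_iSup (fun a : ball (0 : ℂ) 1 => garsia ν a) ⟨a, mem_ball_zero_iff.2 ha⟩
  set M := (carlesonNorm Ω μ).toReal with hM
  have hMe : ENNReal.ofReal M = carlesonNorm Ω μ := ENNReal.ofReal_toReal hμ.ne
  have hM0 : 0 ≤ M := ENNReal.toReal_nonneg
  have key : ∀ a : ℂ, ‖a‖ < 1 → garsia ν a ≤
      ENNReal.ofReal (4 * Real.exp (2 * N) * M + 24 * S.toReal * (A + B) / N ^ 2) := by
    intro a ha
    have ha' : ‖-a‖ < 1 := by rwa [norm_neg]
    have hq : 0 < 1 - ‖a‖ ^ 2 := by nlinarith [norm_nonneg a]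
    have hq' : 0 < 1 - r ^ 2 := by nlinarith
    have himg : (φ ∘ mob a) '' ball 0 1 = Ω := image_comp_mob ha
    have hg0 : ∀ c : ℂ, ‖c‖ < 1 → garsia (pushForward Ω (mob (-a) ∘ ψ) (μ.restrict T)) c =
        garsia ν (mob a c) := fun c hc => garsia_pushForward_mob ho hψd hψm _ hc ha
    have h0 : garsia ν a = pushForward Ω (mob (-a) ∘ ψ) (μ.restrict T) univ := by
      have h1 := hg0 0 (by simp)
      rw [mob_zero] at h1
      rw [← h1]
      simp [garsia, garsiaK]
    rw [h0, ← himg]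
    have hr'1 : √(1 - (1 - ‖a‖ ^ 2) * (1 - r ^ 2) / 4) < 1 := by
      rw [Real.sqrt_lt' one_pos]
      nlinarith [mul_pos hq hq']
    have hr'0 : 0 < √(1 - (1 - ‖a‖ ^ 2) * (1 - r ^ 2) / 4) := by
      apply Real.sqrt_pos.2
      nlinarith [mul_nonneg (sq_nonneg ‖a‖) (sq_nonneg r), sq_nonneg ‖a‖, sq_nonneg r]
    refine pushForward_univ_le (F := L ∘ mob a) (hφ.comp_mob ha) (hinj.comp_mob ha)
      (by rwa [himg]) (fun z hz => ?_) (hLd.comp_mob ha) (fun z hz => ?_) hA0 hB0 hM0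
      ENNReal.toReal_nonneg hN hr'0 hr'1 (hA a ha) hB ?_ ?_ ?_
    · rw [Function.comp_apply, Function.comp_apply, hψ _ (mapsTo_mob ha hz),
        mob_neg_mob ha (mem_ball_zero_iff.1 hz).le]
    · have hz1 := mem_ball_zero_iff.1 hz
      have hm := mapsTo_mob ha hz
      have hab := mem_ball_zero_iff.2 ha
      rw [norm_deriv_comp_mob_zero hφ ha, deriv_comp_mob hφ ha hz1, norm_mul,
        norm_deriv_mob ha hz1.le, ← hLe a hab, ← hLe _ hm, Complex.norm_exp, Complex.norm_exp]
      simp only [Function.comp_apply, mob_zero]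
      have h1 : Real.exp (L a).re ≤ Real.exp ‖L (mob a z) - L a‖ * Real.exp (L (mob a z)).re := by
        rw [← Real.exp_add]
        refine Real.exp_le_exp.2 ?_
        have := (neg_le_abs _).trans (Complex.abs_re_le_norm (L (mob a z) - L a))
        rw [Complex.sub_re] at this
        linarith
      have h2 := den_pos ha hz1.le
      have h3 : ‖1 + conj a * z‖ ≤ 2 := by
        refine (norm_add_le _ _).trans ?_
        rw [norm_one, norm_mul, Complex.norm_conj]
        nlinarith [norm_nonneg a, norm_nonneg z]
      have h4 : 1 - ‖a‖ ^ 2 ≤ 4 * ((1 - ‖a‖ ^ 2) / ‖1 + conj a * z‖ ^ 2) := by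
        rw [← mul_div_assoc, le_div_iff₀ (by positivity), mul_comm 4]
        gcongr
        nlinarith
      calc Real.exp (L a).re * (1 - ‖a‖ ^ 2)
          ≤ (Real.exp ‖L (mob a z) - L a‖ * Real.exp (L (mob a z)).re) *
            (4 * ((1 - ‖a‖ ^ 2) / ‖1 + conj a * z‖ ^ 2)) := by gcongr
        _ = _ := by ring
    · rw [himg]
      intro w hw R hR
      rw [ENNReal.ofReal_mul hM0, hMe]
      exact (Measure.restrict_le_self _).trans (measure_image_inter_ball_le hφ hinj hw hR)
    · rw [himg]
      refine ae_norm_le_pushForward ho.measurableSet hTc.measurableSet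
        (((continuousOn_mob ha').mono ball_subset_closedBall).comp hψd.continuousOn hψm) ?_ μ
      rintro _ ⟨-, z, hz, rfl⟩
      rw [Function.comp_apply, hψ z (closedBall_subset_ball hr hz)]
      simpa using norm_mob_le_of_norm_le ha' hr (mem_closedBall_zero_iff.1 hz)
    · rw [himg]
      intro c hc
      rw [hg0 c hc]
      exact hSb _ (mob_mem_ball ha hc)
  have hfin : S.toReal ≤ 4 * Real.exp (2 * N) * M + 24 * S.toReal * (A + B) / N ^ 2 := by
    refine ENNReal.toReal_le_of_le_ofReal ?_ (iSup_le fun a : ball (0 : ℂ) 1 =>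
      key a (mem_ball_zero_iff.1 a.2))
    have : 0 ≤ S.toReal := ENNReal.toReal_nonneg
    positivity
  have hhalf : 24 * S.toReal * (A + B) / N ^ 2 ≤ S.toReal / 2 := by
    rw [div_le_iff₀ (by positivity)]
    nlinarith [mul_le_mul_of_nonneg_left hN2 (ENNReal.toReal_nonneg (a := S))]
  refine (hSb b hb).trans ?_
  rw [← hMe, ← ENNReal.ofReal_mul (by positivity)]
  exact ENNReal.ofReal_le_ofReal (by linarith)

/-- If `log φ'` has bounded mean oscillation, the pull-back operator is bounded. -/
lemma exists_carlesonNorm_pushForward_le (hφ : DifferentiableOn ℂ φ (ball 0 1))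
    (hinj : InjOn φ (ball 0 1)) (hne : φ '' ball 0 1 ≠ univ)
    (hψ : ∀ z ∈ ball (0 : ℂ) 1, ψ (φ z) = z) (h : IsCarleson unitDisk (bmoaMeasure φ)) :
    ∃ C : ℝ, 0 < C ∧ ∀ μ : Measure ℂ, IsCarleson (φ '' ball 0 1) μ →
      carlesonNorm unitDisk (pushForward (φ '' ball 0 1) ψ μ) ≤
        ENNReal.ofReal C * carlesonNorm (φ '' ball 0 1) μ := by
  obtain ⟨L, hL, hLe⟩ := exists_log_of_ne_zero (hφ.deriv isOpen_ball)
    fun z hz => deriv_ne_zero_of_injOn hφ hinj hz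
  set A := 32 * (carlesonNorm unitDisk (bmoaMeasure φ)).toReal with hA
  set B := (∫⁻ y, ENNReal.ofReal (logWeight y)).toReal with hB
  have hA0 : 0 ≤ A := mul_nonneg (by norm_num) ENNReal.toReal_nonneg
  have hB0 : 0 ≤ B := ENNReal.toReal_nonneg
  have hA1 : ∀ b : ℂ, ‖b‖ < 1 → dirichlet (deriv (L ∘ mob b)) ≤ ENNReal.ofReal A := by
    intro b hb
    rw [← garsia_bmoaMeasure hL hb, hA, ENNReal.ofReal_mul (by norm_num),
      ENNReal.ofReal_toReal (ne_of_lt h)]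
    exact (garsia_restrict_le hb).trans_eq (by norm_num)
  set N := 48 * (A + B) + 1 with hN
  have hN1 : 1 ≤ N := by linarith
  refine ⟨5 * (8 * Real.exp (2 * N)), by positivity, fun μ hμ => ?_⟩
  rw [ENNReal.ofReal_mul (by norm_num), mul_assoc, show ENNReal.ofReal 5 = 5 by norm_num]
  refine carlesonNorm_le_of_garsia fun b hb => ?_
  have ho : IsOpen (φ '' ball 0 1) := isOpen_image_ball hφ hinj
  have hψc := (differentiableOn_inverse_of_injOn hφ hinj hψ).continuousOn
  have hle : garsia ((pushForward (φ '' ball 0 1) ψ μ).restrict unitDisk) b ≤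
      garsia (pushForward (φ '' ball 0 1) ψ μ) b :=
    lintegral_mono' Measure.restrict_le_self le_rfl
  refine hle.trans ?_
  have hu : φ '' ball 0 1 = ⋃ n : ℕ, φ '' closedBall 0 (1 - 1 / ((n : ℝ) + 2)) := by
    rw [← image_iUnion]
    congr 1
    ext z
    simp only [mem_ball_zero_iff, mem_iUnion, mem_closedBall_zero_iff]
    constructor
    · intro hz
      obtain ⟨n, hn⟩ := exists_nat_one_div_lt (sub_pos.2 hz)
      refine ⟨n, ?_⟩
      have : 1 / ((n : ℝ) + 2) ≤ 1 / ((n : ℝ) + 1) := by gcongr; norm_num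
      linarith
    · rintro ⟨n, hn⟩
      have : 0 < 1 / ((n : ℝ) + 2) := by positivity
      linarith
  have hdir : Directed (· ⊆ ·) fun n : ℕ => φ '' closedBall (0 : ℂ) (1 - 1 / ((n : ℝ) + 2)) := by
    refine Monotone.directed_le (f := fun n : ℕ => φ '' closedBall (0 : ℂ) (1 - 1 / ((n : ℝ) + 2)))
      fun m n hmn => image_mono (closedBall_subset_closedBall ?_)
    have : (m : ℝ) ≤ n := by exact_mod_cast hmn
    gcongr
  rw [garsia, lintegral_pushForward ho.measurableSet hψc μ (measurable_garsiaK b).ennreal_ofReal]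
  have hsplit : ∫⁻ w in φ '' ball 0 1, (‖deriv ψ w‖₊ : ℝ≥0∞) * ENNReal.ofReal (garsiaK b (ψ w)) ∂μ =
      ⨆ n : ℕ, ∫⁻ w in φ '' closedBall 0 (1 - 1 / ((n : ℝ) + 2)),
        (‖deriv ψ w‖₊ : ℝ≥0∞) * ENNReal.ofReal (garsiaK b (ψ w)) ∂μ := by
    rw [← setLIntegral_iUnion_of_directed _ hdir, ← hu]
  rw [hsplit]
  refine iSup_le fun n => ?_
  have hn : 1 / ((n : ℝ) + 2) ≤ 1 / 2 := by gcongr; linarith [n.cast_nonneg (α := ℝ)]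
  have hn' : 0 < 1 / ((n : ℝ) + 2) := by positivity
  have hn1 : 1 - 1 / ((n : ℝ) + 2) < 1 := by linarith
  have := garsia_pushForward_restrict_le hφ hinj hne hψ hL hLe hA0 hB0 (by linarith : 0 < N)
    (by nlinarith) hA1 (ENNReal.ofReal_toReal lintegral_logWeight_lt_top.ne).ge hμ
    (by linarith) hn1 hb
  refine le_trans (le_of_eq ?_) this
  rw [garsia, lintegral_pushForward ho.measurableSet hψc _ (measurable_garsiaK b).ennreal_ofReal,
    Measure.restrict_restrict ho.measurableSet,
    inter_eq_right.2 (image_mono (closedBall_subset_ball hn1))]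

end

/-! ## Running minima and lengths of curves -/

/-- The running minimum of a sequence. -/
noncomputable def runMin (v : ℕ → ℝ) : ℕ → ℝ
  | 0 => v 0
  | j + 1 => min (runMin v j) (v (j + 1))

lemma runMin_succ_le (v : ℕ → ℝ) (j : ℕ) : runMin v (j + 1) ≤ runMin v j := min_le_left _ _

lemma runMin_le (v : ℕ → ℝ) : ∀ j, runMin v j ≤ v j
  | 0 => le_rfl
  | _ + 1 => min_le_right _ _

lemma runMin_pos {v : ℕ → ℝ} (hv : ∀ j, 0 < v j) : ∀ j, 0 < runMin v j
  | 0 => hv 0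
  | j + 1 => lt_min (runMin_pos hv j) (hv (j + 1))

lemma continuous_runMin {X : Type*} [TopologicalSpace X] {v : X → ℕ → ℝ}
    (hv : ∀ j, Continuous fun x => v x j) : ∀ j, Continuous fun x => runMin (v x) j
  | 0 => hv 0
  | j + 1 => (continuous_runMin hv j).min (hv (j + 1))

lemma log_sub_log_le_sum_runMin {v : ℕ → ℝ} (hv : ∀ j, 0 < v j) (n : ℕ) :
    Real.log (v 0) - Real.log (v n) ≤
      ∑ j ∈ Finset.range n, (runMin v j - runMin v (j + 1)) / v (j + 1) := by
  have h1 : ∀ j, Real.log (runMin v j) - Real.log (runMin v (j + 1)) ≤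
      (runMin v j - runMin v (j + 1)) / v (j + 1) := by
    intro j
    have hp := runMin_pos hv j
    rcases le_total (runMin v j) (v (j + 1)) with h | h
    · simp [runMin, min_eq_left h]
    · have he : runMin v (j + 1) = v (j + 1) := min_eq_right h
      rw [he, ← Real.log_div hp.ne' (hv _).ne']
      refine (Real.log_le_sub_one_of_pos (div_pos hp (hv _))).trans_eq ?_
      rw [sub_div, div_self (hv _).ne']
  have h2 := Finset.sum_le_sum fun j (_ : j ∈ Finset.range n) => h1 j
  rw [Finset.sum_range_sub' fun j => Real.log (runMin v j)] at h2
  have h3 := Real.log_le_log (runMin_pos hv n) (runMin_le v n)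
  have h4 : runMin v 0 = v 0 := rfl
  rw [h4] at h2
  linarith

/-- Tails of the decrements of the running minimum. -/
lemma sum_runMin_tail_le {v : ℕ → ℝ} (hv : ∀ j, 0 < v j) {n : ℕ} {P : ℕ → Prop}
    [DecidablePred P] {c : ℝ} (hc : 0 ≤ c) (hP : ∀ j, P j → P (j + 1))
    (h : ∀ j, P j → (j = 0 ∨ ¬ P (j - 1)) → v j ≤ c) :
    ∑ j ∈ Finset.range n, (if P j then runMin v j - runMin v (j + 1) else 0) ≤ c := by
  have key : ∀ n, (∑ j ∈ Finset.range n, (if P j then runMin v j - runMin v (j + 1) else 0) ≤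
      if P n then c - runMin v n else 0) ∧ (P n → runMin v n ≤ c) := by
    intro n
    induction n with
    | zero =>
      have h0 : P 0 → runMin v 0 ≤ c := fun hp => h 0 hp (Or.inl rfl)
      refine ⟨?_, h0⟩
      rw [Finset.sum_range_zero]
      split_ifs with hp
      · linarith [h0 hp]
      · exact le_rfl
    | succ n ih =>
      have h1 : P (n + 1) → runMin v (n + 1) ≤ c := fun hp => by
        by_cases hpn : P n
        · exact (runMin_succ_le v n).trans (ih.2 hpn)
        · exact (runMin_le v _).trans (h _ hp (Or.inr hpn))
      refine ⟨?_, h1⟩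
      rw [Finset.sum_range_succ]
      by_cases hpn : P n
      · have := ih.1
        rw [if_pos hpn] at this
        rw [if_pos hpn, if_pos (hP n hpn)]
        linarith
      · have := ih.1
        rw [if_neg hpn] at this
        rw [if_neg hpn, add_zero]
        refine this.trans ?_
        split_ifs with hp
        · linarith [h1 hp]
        · exact le_rfl
  refine (key n).1.trans ?_
  split_ifs
  · linarith [runMin_pos hv n]
  · exact hc

lemma ofReal_le_length {γ γ' : ℝ → ℂ} {a b R : ℝ} (hab : a ≤ b)
    (hγ : ∀ t ∈ Icc a b, HasDerivAt γ (γ' t) t) (hγ' : ContinuousOn γ' (Icc a b))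
    (ha : 2 * R ≤ ‖γ a‖) (hb : ‖γ b‖ ≤ R) :
    ENNReal.ofReal R ≤
      ∫⁻ t in Ioc a b, {t | ‖γ t‖ < 2 * R}.indicator (fun t => ENNReal.ofReal ‖γ' t‖) t := by
  have hγc : ContinuousOn (fun t => ‖γ t‖) (Icc a b) := fun t ht =>
    (hγ t ht).continuousAt.norm.continuousWithinAt
  set T := Icc a b ∩ (fun t => ‖γ t‖) ⁻¹' Ici (2 * R) with hT
  have hTc : IsCompact T := isCompact_Icc.of_isClosed_subset
    (hγc.preimage_isClosed_of_isClosed isClosed_Icc isClosed_Ici) inter_subset_left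
  obtain ⟨s, hsT, hs⟩ := hTc.exists_isMaxOn (f := id) ⟨a, ⟨left_mem_Icc.2 hab, ha⟩⟩
    continuousOn_id
  have hsub : Icc s b ⊆ Icc a b := Icc_subset_Icc_left hsT.1.1
  have hsR : 2 * R ≤ ‖γ s‖ := hsT.2
  have h1 : γ b - γ s = ∫ t in s..b, γ' t := by
    refine (intervalIntegral.integral_eq_sub_of_hasDerivAt (fun t ht => hγ t ?_) ?_).symm
    · rw [uIcc_of_le hsT.1.2] at ht; exact hsub ht
    · exact (hγ'.mono (by rw [uIcc_of_le hsT.1.2]; exact hsub)).intervalIntegrable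
  have h2 : R ≤ ‖∫ t in s..b, γ' t‖ := by
    rw [← h1]
    have := norm_sub_norm_le (γ s) (γ b)
    rw [norm_sub_rev] at this
    linarith
  calc ENNReal.ofReal R ≤ ‖∫ t in s..b, γ' t‖ₑ := by
        rw [← ofReal_norm]; exact ENNReal.ofReal_le_ofReal h2
    _ ≤ ∫⁻ t in Ioc s b, ‖γ' t‖ₑ := by
        rw [intervalIntegral.integral_of_le hsT.1.2]
        exact enorm_integral_le_lintegral_enorm _
    _ ≤ ∫⁻ t in Ioc s b, {t | ‖γ t‖ < 2 * R}.indicator (fun t => ENNReal.ofReal ‖γ' t‖) t := by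
        refine setLIntegral_mono' measurableSet_Ioc fun t ht => ?_
        have ht' : t ∈ {t | ‖γ t‖ < 2 * R} := by
          by_contra hcon
          have hge : 2 * R ≤ ‖γ t‖ := not_lt.1 hcon
          have h3 : t ∈ T := ⟨hsub ⟨ht.1.le, ht.2⟩, hge⟩
          exact absurd (hs h3) (not_le.2 ht.1)
        rw [indicator_of_mem ht', ofReal_norm]
    _ ≤ _ := lintegral_mono_set (Ioc_subset_Ioc_left hsT.1.1)

/-! ## The test measure -/

/-- A partition of `[1/2, r]` into `n` equal intervals. -/
noncomputable def rad (r : ℝ) (n j : ℕ) : ℝ := 1 / 2 + (r - 1 / 2) * min ((j : ℝ) / n) 1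

@[simp] lemma rad_zero (r : ℝ) (n : ℕ) : rad r n 0 = 1 / 2 := by simp [rad]

lemma rad_self (r : ℝ) {n : ℕ} (hn : n ≠ 0) : rad r n n = r := by
  have : (n : ℝ) ≠ 0 := Nat.cast_ne_zero.2 hn
  simp [rad, div_self this]

lemma half_le_rad {r : ℝ} (hr : 1 / 2 < r) (n j : ℕ) : 1 / 2 ≤ rad r n j := by
  have : 0 ≤ min ((j : ℝ) / n) 1 := le_min (by positivity) zero_le_one
  unfold rad
  nlinarith

lemma rad_le {r : ℝ} (hr : 1 / 2 < r) (n j : ℕ) : rad r n j ≤ r := by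
  have : min ((j : ℝ) / n) 1 ≤ 1 := min_le_right _ _
  unfold rad
  nlinarith

lemma rad_mono {r : ℝ} (hr : 1 / 2 < r) (n : ℕ) : Monotone (rad r n) := fun i j hij => by
  have : (i : ℝ) ≤ j := Nat.cast_le.2 hij
  have h : min ((i : ℝ) / n) 1 ≤ min ((j : ℝ) / n) 1 := by gcongr
  unfold rad
  nlinarith

lemma rad_succ_le {r : ℝ} (hr : 1 / 2 < r) (hr1 : r < 1) (n j : ℕ) :
    rad r n (j + 1) ≤ rad r n j + 1 / n := by
  have h0 : (0 : ℝ) ≤ 1 / n := by positivity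
  have h : min (((j + 1 : ℕ) : ℝ) / n) 1 ≤ min ((j : ℝ) / n) 1 + 1 / n := by
    push_cast
    rw [add_div, ← min_add_add_right]
    gcongr
    linarith
  unfold rad
  nlinarith

/-- The modulus of the derivative at the points of a ray prescribed by `rad`. -/
noncomputable def speed (f : ℂ → ℂ) (r : ℝ) (n : ℕ) (θ : ℝ) (j : ℕ) : ℝ :=
  ‖deriv f (circleMap 0 (rad r n j) θ)‖

/-- The decrement of the running minimum of the derivative along a ray. -/
noncomputable def speedDrop (f : ℂ → ℂ) (r : ℝ) (n j : ℕ) (θ : ℝ) : ℝ :=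
  runMin (speed f r n θ) j - runMin (speed f r n θ) (j + 1)

/-- The image of the decrements of the running minimum of the derivative along rays. -/
noncomputable def testMeasure (f : ℂ → ℂ) (r : ℝ) (n : ℕ) : Measure ℂ :=
  ∑ j ∈ Finset.range n, Measure.map (fun θ => f (circleMap 0 (rad r n (j + 1)) θ))
    ((volume.restrict (Ioo (-Real.pi) Real.pi)).withDensity fun θ =>
      ENNReal.ofReal (speedDrop f r n j θ))

lemma speedDrop_nonneg (f : ℂ → ℂ) (r : ℝ) (n j : ℕ) (θ : ℝ) : 0 ≤ speedDrop f r n j θ :=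
  sub_nonneg.2 (runMin_succ_le _ _)

lemma norm_circleMap_of_half_le {t : ℝ} (ht : 1 / 2 ≤ t) (θ : ℝ) : ‖circleMap 0 t θ‖ = t := by
  rw [norm_circleMap_zero, abs_of_nonneg (by linarith)]

lemma norm_circleMap_sub_circleMap (s t θ : ℝ) : ‖circleMap 0 s θ - circleMap 0 t θ‖ = |s - t| := by
  simp only [circleMap_zero]
  rw [← sub_mul, norm_mul, Complex.norm_exp_ofReal_mul_I, mul_one, ← Complex.ofReal_sub,
    Complex.norm_real, Real.norm_eq_abs]

section

variable {f : ℂ → ℂ} {r : ℝ}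

lemma circleMap_rad_mem (hr : 1 / 2 < r) (hr1 : r < 1) (n j : ℕ) (θ : ℝ) :
    circleMap 0 (rad r n j) θ ∈ ball (0 : ℂ) 1 := by
  rw [mem_ball_zero_iff, norm_circleMap_of_half_le (half_le_rad hr n j)]
  exact (rad_le hr n j).trans_lt hr1

lemma continuous_comp_circleMap_rad {g : ℂ → ℂ} (hg : ContinuousOn g (ball 0 1))
    (hr : 1 / 2 < r) (hr1 : r < 1) (n j : ℕ) :
    Continuous fun θ => g (circleMap 0 (rad r n j) θ) :=
  hg.comp_continuous (continuous_circleMap 0 _) fun θ => circleMap_rad_mem hr hr1 n j θ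

lemma speed_pos (hf : DifferentiableOn ℂ f (ball 0 1)) (hinj : InjOn f (ball 0 1))
    (hr : 1 / 2 < r) (hr1 : r < 1) (n : ℕ) (θ : ℝ) (j : ℕ) : 0 < speed f r n θ j :=
  norm_pos_iff.2 (deriv_ne_zero_of_injOn hf hinj (circleMap_rad_mem hr hr1 n j θ))

lemma continuous_speed (hf : DifferentiableOn ℂ f (ball 0 1)) (hr : 1 / 2 < r) (hr1 : r < 1)
    (n j : ℕ) : Continuous fun θ => speed f r n θ j :=
  (continuous_comp_circleMap_rad (hf.deriv isOpen_ball).continuousOn hr hr1 n j).norm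

lemma continuous_speedDrop (hf : DifferentiableOn ℂ f (ball 0 1)) (hr : 1 / 2 < r) (hr1 : r < 1)
    (n j : ℕ) : Continuous (speedDrop f r n j) :=
  (continuous_runMin (continuous_speed hf hr hr1 n) j).sub
    (continuous_runMin (continuous_speed hf hr hr1 n) (j + 1))

lemma lintegral_testMeasure (hf : DifferentiableOn ℂ f (ball 0 1)) (hr : 1 / 2 < r) (hr1 : r < 1)
    (n : ℕ) {F : ℂ → ℝ≥0∞} (hF : Measurable F) :
    ∫⁻ w, F w ∂(testMeasure f r n) = ∫⁻ θ in Ioo (-Real.pi) Real.pi, ∑ j ∈ Finset.range n,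
      ENNReal.ofReal (speedDrop f r n j θ) * F (f (circleMap 0 (rad r n (j + 1)) θ)) := by
  have hm : ∀ j, Measurable fun θ => f (circleMap 0 (rad r n (j + 1)) θ) := fun j =>
    (continuous_comp_circleMap_rad hf.continuousOn hr hr1 n (j + 1)).measurable
  have hd : ∀ j, Measurable fun θ => ENNReal.ofReal (speedDrop f r n j θ) := fun j =>
    (continuous_speedDrop hf hr hr1 n j).measurable.ennreal_ofReal
  rw [testMeasure, lintegral_finsetSum_measure, lintegral_finsetSum]
  · refine Finset.sum_congr rfl fun j _ => ?_
    rw [lintegral_map hF (hm j)]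
    exact lintegral_withDensity_eq_lintegral_mul _ (hd j) (hF.comp (hm j))
  · exact fun j _ => (hd j).mul (hF.comp (hm j))

/-- The length estimate along a single ray. -/
lemma mul_sum_speedDrop_le (hf : DifferentiableOn ℂ f (ball 0 1)) (hinj : InjOn f (ball 0 1))
    (hne : f '' ball 0 1 ≠ univ) (hr : 1 / 2 < r) (hr1 : r < 1) {n : ℕ}
    (hn : 1 / (n : ℝ) ≤ (1 - r) / 2) {w : ℂ} {R : ℝ} {θ : ℝ}
    (hw : 2 * R ≤ ‖f (circleMap 0 (1 / 2) θ) - w‖) :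
    ENNReal.ofReal R * ∑ j ∈ Finset.range n, ENNReal.ofReal (speedDrop f r n j θ) *
      (ball w R).indicator 1 (f (circleMap 0 (rad r n (j + 1)) θ)) ≤
    ∫⁻ t in Ioc (1 / 2) r, ENNReal.ofReal (2 * distC ^ 2) * (ENNReal.ofReal t *
      (ball 0 1 ∩ f ⁻¹' ball w (2 * R)).indicator (fun z => ENNReal.ofReal (‖deriv f z‖ ^ 2))
        (circleMap 0 t θ)) := by
  set E := ball 0 1 ∩ f ⁻¹' ball w (2 * R) with hE
  have hEo : IsOpen E := hf.continuousOn.isOpen_inter_preimage isOpen_ball isOpen_ball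
  set G : ℝ → ℝ≥0∞ := fun t => E.indicator (fun z => ENNReal.ofReal ‖deriv f z‖)
    (circleMap 0 t θ) with hG
  have hcm : Continuous fun t : ℝ => circleMap 0 t θ := by unfold circleMap; fun_prop
  have hGm : Measurable G :=
    (((measurable_deriv f).norm.ennreal_ofReal).indicator hEo.measurableSet).comp hcm.measurable
  have hmem : ∀ t ∈ Icc (1 / 2) r, circleMap 0 t θ ∈ ball (0 : ℂ) 1 := fun t ht => by
    rw [mem_ball_zero_iff, norm_circleMap_of_half_le ht.1]
    exact ht.2.trans_lt hr1
  have hlen : ∀ j, ENNReal.ofReal R * (ball w R).indicator 1 (f (circleMap 0 (rad r n (j + 1)) θ)) ≤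
      ∫⁻ t in Ioc (1 / 2) r, (Iic (rad r n (j + 1))).indicator G t := by
    intro j
    set s := rad r n (j + 1) with hs
    by_cases hb : f (circleMap 0 s θ) ∈ ball w R
    swap
    · rw [indicator_of_notMem hb, mul_zero]; exact zero_le
    rw [indicator_of_mem hb, Pi.one_apply, mul_one]
    have hs1 := half_le_rad hr n (j + 1)
    have hs2 := rad_le hr n (j + 1)
    have hder : ∀ t ∈ Icc (1 / 2) s, HasDerivAt (fun t : ℝ => f (circleMap 0 t θ) - w)
        (deriv f (circleMap 0 t θ) * Complex.exp (θ * Complex.I)) t := by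
      intro t ht
      have h1 : HasDerivAt (fun t : ℝ => circleMap 0 t θ) (Complex.exp (θ * Complex.I)) t := by
        simp only [circleMap_zero]
        simpa using (Complex.ofRealCLM.hasDerivAt (x := t)).mul_const (Complex.exp (θ * Complex.I))
      have h2 := (hf.differentiableAt (isOpen_ball.mem_nhds
        (hmem t ⟨ht.1, ht.2.trans hs2⟩))).hasDerivAt
      exact (h2.comp t h1).sub_const w
    have hcont : ContinuousOn (fun t : ℝ => deriv f (circleMap 0 t θ) *
        Complex.exp (θ * Complex.I)) (Icc (1 / 2) s) :=
      (((hf.deriv isOpen_ball).continuousOn).comp hcm.continuousOn fun t ht =>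
        hmem t ⟨ht.1, ht.2.trans hs2⟩).mul continuousOn_const
    have hb' : ‖f (circleMap 0 s θ) - w‖ ≤ R := by
      rw [← dist_eq_norm]; exact (mem_ball.1 hb).le
    refine (ofReal_le_length hs1 hder hcont hw hb').trans ?_
    rw [lintegral_indicator measurableSet_Iic, Measure.restrict_restrict measurableSet_Iic]
    refine (setLIntegral_mono' measurableSet_Ioc fun t ht => ?_).trans
      (lintegral_mono_set (s := Ioc (1 / 2) s)
      fun t ht => ⟨ht.2, ht.1, ht.2.trans hs2⟩)
    by_cases h : ‖f (circleMap 0 t θ) - w‖ < 2 * R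
    · have hE' : circleMap 0 t θ ∈ E :=
        ⟨hmem t ⟨ht.1.le, ht.2.trans hs2⟩, by rwa [mem_preimage, mem_ball, dist_eq_norm]⟩
      rw [indicator_of_mem (show t ∈ {t | ‖f (circleMap 0 t θ) - w‖ < 2 * R} from h), hG]
      dsimp only
      rw [indicator_of_mem hE', norm_mul, Complex.norm_exp_ofReal_mul_I, mul_one]
    · rw [indicator_of_notMem (show t ∉ {t | ‖f (circleMap 0 t θ) - w‖ < 2 * R} from h)]
      exact zero_le
  calc ENNReal.ofReal R * ∑ j ∈ Finset.range n, ENNReal.ofReal (speedDrop f r n j θ) *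
        (ball w R).indicator 1 (f (circleMap 0 (rad r n (j + 1)) θ))
      ≤ ∑ j ∈ Finset.range n, ENNReal.ofReal (speedDrop f r n j θ) *
        ∫⁻ t in Ioc (1 / 2) r, (Iic (rad r n (j + 1))).indicator G t := by
        rw [Finset.mul_sum]
        refine Finset.sum_le_sum fun j _ => ?_
        rw [mul_left_comm]
        exact mul_le_mul_right (hlen j) _
    _ = ∫⁻ t in Ioc (1 / 2) r, ∑ j ∈ Finset.range n, ENNReal.ofReal (speedDrop f r n j θ) *
          (Iic (rad r n (j + 1))).indicator G t := by
        rw [lintegral_finsetSum _ fun j _ => (hGm.indicator measurableSet_Iic).const_mul _]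
        refine Finset.sum_congr rfl fun j _ => ?_
        rw [lintegral_const_mul _ (hGm.indicator measurableSet_Iic)]
    _ ≤ _ := by
        refine setLIntegral_mono' measurableSet_Ioc fun t ht => ?_
        have hd0 : 0 ≤ distC ^ 2 := sq_nonneg _
        have htm := hmem t ⟨ht.1.le, ht.2⟩
        have h1 : ∑ j ∈ Finset.range n, ENNReal.ofReal (speedDrop f r n j θ) *
            (Iic (rad r n (j + 1))).indicator G t = G t * ENNReal.ofReal
              (∑ j ∈ Finset.range n, if t ≤ rad r n (j + 1) then speedDrop f r n j θ else 0) := by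
          rw [ENNReal.ofReal_sum_of_nonneg fun j _ => by
            split_ifs
            exacts [speedDrop_nonneg f r n j θ, le_rfl], Finset.mul_sum]
          refine Finset.sum_congr rfl fun j _ => ?_
          by_cases h : t ≤ rad r n (j + 1)
          · rw [indicator_of_mem (mem_Iic.2 h), if_pos h, mul_comm]
          · rw [indicator_of_notMem (by simpa using h), if_neg h]
            simp
        have h2 : (∑ j ∈ Finset.range n, if t ≤ rad r n (j + 1) then speedDrop f r n j θ else 0) ≤
            distC ^ 2 * ‖deriv f (circleMap 0 t θ)‖ := by
          refine sum_runMin_tail_le (speed_pos hf hinj hr hr1 n θ)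
            (P := fun j => t ≤ rad r n (j + 1)) (by positivity)
            (fun j hj => hj.trans (rad_mono hr n (Nat.le_succ _))) fun j hj hj' => ?_
          have hlt : rad r n j < t := by
            rcases hj' with rfl | hj'
            · rw [rad_zero]; exact ht.1
            · rcases Nat.eq_zero_or_pos j with rfl | hpos
              · rw [rad_zero]; exact ht.1
              · rw [Nat.sub_add_cancel hpos] at hj'
                exact not_le.1 hj'
          refine norm_deriv_le_distC hf hinj hne (mem_ball_zero_iff.1 htm) ?_ ?_
          · rw [norm_circleMap_sub_circleMap, norm_circleMap_of_half_le ht.1.le, abs_sub_comm,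
              abs_of_pos (sub_pos.2 hlt)]
            linarith [rad_succ_le hr hr1 n j, ht.2]
          · rw [sub_self, norm_zero]
            linarith [mem_ball_zero_iff.1 htm]
        rw [h1]
        refine (mul_le_mul_right (ENNReal.ofReal_le_ofReal h2) _).trans ?_
        rw [hG]
        dsimp only
        by_cases hE' : circleMap 0 t θ ∈ E
        · rw [indicator_of_mem hE', indicator_of_mem hE', ← ENNReal.ofReal_mul (norm_nonneg _),
            ← ENNReal.ofReal_mul (by linarith [ht.1]), ← ENNReal.ofReal_mul (by positivity)]
          refine ENNReal.ofReal_le_ofReal ?_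
          have : 0 ≤ distC ^ 2 * ‖deriv f (circleMap 0 t θ)‖ ^ 2 := by positivity
          nlinarith [ht.1]
        · rw [indicator_of_notMem hE', indicator_of_notMem hE']
          simp

end

section

variable {f : ℂ → ℂ} {r : ℝ}

lemma lintegral_indicator_deriv_le (hf : DifferentiableOn ℂ f (ball 0 1))
    (hinj : InjOn f (ball 0 1))
    (w : ℂ) (R : ℝ) :
    ∫⁻ z, (ball 0 1 ∩ f ⁻¹' ball w R).indicator (fun z => ENNReal.ofReal (‖deriv f z‖ ^ 2)) z ≤
      volume (ball w R) := by
  have hEo : IsOpen (ball 0 1 ∩ f ⁻¹' ball w R) :=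
    hf.continuousOn.isOpen_inter_preimage isOpen_ball isOpen_ball
  have h := lintegral_image_of_injOn hEo.measurableSet
    (fun z hz => hf.differentiableAt (isOpen_ball.mem_nhds hz.1)) (hinj.mono inter_subset_left)
    fun _ => 1
  simp only [mul_one, lintegral_one, Measure.restrict_apply_univ] at h
  rw [lintegral_indicator hEo.measurableSet, ← h]
  refine measure_mono ?_
  rintro _ ⟨z, hz, rfl⟩
  exact hz.2

lemma sum_speedDrop_le (hf : DifferentiableOn ℂ f (ball 0 1)) (hinj : InjOn f (ball 0 1))
    (hr : 1 / 2 < r) (hr1 : r < 1) (n : ℕ) (θ : ℝ) :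
    ∑ j ∈ Finset.range n, speedDrop f r n j θ ≤ ‖deriv f (circleMap 0 (1 / 2) θ)‖ := by
  have h := Finset.sum_range_sub' (fun j => runMin (speed f r n θ) j) n
  have h0 : runMin (speed f r n θ) 0 = ‖deriv f (circleMap 0 (1 / 2) θ)‖ := by
    simp [runMin, speed]
  have hp := runMin_pos (speed_pos hf hinj hr hr1 n θ) n
  rw [h0] at h
  simp only [speedDrop]
  linarith

lemma testMeasure_ball_le (hf : DifferentiableOn ℂ f (ball 0 1)) (hinj : InjOn f (ball 0 1))
    (hr : 1 / 2 < r) (hr1 : r < 1) {n : ℕ} (hn : 1 / (n : ℝ) ≤ (1 - r) / 2) {w : ℂ}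
    (hw : w ∉ f '' ball 0 1) {R : ℝ} (hR : 0 < R) :
    testMeasure f r n (ball w R) ≤ ENNReal.ofReal (600 * distC ^ 2 * R) := by
  have hne : f '' ball 0 1 ≠ univ := fun h => hw (h ▸ mem_univ w)
  have hd0 : 0 < distC ^ 2 := by have := one_le_distC; positivity
  have hT : testMeasure f r n (ball w R) = ∫⁻ θ in Ioo (-Real.pi) Real.pi, ∑ j ∈ Finset.range n,
      ENNReal.ofReal (speedDrop f r n j θ) *
        (ball w R).indicator 1 (f (circleMap 0 (rad r n (j + 1)) θ)) := by
    rw [← lintegral_testMeasure hf hr hr1 n (measurable_one.indicator measurableSet_ball),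
      lintegral_indicator_one measurableSet_ball]
  by_cases hcase : ∀ θ, 2 * R ≤ ‖f (circleMap 0 (1 / 2) θ) - w‖
  · set H : ℂ → ℝ≥0∞ := (ball 0 1 ∩ f ⁻¹' ball w (2 * R)).indicator
      (fun z => ENNReal.ofReal (‖deriv f z‖ ^ 2)) with hH
    have hEo : IsOpen (ball 0 1 ∩ f ⁻¹' ball w (2 * R)) :=
      hf.continuousOn.isOpen_inter_preimage isOpen_ball isOpen_ball
    have hHm : Measurable H :=
      (((measurable_deriv f).norm.pow_const 2).ennreal_ofReal).indicator hEo.measurableSet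
    have hcm : Continuous fun p : ℝ × ℝ => circleMap 0 p.2 p.1 := by unfold circleMap; fun_prop
    have hjm : Measurable fun p : ℝ × ℝ => ENNReal.ofReal (2 * distC ^ 2) *
        (ENNReal.ofReal p.2 * H (circleMap 0 p.2 p.1)) :=
      (measurable_snd.ennreal_ofReal.mul (hHm.comp hcm.measurable)).const_mul _
    have hθm : ∀ t : ℝ, Measurable fun θ => H (circleMap 0 t θ) := fun t =>
      hHm.comp (continuous_circleMap 0 t).measurable
    have hkey : ENNReal.ofReal R * testMeasure f r n (ball w R) ≤
        ENNReal.ofReal R * ENNReal.ofReal (600 * distC ^ 2 * R) := by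
      calc ENNReal.ofReal R * testMeasure f r n (ball w R)
          ≤ ∫⁻ θ in Ioo (-Real.pi) Real.pi, ∫⁻ t in Ioc (1 / 2) r,
              ENNReal.ofReal (2 * distC ^ 2) * (ENNReal.ofReal t * H (circleMap 0 t θ)) := by
            rw [hT, ← lintegral_const_mul' _ _ ENNReal.ofReal_ne_top]
            exact lintegral_mono fun θ => mul_sum_speedDrop_le hf hinj hne hr hr1 hn (hcase θ)
        _ = ∫⁻ t in Ioc (1 / 2) r, ∫⁻ θ in Ioo (-Real.pi) Real.pi,
              ENNReal.ofReal (2 * distC ^ 2) * (ENNReal.ofReal t * H (circleMap 0 t θ)) :=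
            lintegral_lintegral_swap hjm.aemeasurable
        _ = ENNReal.ofReal (2 * distC ^ 2) * ∫⁻ t in Ioc (1 / 2) r, ENNReal.ofReal t *
              ∫⁻ θ in Ioo (-Real.pi) Real.pi, H (circleMap 0 t θ) := by
            rw [← lintegral_const_mul' _ _ ENNReal.ofReal_ne_top]
            refine lintegral_congr fun t => ?_
            rw [lintegral_const_mul' _ _ ENNReal.ofReal_ne_top,
              lintegral_const_mul' _ _ ENNReal.ofReal_ne_top]
        _ ≤ ENNReal.ofReal (2 * distC ^ 2) * ∫⁻ z, H z := by
            rw [lintegral_polar hHm]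
            exact mul_le_mul_right (lintegral_mono_set fun t ht =>
              (lt_trans (by norm_num) ht.1 : (0 : ℝ) < t)) _
        _ ≤ ENNReal.ofReal (2 * distC ^ 2) * ENNReal.ofReal ((2 * R) ^ 2 * Real.pi) := by
            refine mul_le_mul_right ((lintegral_indicator_deriv_le hf hinj w (2 * R)).trans_eq ?_) _
            rw [Complex.volume_ball, ENNReal.ofReal_mul (p := (2 * R) ^ 2) (by positivity),
              ENNReal.ofReal_pow (by positivity), ← NNReal.coe_real_pi, ENNReal.ofReal_coe_nnreal]
        _ ≤ _ := by
            rw [← ENNReal.ofReal_mul (by positivity), ← ENNReal.ofReal_mul hR.le]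
            refine ENNReal.ofReal_le_ofReal ?_
            have := Real.pi_lt_four
            have : 0 < distC ^ 2 * R ^ 2 := by positivity
            nlinarith
    rwa [ENNReal.mul_le_mul_iff_right (by simpa using hR) ENNReal.ofReal_ne_top] at hkey
  · push Not at hcase
    obtain ⟨θ₀, hθ₀⟩ := hcase
    have hn2 : ∀ θ, ‖circleMap 0 (1 / 2) θ‖ = 1 / 2 := norm_circleMap_of_half_le le_rfl
    have h1 := koebe hf hinj hw (z := circleMap 0 (1 / 2) θ₀) (by rw [hn2]; norm_num)
    rw [hn2] at h1
    have h2 : ∀ θ, ‖deriv f (circleMap 0 (1 / 2) θ)‖ ≤ distC ^ 2 * (86 * R) := fun θ => by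
      refine (norm_deriv_le_distC hf hinj hne (b := 0) (z := circleMap 0 (1 / 2) θ₀) (by simp)
        (by rw [sub_zero, hn2]; simp) (by rw [sub_zero, hn2]; simp)).trans ?_
      gcongr
      linarith
    rw [hT]
    calc _ ≤ ∫⁻ θ in Ioo (-Real.pi) Real.pi, ENNReal.ofReal (distC ^ 2 * (86 * R)) := by
          refine lintegral_mono fun θ => ?_
          refine le_trans ?_ (ENNReal.ofReal_le_ofReal
            ((sum_speedDrop_le hf hinj hr hr1 n θ).trans (h2 θ)))
          rw [ENNReal.ofReal_sum_of_nonneg fun j _ => speedDrop_nonneg f r n j θ]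
          refine Finset.sum_le_sum fun j _ => mul_le_of_le_one_right' ?_
          exact indicator_le_self' (f := (1 : ℂ → ℝ≥0∞)) (fun _ _ => zero_le) _
      _ ≤ _ := by
          rw [setLIntegral_const, Real.volume_Ioo, ← ENNReal.ofReal_mul (by positivity)]
          refine ENNReal.ofReal_le_ofReal ?_
          have := Real.pi_lt_d2
          have : 0 < distC ^ 2 * R := by positivity
          nlinarith

lemma carlesonNorm_testMeasure_le (hf : DifferentiableOn ℂ f (ball 0 1))
    (hinj : InjOn f (ball 0 1)) (hr : 1 / 2 < r) (hr1 : r < 1) {n : ℕ}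
    (hn : 1 / (n : ℝ) ≤ (1 - r) / 2) :
    carlesonNorm (f '' ball 0 1) (testMeasure f r n) ≤ ENNReal.ofReal (600 * distC ^ 2) := by
  refine iSup₂_le fun w hw => iSup₂_le fun R hR => ?_
  have hw' := notMem_of_mem_frontier_image hf hinj hw
  refine ENNReal.div_le_of_le_mul ?_
  rw [← ENNReal.ofReal_mul (by positivity)]
  exact (measure_mono inter_subset_right).trans (testMeasure_ball_le hf hinj hr hr1 hn hw' hR.1)

lemma le_pushForward_testMeasure {g : ℂ → ℂ} (hf : DifferentiableOn ℂ f (ball 0 1))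
    (hinj : InjOn f (ball 0 1)) (hg : ∀ z ∈ ball (0 : ℂ) 1, g (f z) = z)
    (hr : 1 / 2 < r) (hr1 : r < 1) {n : ℕ} (hn : n ≠ 0) :
    ∫⁻ θ in Ioo (-Real.pi) Real.pi, ENNReal.ofReal
        (Real.log ‖deriv f (circleMap 0 (1 / 2) θ)‖ - Real.log ‖deriv f (circleMap 0 r θ)‖) ≤
      pushForward (f '' ball 0 1) g (testMeasure f r n) univ := by
  have ho := isOpen_image_ball hf hinj
  have hgc := (differentiableOn_inverse_of_injOn hf hinj hg).continuousOn
  have h := lintegral_pushForward ho.measurableSet hgc (testMeasure f r n)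
    (h := fun _ => 1) measurable_const
  simp only [lintegral_one, mul_one] at h
  have hdm : Measurable fun w => (‖deriv g w‖₊ : ℝ≥0∞) :=
    (measurable_deriv g).nnnorm.coe_nnreal_ennreal
  rw [h, ← lintegral_indicator ho.measurableSet,
    lintegral_testMeasure hf hr hr1 n (hdm.indicator ho.measurableSet)]
  refine lintegral_mono fun θ => ?_
  have hsum : ∑ j ∈ Finset.range n, ENNReal.ofReal (speedDrop f r n j θ) *
      (f '' ball 0 1).indicator (fun w => (‖deriv g w‖₊ : ℝ≥0∞))
        (f (circleMap 0 (rad r n (j + 1)) θ)) =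
      ENNReal.ofReal (∑ j ∈ Finset.range n, speedDrop f r n j θ / speed f r n θ (j + 1)) := by
    have hv := speed_pos hf hinj hr hr1 n θ
    rw [ENNReal.ofReal_sum_of_nonneg fun j _ =>
      div_nonneg (speedDrop_nonneg f r n j θ) (hv _).le]
    refine Finset.sum_congr rfl fun j _ => ?_
    have hm := circleMap_rad_mem hr hr1 n (j + 1) θ
    rw [indicator_of_mem (mem_image_of_mem f hm), div_eq_mul_inv,
      ENNReal.ofReal_mul (speedDrop_nonneg f r n j θ),
      (hasDerivAt_inverse_of_injOn hf hinj hg hm).deriv, ← enorm_eq_nnnorm, ← ofReal_norm,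
      norm_inv]
    rfl
  rw [hsum]
  refine ENNReal.ofReal_le_ofReal ?_
  have hl := log_sub_log_le_sum_runMin (speed_pos hf hinj hr hr1 n θ) n
  simpa only [speed, speedDrop, rad_zero, rad_self r hn] using hl

end

lemma circleAverage_log_norm_one_add {b : ℂ} (hb : ‖b‖ < 1) {s : ℝ} (hs0 : 0 < s) (hs : s < 1) :
    Real.circleAverage (fun ξ => Real.log ‖1 + conj b * ξ‖) 0 s = 0 := by
  have hmem : ∀ z ∈ closedBall (0 : ℂ) s, 1 + conj b * z ∈ Complex.slitPlane := by
    intro z hz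
    have hz' := mem_closedBall_zero_iff.1 hz
    refine Or.inl ?_
    have h1 : -‖conj b * z‖ ≤ (conj b * z).re := (abs_le.1 (Complex.abs_re_le_norm _)).1
    rw [norm_mul, Complex.norm_conj] at h1
    have h2 : ‖b‖ * ‖z‖ < 1 := by nlinarith [norm_nonneg b, norm_nonneg z]
    simp only [Complex.add_re, Complex.one_re]
    linarith
  have hd : DifferentiableOn ℂ (fun z => Complex.log (1 + conj b * z)) (closedBall 0 s) :=
    fun z hz => (((differentiableAt_id.const_mul (conj b)).const_add 1).clog
      (hmem z hz)).differentiableWithinAt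
  have hdc : DiffContOnCl ℂ (fun z => Complex.log (1 + conj b * z)) (ball 0 |s|) := by
    rw [abs_of_pos hs0]
    exact (hd.mono (closure_ball_subset_closedBall)).diffContOnCl
  have h1 := hdc.circleAverage
  have h2 := Complex.reCLM.circleAverage_comp_comm (f := fun z => Complex.log (1 + conj b * z))
    (c := 0) (R := s) (ContinuousOn.circleIntegrable hs0.le
      (hd.continuousOn.mono sphere_subset_closedBall))
  rw [h1] at h2
  simpa [Function.comp_def, Complex.log_re] using h2

section

variable {φ ψ : ℂ → ℂ}

lemma lintegral_log_deriv_comp_mob_le (hφ : DifferentiableOn ℂ φ (ball 0 1))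
    (hinj : InjOn φ (ball 0 1)) (hψ : ∀ z ∈ ball (0 : ℂ) 1, ψ (φ z) = z) {C : ℝ}
    (hC : ∀ μ : Measure ℂ, IsCarleson (φ '' ball 0 1) μ →
      carlesonNorm unitDisk (pushForward (φ '' ball 0 1) ψ μ) ≤
        ENNReal.ofReal C * carlesonNorm (φ '' ball 0 1) μ) {b : ℂ} (hb : ‖b‖ < 1) {r : ℝ}
    (hr : 1 / 2 < r) (hr1 : r < 1) :
    ∫⁻ θ in Ioo (-Real.pi) Real.pi, ENNReal.ofReal
        (Real.log ‖deriv (φ ∘ mob b) (circleMap 0 (1 / 2) θ)‖ -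
          Real.log ‖deriv (φ ∘ mob b) (circleMap 0 r θ)‖) ≤
      32 * (ENNReal.ofReal C * ENNReal.ofReal (600 * distC ^ 2)) := by
  obtain ⟨m, hm⟩ := exists_nat_one_div_lt (show 0 < (1 - r) / 2 by linarith)
  have hn : 1 / ((m + 1 : ℕ) : ℝ) ≤ (1 - r) / 2 := by push_cast; exact hm.le
  have hb' : ‖-b‖ < 1 := by rwa [norm_neg]
  have ho := isOpen_image_ball hφ hinj
  have hψd := differentiableOn_inverse_of_injOn hφ hinj hψ
  have hψm := mapsTo_inverse hψ
  set μ := testMeasure (φ ∘ mob b) r (m + 1) with hμ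
  have hnorm := carlesonNorm_testMeasure_le (hφ.comp_mob hb) (hinj.comp_mob hb) hr hr1 hn
  rw [image_comp_mob hb] at hnorm
  have hinv : ∀ z ∈ ball (0 : ℂ) 1, (mob (-b) ∘ ψ) ((φ ∘ mob b) z) = z := fun z hz => by
    have hz1 := mem_ball_zero_iff.1 hz
    simp only [Function.comp_apply]
    rw [hψ _ (mem_ball_zero_iff.2 (mob_mem_ball hb hz1)), mob_neg_mob hb hz1.le]
  have h := le_pushForward_testMeasure (hφ.comp_mob hb) (hinj.comp_mob hb) hinv hr hr1
    (Nat.succ_ne_zero m)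
  rw [image_comp_mob hb] at h
  refine h.trans ?_
  have h1 : pushForward (φ '' ball 0 1) (mob (-b) ∘ ψ) μ univ =
      garsia (pushForward (φ '' ball 0 1) ψ μ) b := by
    have h2 := garsia_pushForward_mob ho hψd hψm μ (a := 0) (by simp) hb
    rw [mob_zero] at h2
    rw [← h2]
    simp [garsia, garsiaK]
  have hres : (pushForward (φ '' ball 0 1) ψ μ).restrict unitDisk =
      pushForward (φ '' ball 0 1) ψ μ := by
    refine Measure.restrict_eq_self_of_ae_mem ?_
    have hd : MeasurableSet unitDiskᶜ := (show IsOpen unitDisk from isOpen_ball).measurableSet.compl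
    change pushForward (φ '' ball 0 1) ψ μ unitDiskᶜ = 0
    rw [← lintegral_indicator_one hd, lintegral_pushForward ho.measurableSet hψd.continuousOn _
      (measurable_one.indicator hd), setLIntegral_congr_fun (g := fun _ => 0) ho.measurableSet
      fun w hw => ?_]
    · simp
    · rw [indicator_of_notMem (not_not.2 (hψm hw) : ψ w ∉ unitDiskᶜ), mul_zero]
  rw [h1, ← hres]
  refine (garsia_restrict_le hb).trans (mul_le_mul_right ?_ _)
  exact (hC μ (hnorm.trans_lt ENNReal.ofReal_lt_top)).trans (mul_le_mul_right hnorm _)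

lemma circleAverage_log_deriv_comp_mob_le (hφ : DifferentiableOn ℂ φ (ball 0 1))
    (hinj : InjOn φ (ball 0 1)) (hne : φ '' ball 0 1 ≠ univ)
    (hψ : ∀ z ∈ ball (0 : ℂ) 1, ψ (φ z) = z) {C : ℝ} (hC0 : 0 < C)
    (hC : ∀ μ : Measure ℂ, IsCarleson (φ '' ball 0 1) μ →
      carlesonNorm unitDisk (pushForward (φ '' ball 0 1) ψ μ) ≤
        ENNReal.ofReal C * carlesonNorm (φ '' ball 0 1) μ) {b : ℂ} (hb : ‖b‖ < 1) {r : ℝ}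
    (hr : 1 / 2 < r) (hr1 : r < 1) :
    Real.circleAverage (fun ξ => max (Real.log ‖deriv (φ ∘ mob b) 0‖ -
      Real.log ‖deriv (φ ∘ mob b) ξ‖) 0) 0 r ≤
        2 * Real.log distC + 32 * (C * (600 * distC ^ 2)) := by
  have hd1 := one_le_distC
  have hl0 : 0 ≤ Real.log distC := Real.log_nonneg hd1
  have hf := hφ.comp_mob hb
  have hfi := hinj.comp_mob hb
  have hne' : (φ ∘ mob b) '' ball 0 1 ≠ univ := by rwa [image_comp_mob hb]
  set f := φ ∘ mob b with hfdef
  have hsub : sphere (0 : ℂ) r ⊆ ball 0 1 := fun z hz => by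
    rw [mem_ball_zero_iff, mem_sphere_zero_iff_norm.1 hz]; exact hr1
  have hcont : ContinuousOn (fun ξ => max (Real.log ‖deriv f 0‖ - Real.log ‖deriv f ξ‖) 0)
      (sphere 0 r) := by
    refine ContinuousOn.sup (continuousOn_const.sub (ContinuousOn.log
      ((hf.deriv isOpen_ball).continuousOn.mono hsub).norm fun z hz => ?_)) continuousOn_const
    exact norm_ne_zero_iff.2 (deriv_ne_zero_of_injOn hf hfi (hsub hz))
  have hpt : ∀ θ, Real.log ‖deriv f 0‖ ≤
      2 * Real.log distC + Real.log ‖deriv f (circleMap 0 (1 / 2) θ)‖ := by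
    intro θ
    have hn2 : ‖circleMap 0 (1 / 2) θ‖ = 1 / 2 := norm_circleMap_of_half_le le_rfl θ
    have h0 : 0 < ‖deriv f 0‖ := norm_pos_iff.2 (deriv_ne_zero_of_injOn hf hfi (by simp))
    have h1 : 0 < ‖deriv f (circleMap 0 (1 / 2) θ)‖ :=
      norm_pos_iff.2 (deriv_ne_zero_of_injOn hf hfi (by rw [mem_ball_zero_iff, hn2]; norm_num))
    have h2 := norm_deriv_le_distC hf hfi hne' (b := 0) (y := 0) (z := circleMap 0 (1 / 2) θ)
      (by simp) (by simp) (by rw [sub_zero, hn2]; simp)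
    have h3 := Real.log_le_log h0 h2
    rw [Real.log_mul (by positivity) h1.ne', Real.log_pow] at h3
    exact_mod_cast h3
  have hmain : ENNReal.ofReal (2 * Real.pi * Real.circleAverage (fun ξ =>
      max (Real.log ‖deriv f 0‖ - Real.log ‖deriv f ξ‖) 0) 0 r) ≤
      ENNReal.ofReal (2 * Real.pi * (2 * Real.log distC) + 32 * (C * (600 * distC ^ 2))) := by
    rw [← lintegral_circle (hcont.circleIntegrable (by linarith)) fun z => le_max_right _ _]
    calc _ ≤ ∫⁻ θ in Ioo (-Real.pi) Real.pi, (ENNReal.ofReal (2 * Real.log distC) +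
            ENNReal.ofReal (Real.log ‖deriv f (circleMap 0 (1 / 2) θ)‖ -
              Real.log ‖deriv f (circleMap 0 r θ)‖)) := by
          refine lintegral_mono fun θ => ?_
          have hle : ∀ x y c : ℝ, 0 ≤ c → x ≤ c + y →
              ENNReal.ofReal (max x 0) ≤ ENNReal.ofReal c + ENNReal.ofReal y := by
            intro x y c hc hxy
            rw [ENNReal.ofReal_max, ENNReal.ofReal_zero, max_eq_left zero_le]
            exact (ENNReal.ofReal_le_ofReal hxy).trans ENNReal.ofReal_add_le
          exact hle _ _ _ (by positivity) (by linarith [hpt θ])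
      _ ≤ _ := by
          rw [lintegral_add_left measurable_const, setLIntegral_const, Real.volume_Ioo]
          refine (add_le_add_right (lintegral_log_deriv_comp_mob_le hφ hinj hψ hC hb hr hr1)
            _).trans_eq ?_
          have h32 : (32 : ℝ≥0∞) = ENNReal.ofReal 32 := by norm_num
          rw [h32, ← ENNReal.ofReal_mul hC0.le, ← ENNReal.ofReal_mul (p := 32) (by norm_num),
            ← ENNReal.ofReal_mul (by linarith), ← ENNReal.ofReal_add]
          · congr 1; ring
          · have : 0 ≤ Real.pi - -Real.pi := by linarith [Real.pi_pos]
            exact mul_nonneg (by linarith) this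
          · positivity
  have hpi := Real.pi_gt_three
  have h1 := (ENNReal.ofReal_le_ofReal_iff (by positivity)).1 hmain
  have h2 : 0 ≤ 32 * (C * (600 * distC ^ 2)) := by positivity
  have h3 : 2 * Real.pi * Real.circleAverage (fun ξ =>
      max (Real.log ‖deriv f 0‖ - Real.log ‖deriv f ξ‖) 0) 0 r ≤
      2 * Real.pi * (2 * Real.log distC + 32 * (C * (600 * distC ^ 2))) := by nlinarith
  exact le_of_mul_le_mul_left h3 (by positivity)

lemma exists_circleAverage_log_le {L : ℂ → ℂ} (hφ : DifferentiableOn ℂ φ (ball 0 1))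
    (hinj : InjOn φ (ball 0 1)) (hne : φ '' ball 0 1 ≠ univ)
    (hψ : ∀ z ∈ ball (0 : ℂ) 1, ψ (φ z) = z)
    (hL : DifferentiableOn ℂ L (ball 0 1))
    (hLe : ∀ z ∈ ball (0 : ℂ) 1, Complex.exp (L z) = deriv φ z) {C : ℝ} (hC0 : 0 < C)
    (hC : ∀ μ : Measure ℂ, IsCarleson (φ '' ball 0 1) μ →
      carlesonNorm unitDisk (pushForward (φ '' ball 0 1) ψ μ) ≤
        ENNReal.ofReal C * carlesonNorm (φ '' ball 0 1) μ) :
    ∃ A : ℝ, 0 < A ∧ ∀ b : ℂ, ‖b‖ < 1 → ∀ r : ℝ, 1 / 2 < r → r < 1 →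
      Real.circleAverage (fun ξ => max ((L b).re - (L (mob b ξ)).re) 0) 0 r ≤ A := by
  have hd1 := one_le_distC
  have hl0 : 0 ≤ Real.log distC := Real.log_nonneg hd1
  have hl2 : 0 ≤ Real.log 2 := Real.log_nonneg (by norm_num)
  refine ⟨2 * Real.log distC + 32 * (C * (600 * distC ^ 2)) + 2 * Real.log 2, by positivity,
    fun b hb r hr hr1 => ?_⟩
  have hr0 : 0 < r := by linarith
  have hmain := circleAverage_log_deriv_comp_mob_le hφ hinj hne hψ hC0 hC hb hr hr1
  have hsub : sphere (0 : ℂ) r ⊆ ball 0 1 := fun z hz => by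
    rw [mem_ball_zero_iff, mem_sphere_zero_iff_norm.1 hz]; exact hr1
  have hf := hφ.comp_mob hb
  have hfi := hinj.comp_mob hb
  have hlog : ∀ z ∈ ball (0 : ℂ) 1, Real.log ‖deriv (φ ∘ mob b) z‖ =
      (L (mob b z)).re + Real.log (1 - ‖b‖ ^ 2) - 2 * Real.log ‖1 + conj b * z‖ := by
    intro z hz
    have hz1 := mem_ball_zero_iff.1 hz
    have hp := den_pos hb hz1.le
    have hq : 0 < 1 - ‖b‖ ^ 2 := by nlinarith [norm_nonneg b]
    rw [deriv_comp_mob hφ hb hz1, norm_mul, norm_deriv_mob hb hz1.le,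
      ← hLe _ (mem_ball_zero_iff.2 (mob_mem_ball hb hz1)), Complex.norm_exp,
      Real.log_mul (Real.exp_pos _).ne' (by positivity), Real.log_exp,
      Real.log_div hq.ne' (by positivity), Real.log_pow]
    push_cast
    ring
  have hc1 : ContinuousOn (fun ξ => max ((L b).re - (L (mob b ξ)).re) 0) (sphere 0 r) := by
    have : ContinuousOn (fun ξ => L (mob b ξ)) (sphere 0 r) :=
      (hL.comp_mob hb).continuousOn.mono hsub
    exact ContinuousOn.sup (continuousOn_const.sub (Complex.continuous_re.comp_continuousOn this))
      continuousOn_const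
  have hc2 : ContinuousOn (fun ξ => max (Real.log ‖deriv (φ ∘ mob b) 0‖ -
      Real.log ‖deriv (φ ∘ mob b) ξ‖) 0) (sphere 0 r) := by
    refine ContinuousOn.sup (continuousOn_const.sub (ContinuousOn.log
      ((hf.deriv isOpen_ball).continuousOn.mono hsub).norm fun z hz => ?_)) continuousOn_const
    exact norm_ne_zero_iff.2 (deriv_ne_zero_of_injOn hf hfi (hsub hz))
  have hc3 : ContinuousOn (fun ξ => Real.log ‖1 + conj b * ξ‖) (sphere 0 r) := by
    refine ContinuousOn.log (by fun_prop) fun z hz => ?_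
    exact (den_pos hb (mem_ball_zero_iff.1 (hsub hz)).le).ne'
  have hi2 := hc2.circleIntegrable hr0.le
  have hi3 := hc3.circleIntegrable hr0.le
  have hi4 : CircleIntegrable (fun ξ => 2 * (Real.log 2 - Real.log ‖1 + conj b * ξ‖)) 0 r :=
    (continuousOn_const.mul (continuousOn_const.sub hc3)).circleIntegrable hr0.le
  have havg : Real.circleAverage (fun ξ => 2 * (Real.log 2 - Real.log ‖1 + conj b * ξ‖)) 0 r =
      2 * Real.log 2 := by
    have h1 := Real.circleAverage_fun_smul (𝕜 := ℝ) (a := (2 : ℝ))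
      (f := fun ξ => Real.log 2 - Real.log ‖1 + conj b * ξ‖) (c := 0) (R := r)
    have h2 := Real.circleAverage_fun_sub (c := 0) (R := r)
      (continuousOn_const.circleIntegrable hr0.le : CircleIntegrable (fun _ => Real.log 2) 0 r) hi3
    rw [circleAverage_log_norm_one_add hb hr0 hr1, Real.circleAverage_const, sub_zero] at h2
    simpa only [smul_eq_mul, h2] using h1
  have hle : Real.circleAverage (fun ξ => max ((L b).re - (L (mob b ξ)).re) 0) 0 r ≤
      Real.circleAverage (fun ξ => max (Real.log ‖deriv (φ ∘ mob b) 0‖ -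
        Real.log ‖deriv (φ ∘ mob b) ξ‖) 0 + 2 * (Real.log 2 - Real.log ‖1 + conj b * ξ‖)) 0 r := by
    refine Real.circleAverage_mono (hc1.circleIntegrable hr0.le) (hi2.add hi4) fun ξ hξ => ?_
    rw [abs_of_pos hr0] at hξ
    have hξ1 := mem_ball_zero_iff.1 (hsub hξ)
    have h0 := hlog 0 (by simp)
    have h1 := hlog ξ (hsub hξ)
    rw [mul_zero, add_zero, norm_one, Real.log_one, mul_zero, sub_zero, mob_zero] at h0
    have h2 : Real.log ‖1 + conj b * ξ‖ ≤ Real.log 2 := by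
      refine Real.log_le_log (den_pos hb hξ1.le) ((norm_add_le _ _).trans ?_)
      rw [norm_one, norm_mul, Complex.norm_conj]
      nlinarith [norm_nonneg b, norm_nonneg ξ]
    have h3 := le_max_left (Real.log ‖deriv (φ ∘ mob b) 0‖ -
      Real.log ‖deriv (φ ∘ mob b) ξ‖) 0
    have h4 := le_max_right (Real.log ‖deriv (φ ∘ mob b) 0‖ -
      Real.log ‖deriv (φ ∘ mob b) ξ‖) 0
    refine max_le ?_ ?_ <;> linarith
  rw [Real.circleAverage_fun_add hi2 hi4, havg] at hle
  linarith

end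

/-! ## Dilations -/

section

variable {L : ℂ → ℂ}

lemma differentiableOn_comp_mul {s : ℝ} (hL : DifferentiableOn ℂ L (ball 0 s)) {ρ : ℝ}
    (hρ : 0 < ρ) : DifferentiableOn ℂ (fun z => L (ρ * z)) (ball 0 (s / ρ)) := by
  refine hL.comp (t := ball 0 s) (g := L) (f := fun z => (ρ : ℂ) * z) (by fun_prop) fun z hz => ?_
  have := mem_ball_zero_iff.1 hz
  rw [lt_div_iff₀' hρ] at this
  rwa [mem_ball_zero_iff, norm_mul, Complex.norm_real, Real.norm_eq_abs, abs_of_pos hρ]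

/-- The positive part of a constant minus a harmonic function is subharmonic. -/
lemma posPart_sub_re_le_diskAvg {G : ℂ → ℂ} {R : ℝ} (hR : 1 < R)
    (hG : DifferentiableOn ℂ G (ball 0 R)) (c : ℝ) {z : ℂ} (hz : ‖z‖ < 1) :
    max (c - (G z).re) 0 ≤ diskAvg z (fun ξ => max (c - (G ξ).re) 0) := by
  have hu := (continuousOn_re_of_differentiableOn hR hG).mono
    (sphere_subset_closedBall (x := (0 : ℂ)))
  have hc : ContinuousOn (fun ξ => c - (G ξ).re) (sphere 0 1) := continuousOn_const.sub hu
  have hm : ContinuousOn (fun ξ => max (c - (G ξ).re) 0) (sphere 0 1) :=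
    ContinuousOn.sup hc continuousOn_const
  refine max_le ?_ ?_
  · have h1 := diskAvg_mono hc hm (fun ξ _ => le_max_left _ _) hz
    rwa [diskAvg_sub continuousOn_const hu hz, diskAvg_const, diskAvg_re hR hG hz] at h1
  · have h1 := diskAvg_mono continuousOn_const hm (fun ξ _ => le_max_right (c - (G ξ).re) 0) hz
    rwa [diskAvg_const] at h1

lemma diskAvg_posPart_comp_mul_le (hL : DifferentiableOn ℂ L (ball 0 1)) {A : ℝ}
    (h : ∀ b : ℂ, ‖b‖ < 1 → ∀ r : ℝ, 1 / 2 < r → r < 1 →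
      Real.circleAverage (fun ξ => max ((L b).re - (L (mob b ξ)).re) 0) 0 r ≤ A)
    {ρ : ℝ} (hρ : 0 < ρ) (hρ1 : ρ < 1) {c : ℂ} (hc : ‖c‖ < 1) :
    diskAvg c (fun ξ => max ((L (ρ * c)).re - (L (ρ * ξ)).re) 0) ≤ A := by
  have hnρ : ∀ z : ℂ, ‖(ρ : ℂ) * z‖ = ρ * ‖z‖ := fun z => by
    rw [norm_mul, Complex.norm_real, Real.norm_eq_abs, abs_of_pos hρ]
  set b : ℂ := ρ * c with hbdef
  have hb : ‖b‖ < 1 := by rw [hbdef, hnρ]; nlinarith [norm_nonneg c]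
  have hnb : ‖-b‖ < 1 := by rwa [norm_neg]
  set s₀ := √(1 - (1 - ‖-b‖ ^ 2) * (1 - ρ ^ 2) / 4) with hs₀
  have hs₀1 : s₀ < 1 := by
    rw [hs₀, Real.sqrt_lt' one_pos]
    have h1 : 0 < 1 - ‖-b‖ ^ 2 := by nlinarith [norm_nonneg (-b)]
    have h2 : 0 < 1 - ρ ^ 2 := by nlinarith
    nlinarith [mul_pos h1 h2]
  obtain ⟨s, hs, hs1⟩ := exists_between (max_lt hs₀1 (by norm_num : (1 / 2 : ℝ) < 1))
  have hs2 : s₀ < s := (le_max_left _ _).trans_lt hs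
  have hs3 : 1 / 2 < s := (le_max_right _ _).trans_lt hs
  have hs0 : 0 < s := by linarith
  have hR : 1 < 1 / s := by rwa [lt_div_iff₀ hs0, one_mul]
  have hRρ : 1 < 1 / ρ := by rwa [lt_div_iff₀ hρ, one_mul]
  set G : ℂ → ℂ := fun ζ => (L ∘ mob b) (s * ζ) with hG
  have hGd : DifferentiableOn ℂ G (ball 0 (1 / s)) := differentiableOn_comp_mul (hL.comp_mob hb) hs0
  set H : ℂ → ℝ := fun ξ => max ((L b).re - (G ξ).re) 0 with hH
  have hGc := (continuousOn_re_of_differentiableOn hR hGd).mono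
    (sphere_subset_closedBall (x := (0 : ℂ)))
  have hHc : ContinuousOn H (sphere 0 1) :=
    ContinuousOn.sup (continuousOn_const.sub hGc) continuousOn_const
  have hH0 : diskAvg 0 H ≤ A := by
    have h1 := h b hb s hs3 hs1
    rw [Real.circleAverage_eq_circleAverage_zero_one] at h1
    simpa [diskAvg, hH, hG, mob] using h1
  have hρz : ∀ ξ ∈ closedBall (0 : ℂ) 1, ‖(ρ : ℂ) * ξ‖ ≤ ρ := fun ξ hξ => by
    rw [hnρ]
    nlinarith [mem_closedBall_zero_iff.1 hξ]
  have hFc : ContinuousOn (fun ξ => max ((L b).re - (L (ρ * ξ)).re) 0) (sphere 0 1) :=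
    ContinuousOn.sup (continuousOn_const.sub ((continuousOn_re_of_differentiableOn hRρ
      (differentiableOn_comp_mul hL hρ)).mono sphere_subset_closedBall)) continuousOn_const
  refine le_of_forall_pos_le_add fun ε hε => ?_
  obtain ⟨P, hP⟩ := exists_polynomial_re_near hHc (half_pos hε)
  set Q : ℂ → ℂ := fun z => P.eval (mob (-b) (ρ * z) / s) with hQ
  have hQd : DifferentiableOn ℂ Q (ball 0 (1 / ρ)) := by
    have h1 : DifferentiableOn ℂ (fun z => P.eval (mob (-b) z / s)) (ball 0 1) :=
      P.differentiable.comp_differentiableOn ((differentiableOn_mob hnb).div_const _)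
    exact differentiableOn_comp_mul h1 hρ
  have hQc := (continuousOn_re_of_differentiableOn hRρ hQd).mono
    (sphere_subset_closedBall (x := (0 : ℂ)))
  have hmono := diskAvg_mono hFc (hQc.add continuousOn_const) (fun ξ hξ => ?_) hc (h₂ := fun ξ =>
    (Q ξ).re + ε / 2)
  · refine hmono.trans ?_
    rw [diskAvg_add hQc continuousOn_const hc, diskAvg_re hRρ hQd hc, diskAvg_const]
    have h1 := (abs_le.1 (abs_re_sub_diskAvg_le hHc hP (z := 0) (by simp))).2
    have h2 : Q c = P.eval 0 := by simp only [hQ, ← hbdef, mob_neg_self, zero_div]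
    rw [h2]
    linarith
  · have hξ1 := hρz ξ (sphere_subset_closedBall hξ)
    set z : ℂ := mob (-b) (ρ * ξ) / s with hz
    have hz1 : ‖z‖ < 1 := by
      rw [hz, norm_div, Complex.norm_real, Real.norm_eq_abs, abs_of_pos hs0, div_lt_one hs0]
      exact (norm_mob_le_of_norm_le hnb hρ1 hξ1).trans_lt hs2
    have hGz : G z = L (ρ * ξ) := by
      have hs' : (s : ℂ) ≠ 0 := Complex.ofReal_ne_zero.2 hs0.ne'
      simp only [hG, hz, Function.comp_apply]
      rw [mul_div_cancel₀ _ hs', mob_mob_neg hb (hξ1.trans hρ1.le)]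
    have h1 := posPart_sub_re_le_diskAvg hR hGd (L b).re hz1
    have h2 := (abs_le.1 (abs_re_sub_diskAvg_le hHc hP hz1)).1
    rw [hGz] at h1
    change _ ≤ (P.eval z).re + ε / 2
    linarith

lemma dirichlet_comp_mob_le_of_dilate (hL : DifferentiableOn ℂ L (ball 0 1)) {S : ℝ≥0∞} {b : ℂ}
    (hb : ‖b‖ < 1)
    (h : ∀ ρ : ℝ, 0 < ρ → ρ < 1 → dirichlet (deriv ((fun z => L (ρ * z)) ∘ mob b)) ≤ S) :
    dirichlet (deriv (L ∘ mob b)) ≤ S := by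
  obtain ⟨u, -, hu, hut⟩ := exists_seq_strictMono_tendsto' (one_pos (α := ℝ))
  set F : ℕ → ℂ → ℝ≥0∞ := fun k z => ENNReal.ofReal (garsiaK b z *
    (‖deriv (fun z => L (u k * z)) z‖ ^ 2 * (1 - ‖z‖ ^ 2))) with hF
  have hFm : ∀ k, Measurable (F k) := fun k => by
    have h1 := measurable_deriv (fun z => L (u k * z))
    have h2 := measurable_garsiaK b
    exact (h2.mul ((h1.norm.pow_const 2).mul
      (measurable_const.sub (measurable_norm.pow_const 2)))).ennreal_ofReal
  have hFS : ∀ k, ∫⁻ z in ball (0 : ℂ) 1, F k z ≤ S := fun k => by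
    have h1 : DifferentiableOn ℂ (fun z => L (u k * z)) (ball 0 1) :=
      (differentiableOn_comp_mul hL (hu k).1).mono (ball_subset_ball
        (by rw [le_div_iff₀ (hu k).1, one_mul]; exact (hu k).2.le))
    rw [hF, ← dirichlet_comp_mob h1 hb]
    exact h _ (hu k).1 (hu k).2
  have hlim : ∀ z ∈ ball (0 : ℂ) 1, Tendsto (fun k => F k z) atTop (𝓝 (ENNReal.ofReal
      (garsiaK b z * (‖deriv L z‖ ^ 2 * (1 - ‖z‖ ^ 2))))) := by
    intro z hz
    have hut' : Tendsto (fun k => (u k : ℂ) * z) atTop (𝓝 z) := by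
      simpa using ((Complex.continuous_ofReal.tendsto 1).comp hut).mul_const z
    have hd : Tendsto (fun k => deriv L (u k * z)) atTop (𝓝 (deriv L z)) :=
      (((hL.deriv isOpen_ball).continuousOn.continuousAt
        (isOpen_ball.mem_nhds hz)).tendsto).comp hut'
    have hd' : Tendsto (fun k => deriv (fun z => L (u k * z)) z) atTop (𝓝 (deriv L z)) := by
      have h1 : ∀ k, deriv (fun z => L (u k * z)) z = u k * deriv L (u k * z) := fun k => by
        simpa using deriv_comp_mul_left (u k : ℂ) L z
      simp only [h1]
      simpa using ((Complex.continuous_ofReal.tendsto 1).comp hut).mul hd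
    exact (ENNReal.continuous_ofReal.tendsto _).comp
      (((hd'.norm.pow 2).mul_const _).const_mul _)
  rw [dirichlet_comp_mob hL hb,
    setLIntegral_congr_fun measurableSet_ball fun z hz => ((hlim z hz).liminf_eq).symm]
  refine (lintegral_liminf_le hFm).trans ?_
  exact (liminf_le_liminf (Eventually.of_forall hFS)).trans_eq (by simp)

end

lemma isCarleson_bmoaMeasure_of_pushForward {φ ψ : ℂ → ℂ} (hφ : DifferentiableOn ℂ φ (ball 0 1))
    (hinj : InjOn φ (ball 0 1)) (hne : φ '' ball 0 1 ≠ univ)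
    (hψ : ∀ z ∈ ball (0 : ℂ) 1, ψ (φ z) = z) {C : ℝ} (hC0 : 0 < C)
    (hC : ∀ μ : Measure ℂ, IsCarleson (φ '' ball 0 1) μ →
      carlesonNorm unitDisk (pushForward (φ '' ball 0 1) ψ μ) ≤
        ENNReal.ofReal C * carlesonNorm (φ '' ball 0 1) μ) :
    IsCarleson unitDisk (bmoaMeasure φ) := by
  obtain ⟨L, hL, hLe⟩ := exists_log_of_ne_zero (hφ.deriv isOpen_ball)
    fun z hz => deriv_ne_zero_of_injOn hφ hinj hz
  have hLd : DifferentiableOn ℂ L (ball 0 1) := fun z hz =>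
    (hL z hz).differentiableAt.differentiableWithinAt
  obtain ⟨A, hA, h⟩ := exists_circleAverage_log_le hφ hinj hne hψ hLd hLe hC0 hC
  refine (carlesonNorm_le_of_garsia (S := ENNReal.ofReal (2 ^ 14 * A ^ 2)) fun b hb => ?_).trans_lt
    (ENNReal.mul_lt_top (by norm_num) ENNReal.ofReal_lt_top)
  rw [garsia_bmoaMeasure hL hb]
  refine dirichlet_comp_mob_le_of_dilate hLd hb fun ρ hρ hρ1 => ?_
  exact dirichlet_comp_mob_le (R := 1 / ρ) (by rwa [lt_div_iff₀ hρ, one_mul])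
    (differentiableOn_comp_mul hLd hρ) hA
    (fun c hc => diskAvg_posPart_comp_mul_le hLd h hρ hρ1 hc) hb

end

/-- `log φ′ ∈ BMOA(Δ)` — in its Carleson-measure formulation:
`|φ″/φ′|²(1-|z|²) dxdy ∈ CM(Δ)` — iff the pull-back operator `φ*` (push-forward along
the inverse map `ψ = φ⁻¹`) is bounded from `CM(Ω)` to `CM(Δ)`. -/
theorem stmt_5 (φ ψ : ℂ → ℂ) (Ω : Set ℂ)
    (hΩopen : IsOpen Ω) (hΩne : Ω.Nonempty) (hΩproper : Ω ≠ Set.univ)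
    (hΩconn : IsConnected Ω) (hΩsc : SimplyConnectedSpace Ω)
    (hdiff : DifferentiableOn ℂ φ unitDisk)
    (hinj : Set.InjOn φ unitDisk)
    (honto : φ '' unitDisk = Ω)
    (hψφ : ∀ z ∈ unitDisk, ψ (φ z) = z)
    (hφψ : ∀ w ∈ Ω, φ (ψ w) = w) :
    IsCarleson unitDisk (bmoaMeasure φ) ↔
      ∃ C : ℝ, 0 < C ∧ ∀ μ : Measure ℂ, IsCarleson Ω μ →
        IsCarleson unitDisk (pushForward Ω ψ μ) ∧
        carlesonNorm unitDisk (pushForward Ω ψ μ) ≤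
          ENNReal.ofReal C * carlesonNorm Ω μ := by
  subst honto
  have hne : φ '' ball 0 1 ≠ univ := hΩproper
  constructor
  · intro h
    obtain ⟨C, hC0, hC⟩ := exists_carlesonNorm_pushForward_le hdiff hinj hne hψφ h
    exact ⟨C, hC0, fun μ hμ =>
      ⟨(hC μ hμ).trans_lt (ENNReal.mul_lt_top ENNReal.ofReal_lt_top hμ), hC μ hμ⟩⟩
  · rintro ⟨C, hC0, hC⟩
    exact isCarleson_bmoaMeasure_of_pushForward hdiff hinj hne hψφ hC0 fun μ hμ => (hC μ hμ).2
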